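/- Let λ ∈ (0,1); let μ ≠ δ₀ be a symmetric Borel probability measure on ℝ that is ⊞_λ-infinitely divisible with rectangular R-transform C, and let ν, ρ be symmetric Borel probability measures on ℝ such that ρ is the rectangular free convolution μ ⊞_λ ν. Then the singular part of ρ with respect to Lebesgue measure is carried by a closed subset of ℝ of Lebesgue measure zero, and there is a closed subset S ⊆ ℝ of Lebesgue measure zero such that the absolutely continuous part of ρ admits a density that is continuous on ℝ∖S. -/

import Mathlib

open MeasureTheory Complex Set Filter Topology

noncomputable section

/-- The upper half-plane. -/
def UHP : Set ℂ := {z : ℂ | 0 < z.im}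

/-- The nonnegative real axis, viewed as a subset of `ℂ`. -/
def posAxis : Set ℂ := {z : ℂ | z.im = 0 ∧ 0 ≤ z.re}

/-- `M_μ(z) = ∫ z t² / (1 - z t²) dμ(t)`. -/
def Mt (μ : Measure ℝ) (z : ℂ) : ℂ := ∫ t : ℝ, z * (t : ℂ) ^ 2 / (1 - z * (t : ℂ) ^ 2) ∂μ

/-- `H_μ(z) = z (1 + M_μ(z)) (1 + λ M_μ(z))`. -/
def Ht (l : ℝ) (μ : Measure ℝ) (z : ℂ) : ℂ :=
  z * (1 + Mt μ z) * (1 + (l : ℂ) * Mt μ z)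

/-- `T(w) = (λ w + 1)(w + 1)`. -/
def Tfun (l : ℝ) (w : ℂ) : ℂ := ((l : ℂ) * w + 1) * (w + 1)

/-- The rectangular `R`-transform with Lévy measure `G`:
`C(z) = z ∫ (1+t²)/(1-z t²) dG(t)`. -/
def rectC (G : Measure ℝ) (z : ℂ) : ℂ :=
  z * ∫ t : ℝ, (1 + (t : ℂ) ^ 2) / (1 - z * (t : ℂ) ^ 2) ∂G

/-- `μ` is `⊞_λ`-infinitely divisible with rectangular `R`-transform `C = rectC G`:
`H_μ(x) = x T(C(H_μ(x)))` for `x < 0` close to `0`. -/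
def IsRectInfDiv (l : ℝ) (μ G : Measure ℝ) : Prop :=
  ∃ ε > (0 : ℝ), ∀ x ∈ Set.Ioo (-ε) (0 : ℝ),
    Ht l μ (x : ℂ) = (x : ℂ) * Tfun l (rectC G (Ht l μ (x : ℂ)))

/-- `ρ` is the rectangular free convolution `μ ⊞_λ ν`, where `μ` has rectangular
`R`-transform `rectC G`. -/
def IsRectConv (l : ℝ) (G ν ρ : Measure ℝ) : Prop :=
  ∃ ε > (0 : ℝ), ∀ x ∈ Set.Ioo (-ε) (0 : ℝ),
    Tfun l (Mt ρ (x : ℂ) - rectC G (Ht l ρ (x : ℂ))) ≠ 0 ∧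
    Ht l ρ (x : ℂ) =
      Ht l ν (Ht l ρ (x : ℂ) / Tfun l (Mt ρ (x : ℂ) - rectC G (Ht l ρ (x : ℂ))))


/-! ### Part 1: a family of integral kernels -/

/-- A kernel `t ↦ k t / (α t + h β t)`. -/
structure Ker where
  k : ℝ → ℝ
  α : ℝ → ℝ
  β : ℝ → ℝ
  mk' : Measurable k
  mα : Measurable α
  mβ : Measurable β
  bk : ∀ t, |k t| ≤ 1 + t ^ 2
  bβ : ∀ t, |β t| ≤ 1 + t ^ 2
  nd : ∀ (h : ℂ) (t : ℝ), (α t : ℂ) + h * (β t : ℂ) = 0 → k t * β t ≠ 0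

namespace Ker

variable (κ : Ker)

/-- denominator -/
def den (h : ℂ) (t : ℝ) : ℂ := (κ.α t : ℂ) + h * (κ.β t : ℂ)

/-- the transform -/
def I (σ : Measure ℝ) (h : ℂ) : ℂ := ∫ t, (κ.k t : ℂ) / κ.den h t ∂σ

/-- the square transform -/
def W (σ : Measure ℝ) (h : ℂ) : ENNReal :=
  ∫⁻ t, ENNReal.ofReal |κ.k t * κ.β t| * (‖κ.den h t‖ₑ ^ 2)⁻¹ ∂σ

/-- points where the denominators are bounded below -/
def Good (σ : Measure ℝ) (h : ℂ) : Prop :=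
  ∃ c > (0 : ℝ), ∀ᵐ t ∂σ, c * (1 + t ^ 2) ≤ ‖κ.den h t‖

lemma measurable_den (h : ℂ) : Measurable (κ.den h) := by
  unfold den
  have h1 := κ.mα
  have h2 := κ.mβ
  fun_prop

lemma measurable_quot (h : ℂ) : Measurable (fun t => (κ.k t : ℂ) / κ.den h t) := by
  have h1 := κ.mk'
  have h2 := κ.measurable_den h
  fun_prop

lemma den_sub (h h' : ℂ) (t : ℝ) : κ.den h t - κ.den h' t = (h - h') * (κ.β t : ℂ) := by
  unfold den; ring

lemma den_lower {h h' : ℂ} {c t : ℝ} (hc : c * (1 + t ^ 2) ≤ ‖κ.den h t‖)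
    (hh : ‖h' - h‖ ≤ c / 2) : c / 2 * (1 + t ^ 2) ≤ ‖κ.den h' t‖ := by
  have h1 := κ.den_sub h' h t
  have h2 : ‖κ.den h' t - κ.den h t‖ ≤ c / 2 * (1 + t ^ 2) := by
    rw [h1, norm_mul, Complex.norm_real, Real.norm_eq_abs]
    exact mul_le_mul hh (κ.bβ t) (abs_nonneg _) ((norm_nonneg _).trans hh)
  have h3 := norm_sub_norm_le (κ.den h t) (κ.den h' t)
  rw [norm_sub_rev] at h3
  linarith

lemma isOpen_good (σ : Measure ℝ) : IsOpen {h | κ.Good σ h} := by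
  rw [Metric.isOpen_iff]
  rintro h ⟨c, hc, hh⟩
  refine ⟨c / 2, by positivity, fun h' hh' => ⟨c / 2, by positivity, ?_⟩⟩
  filter_upwards [hh] with t ht
  refine κ.den_lower ht ?_
  rw [Metric.mem_ball, dist_eq_norm] at hh'
  exact hh'.le

variable {κ}

lemma Good.integrable {σ : Measure ℝ} [IsFiniteMeasure σ] {h : ℂ} (hg : κ.Good σ h) :
    Integrable (fun t => (κ.k t : ℂ) / κ.den h t) σ := by
  obtain ⟨c, hc, hh⟩ := hg
  refine Integrable.of_bound (κ.measurable_quot h).aestronglyMeasurable (1 / c) ?_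
  filter_upwards [hh] with t ht
  rw [norm_div, Complex.norm_real, Real.norm_eq_abs]
  have h1 := κ.bk t
  have h0 : 0 < 1 + t ^ 2 := by positivity
  have h2 : 0 < ‖κ.den h t‖ := lt_of_lt_of_le (by positivity) ht
  rw [div_le_div_iff₀ h2 hc]
  nlinarith

/-- real integrand of `W` -/
def wr (κ : Ker) (h : ℂ) (t : ℝ) : ℝ := |κ.k t * κ.β t| / ‖κ.den h t‖ ^ 2

lemma measurable_wr (h : ℂ) : Measurable (κ.wr h) := by
  have h1 := κ.mk'
  have h2 := κ.mβ
  have h3 := κ.measurable_den h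
  unfold wr
  fun_prop

lemma wr_nonneg (h : ℂ) (t : ℝ) : 0 ≤ κ.wr h t := by unfold wr; positivity

lemma W_integrand_eq {h : ℂ} {t : ℝ} (hd : κ.den h t ≠ 0) :
    ENNReal.ofReal |κ.k t * κ.β t| * (‖κ.den h t‖ₑ ^ 2)⁻¹ = ENNReal.ofReal (κ.wr h t) := by
  unfold wr
  have h0 : 0 < ‖κ.den h t‖ ^ 2 := by have := norm_pos_iff.mpr hd; positivity
  rw [ENNReal.ofReal_div_of_pos h0, ENNReal.div_eq_inv_mul, mul_comm,
    ENNReal.ofReal_pow (norm_nonneg _), ofReal_norm]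

lemma Good.den_ne {σ : Measure ℝ} {h : ℂ} (hg : κ.Good σ h) : ∀ᵐ t ∂σ, κ.den h t ≠ 0 := by
  obtain ⟨c, hc, hh⟩ := hg
  filter_upwards [hh] with t ht h0
  rw [h0, norm_zero] at ht
  nlinarith [sq_nonneg t]

lemma Good.integrable_wr {σ : Measure ℝ} [IsFiniteMeasure σ] {h : ℂ} (hg : κ.Good σ h) :
    Integrable (κ.wr h) σ := by
  obtain ⟨c, hc, hh⟩ := hg
  refine Integrable.of_bound (measurable_wr h).aestronglyMeasurable (1 / c ^ 2) ?_
  filter_upwards [hh] with t ht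
  rw [Real.norm_eq_abs, abs_of_nonneg (wr_nonneg h t), wr]
  have h0 : 0 < 1 + t ^ 2 := by positivity
  have h2 : 0 < ‖κ.den h t‖ := lt_of_lt_of_le (by positivity) ht
  rw [div_le_div_iff₀ (by positivity) (by positivity), abs_mul, one_mul]
  have h3 : |κ.k t| * |κ.β t| ≤ (1 + t ^ 2) * (1 + t ^ 2) :=
    mul_le_mul (κ.bk t) (κ.bβ t) (abs_nonneg _) h0.le
  calc |κ.k t| * |κ.β t| * c ^ 2 ≤ (1 + t ^ 2) * (1 + t ^ 2) * c ^ 2 := by gcongr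
    _ = (c * (1 + t ^ 2)) ^ 2 := by ring
    _ ≤ ‖κ.den h t‖ ^ 2 := by gcongr

lemma Good.W_eq {σ : Measure ℝ} [IsFiniteMeasure σ] {h : ℂ} (hg : κ.Good σ h) :
    κ.W σ h = ENNReal.ofReal (∫ t, κ.wr h t ∂σ) := by
  rw [ofReal_integral_eq_lintegral_ofReal hg.integrable_wr (ae_of_all _ (wr_nonneg h)), W]
  refine lintegral_congr_ae ?_
  filter_upwards [hg.den_ne] with t ht
  exact W_integrand_eq ht

lemma W_den_ne {σ : Measure ℝ} {h : ℂ} (hW : κ.W σ h ≠ ⊤) : ∀ᵐ t ∂σ, κ.den h t ≠ 0 := by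
  have hm : Measurable (fun t => ENNReal.ofReal |κ.k t * κ.β t| * (‖κ.den h t‖ₑ ^ 2)⁻¹) := by
    have h1 := κ.mk'
    have h2 := κ.mβ
    have h3 := κ.measurable_den h
    fun_prop
  filter_upwards [ae_lt_top hm hW] with t ht h0
  rw [h0] at ht
  have := κ.nd h t h0
  have h2 : ENNReal.ofReal |κ.k t * κ.β t| ≠ 0 := by
    rw [Ne, ENNReal.ofReal_eq_zero, not_le]; exact abs_pos.mpr this
  rw [enorm_zero, zero_pow two_ne_zero, ENNReal.inv_zero, ENNReal.mul_top h2] at ht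
  exact lt_irrefl _ ht

lemma W_integrable_wr {σ : Measure ℝ} {h : ℂ} (hW : κ.W σ h ≠ ⊤) :
    Integrable (κ.wr h) σ ∧ (κ.W σ h).toReal = ∫ t, κ.wr h t ∂σ := by
  have h1 : κ.W σ h = ∫⁻ t, ENNReal.ofReal (κ.wr h t) ∂σ := by
    refine lintegral_congr_ae ?_
    filter_upwards [W_den_ne hW] with t ht
    exact W_integrand_eq ht
  constructor
  · refine ⟨(measurable_wr h).aestronglyMeasurable, ?_⟩
    rw [hasFiniteIntegral_iff_ofReal (ae_of_all _ (wr_nonneg h)), ← h1]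
    exact hW.lt_top
  · rw [integral_eq_lintegral_of_nonneg_ae (ae_of_all _ (wr_nonneg h))
      (measurable_wr h).aestronglyMeasurable, h1]

lemma lip {σ : Measure ℝ} [IsFiniteMeasure σ] {h h' : ℂ} (hg : κ.Good σ h)
    (hW : κ.W σ h' ≠ ⊤) :
    Integrable (fun t => (κ.k t : ℂ) / κ.den h' t) σ ∧
    ‖κ.I σ h - κ.I σ h'‖ ≤ ‖h - h'‖ * ((∫ t, κ.wr h t ∂σ) + (κ.W σ h').toReal) := by
  obtain ⟨i1, e1⟩ := W_integrable_wr hW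
  have i2 := hg.integrable_wr
  have hb : ∀ᵐ t ∂σ, ‖(κ.k t : ℂ) / κ.den h t - (κ.k t : ℂ) / κ.den h' t‖
      ≤ ‖h - h'‖ * (κ.wr h t + κ.wr h' t) := by
    filter_upwards [hg.den_ne, W_den_ne hW] with t h1 h2
    have h3 : (κ.k t : ℂ) / κ.den h t - (κ.k t : ℂ) / κ.den h' t
        = -(h - h') * ((κ.k t * κ.β t : ℝ) : ℂ) / (κ.den h t * κ.den h' t) := by
      rw [div_sub_div _ _ h1 h2]
      congr 1
      have := κ.den_sub h h' t
      push_cast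
      linear_combination (-(κ.k t : ℂ)) * this
    have p1 := norm_pos_iff.mpr h1
    have p2 := norm_pos_iff.mpr h2
    rw [h3, norm_div, norm_mul, norm_neg, norm_mul, Complex.norm_real, Real.norm_eq_abs, mul_div_assoc]
    refine mul_le_mul_of_nonneg_left ?_ (norm_nonneg _)
    unfold wr
    have h4 : (‖κ.den h t‖ * ‖κ.den h' t‖)⁻¹ ≤ (‖κ.den h t‖ ^ 2)⁻¹ + (‖κ.den h' t‖ ^ 2)⁻¹ := by
      rw [mul_inv, ← inv_pow, ← inv_pow]
      nlinarith [sq_nonneg (‖κ.den h t‖⁻¹ - ‖κ.den h' t‖⁻¹), inv_pos.mpr p1, inv_pos.mpr p2,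
        mul_pos (inv_pos.mpr p1) (inv_pos.mpr p2)]
    rw [div_eq_mul_inv, div_eq_mul_inv, div_eq_mul_inv, ← mul_add]
    exact mul_le_mul_of_nonneg_left h4 (abs_nonneg _)
  have i3 : Integrable (fun t => ‖h - h'‖ * (κ.wr h t + κ.wr h' t)) σ := (i2.add i1).const_mul _
  have m1 := (κ.measurable_quot h).aestronglyMeasurable (μ := σ)
  have m2 := (κ.measurable_quot h').aestronglyMeasurable (μ := σ)
  have i4 : Integrable (fun t => (κ.k t : ℂ) / κ.den h t - (κ.k t : ℂ) / κ.den h' t) σ :=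
    i3.mono' (m1.sub m2) hb
  have i5 : Integrable (fun t => (κ.k t : ℂ) / κ.den h' t) σ := by
    have := hg.integrable.sub i4
    refine this.congr (ae_of_all _ fun t => ?_)
    simp
  refine ⟨i5, ?_⟩
  rw [e1, I, I, ← integral_sub hg.integrable i5, ← integral_add i2 i1, ← integral_const_mul]
  exact norm_integral_le_of_norm_le i3 hb

lemma Good.differentiableAt {σ : Measure ℝ} [IsFiniteMeasure σ] {h : ℂ} (hg : κ.Good σ h) :
    DifferentiableAt ℂ (κ.I σ) h := by
  have hg' := hg
  obtain ⟨c, hc, hh⟩ := hg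
  have key := hasDerivAt_integral_of_dominated_loc_of_deriv_le (𝕜 := ℂ) (μ := σ)
    (F := fun h t => (κ.k t : ℂ) / κ.den h t)
    (F' := fun h t => -((κ.k t : ℂ) * κ.β t) / (κ.den h t) ^ 2) (x₀ := h)
    (s := Metric.ball h (c / 2)) (bound := fun _ => 4 / c ^ 2)
    (Metric.ball_mem_nhds _ (by positivity))
    (Eventually.of_forall fun x => (κ.measurable_quot x).aestronglyMeasurable)
    hg'.integrable ?_ ?_ (integrable_const _) ?_
  · exact key.2.differentiableAt
  · have h1 := κ.mk'
    have h2 := κ.mβ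
    have h3 := κ.measurable_den h
    have : Measurable (fun t => -((κ.k t : ℂ) * κ.β t) / (κ.den h t) ^ 2) := by fun_prop
    exact this.aestronglyMeasurable
  · filter_upwards [hh] with t ht x hx
    rw [Metric.mem_ball, dist_eq_norm] at hx
    have h5 := κ.den_lower ht hx.le
    have h0 : 0 < 1 + t ^ 2 := by positivity
    have h2 : 0 < ‖κ.den x t‖ := lt_of_lt_of_le (by positivity) h5
    rw [norm_div, norm_neg, norm_mul, norm_pow, Complex.norm_real, Complex.norm_real,
      Real.norm_eq_abs, Real.norm_eq_abs, div_le_div_iff₀ (by positivity) (by positivity)]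
    have h3 : |κ.k t| * |κ.β t| ≤ (1 + t ^ 2) * (1 + t ^ 2) :=
      mul_le_mul (κ.bk t) (κ.bβ t) (abs_nonneg _) h0.le
    calc |κ.k t| * |κ.β t| * c ^ 2 ≤ (1 + t ^ 2) * (1 + t ^ 2) * c ^ 2 := by gcongr
      _ = 4 * (c / 2 * (1 + t ^ 2)) ^ 2 := by ring
      _ ≤ 4 * ‖κ.den x t‖ ^ 2 := by gcongr
  · filter_upwards [hh] with t ht x hx
    rw [Metric.mem_ball, dist_eq_norm] at hx
    have h5 := κ.den_lower ht hx.le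
    have h2 : κ.den x t ≠ 0 := norm_pos_iff.mp (lt_of_lt_of_le (by positivity) h5)
    have hd : HasDerivAt (fun x => κ.den x t) (κ.β t : ℂ) x := by
      unfold den
      simpa using ((hasDerivAt_id x).mul_const (κ.β t : ℂ)).const_add (κ.α t : ℂ)
    have := (hasDerivAt_const x (κ.k t : ℂ)).div hd h2
    simp only [zero_mul, zero_sub] at this
    exact this

lemma W_le_of_tendsto {ι : Type*} {L : Filter ι} [L.NeBot] [L.IsCountablyGenerated]
    {σ : Measure ℝ} {q : ι → ℂ} {q' : ℂ}
    (hq : Tendsto q L (𝓝 q')) {K : ENNReal} (hK : ∀ᶠ n in L, κ.W σ (q n) ≤ K) :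
    κ.W σ q' ≤ K := by
  have hm : ∀ h, Measurable (fun t => ENNReal.ofReal |κ.k t * κ.β t| * (‖κ.den h t‖ₑ ^ 2)⁻¹) := by
    intro h
    have h1 := κ.mk'
    have h2 := κ.mβ
    have h3 := κ.measurable_den h
    fun_prop
  have h1 : κ.W σ q' = ∫⁻ t, liminf (fun n =>
      ENNReal.ofReal |κ.k t * κ.β t| * (‖κ.den (q n) t‖ₑ ^ 2)⁻¹) L ∂σ := by
    refine lintegral_congr fun t => ?_
    symm
    apply Tendsto.liminf_eq
    refine ENNReal.Tendsto.const_mul ?_ (Or.inr ENNReal.ofReal_ne_top)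
    refine (continuous_inv.tendsto _).comp ?_
    refine ((ENNReal.continuous_pow 2).tendsto _).comp ?_
    refine (continuous_enorm.tendsto _).comp ?_
    unfold den
    exact (hq.mul_const _).const_add _
  rw [h1]
  refine (lintegral_liminf_le fun n => hm (q n)).trans ?_
  exact liminf_le_of_frequently_le' hK.frequently

lemma I_tendsto {ι : Type*} {L : Filter ι} [L.NeBot] [L.IsCountablyGenerated]
    {σ : Measure ℝ} [IsFiniteMeasure σ] {q : ι → ℂ} {q' : ℂ}
    (hq : Tendsto q L (𝓝 q')) {K : ℝ} (hg : ∀ᶠ n in L, κ.Good σ (q n))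
    (hK : ∀ᶠ n in L, ∫ t, κ.wr (q n) t ∂σ ≤ K) :
    κ.W σ q' ≤ ENNReal.ofReal K ∧ Tendsto (fun n => κ.I σ (q n)) L (𝓝 (κ.I σ q')) := by
  have h1 : κ.W σ q' ≤ ENNReal.ofReal K := by
    refine W_le_of_tendsto hq ?_
    filter_upwards [hg, hK] with n h1 h2
    rw [h1.W_eq]
    exact ENNReal.ofReal_le_ofReal h2
  have h2 : κ.W σ q' ≠ ⊤ := (h1.trans_lt ENNReal.ofReal_lt_top).ne
  refine ⟨h1, ?_⟩
  rw [tendsto_iff_norm_sub_tendsto_zero]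
  have h3 : Tendsto (fun n => ‖q n - q'‖ * (K + (κ.W σ q').toReal)) L (𝓝 0) := by
    have := (tendsto_iff_norm_sub_tendsto_zero.mp hq).mul_const (K + (κ.W σ q').toReal)
    simpa using this
  refine squeeze_zero' (Eventually.of_forall fun n => norm_nonneg _) ?_ h3
  filter_upwards [hg, hK] with n h4 h5
  refine (lip h4 h2).2.trans ?_
  gcongr

end Ker

/-- The kernel `(1+t²)/(1-ht²)`. -/
def kPsi : Ker where
  k t := 1 + t ^ 2
  α _ := 1
  β t := -t ^ 2
  mk' := by fun_prop
  mα := by fun_prop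
  mβ := by fun_prop
  bk t := by rw [abs_of_nonneg (by positivity)]
  bβ t := by rw [abs_neg, abs_of_nonneg (by positivity)]; linarith
  nd h t h0 := by
    have : t ≠ 0 := by rintro rfl; simp at h0
    have : 0 < t ^ 2 := by positivity
    nlinarith

/-- The kernel `1/(q-t²)`. -/
def kN : Ker where
  k _ := 1
  α t := -t ^ 2
  β _ := 1
  mk' := by fun_prop
  mα := by fun_prop
  mβ := by fun_prop
  bk t := by simp; positivity
  bβ t := by simp; positivity
  nd h t h0 := by simp

/-- Complement of `[0,∞)`. -/
def Off (z : ℂ) : Prop := z.im ≠ 0 ∨ z.re < 0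

lemma Off.ne_zero {z : ℂ} (h : Off z) : z ≠ 0 := by
  rintro rfl; simp [Off] at h

lemma Off.lower {z : ℂ} (h : Off z) : ∃ c > (0 : ℝ), ∀ s : ℝ, 0 ≤ s →
    c * (1 + s) ≤ ‖z - s‖ := by
  -- the function is bounded below at infinity and by distance
  rcases h with h | h
  · have h0 : 0 < |z.im| := abs_pos.mpr h
    have hz : 0 ≤ ‖z‖ := norm_nonneg _
    refine ⟨|z.im| / (1 + ‖z‖ + |z.im|), by positivity, fun s hs => ?_⟩
    have h1 : |z.im| ≤ ‖z - s‖ := by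
      have := Complex.abs_im_le_norm (z - s); simpa using this
    have h2 : s - ‖z‖ ≤ ‖z - s‖ := by
      have := norm_sub_norm_le (s : ℂ) z
      rw [norm_sub_rev, Complex.norm_real, Real.norm_eq_abs, abs_of_nonneg hs] at this
      exact this
    rw [div_mul_eq_mul_div, div_le_iff₀ (by positivity)]
    nlinarith
  · refine ⟨min 1 (-z.re), by simp [h], fun s hs => ?_⟩
    have h1 : s - z.re ≤ ‖z - s‖ := by
      have := Complex.abs_re_le_norm (z - s)
      have h2 := neg_le_abs (z - s).re
      simp at this h2
      linarith
    have := min_le_left 1 (-z.re)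
    have := min_le_right 1 (-z.re)
    nlinarith

lemma Off.goodN {z : ℂ} (h : Off z) (σ : Measure ℝ) : kN.Good σ z := by
  obtain ⟨c, hc, hh⟩ := h.lower
  refine ⟨c, hc, ae_of_all _ fun t => ?_⟩
  have := hh (t ^ 2) (by positivity)
  refine this.trans_eq ?_
  congr 1
  simp [Ker.den, kN]; ring

lemma Off.inv {z : ℂ} (h : Off z) : Off z⁻¹ := by
  have h0 : 0 < Complex.normSq z := Complex.normSq_pos.mpr h.ne_zero
  unfold Off at *
  rw [Complex.inv_im, Complex.inv_re]
  rcases h with h | h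
  · left
    exact div_ne_zero (neg_ne_zero.mpr h) h0.ne'
  · right
    exact div_neg_of_neg_of_pos h h0

lemma Off.goodPsi {z : ℂ} (h : Off z) (σ : Measure ℝ) : kPsi.Good σ z := by
  obtain ⟨c, hc, hh⟩ := h.inv.lower
  have hz := norm_pos_iff.mpr h.ne_zero
  refine ⟨‖z‖ * c, by positivity, ae_of_all _ fun t => ?_⟩
  have := hh (t ^ 2) (by positivity)
  have e : kPsi.den z t = z * (z⁻¹ - ((t ^ 2 : ℝ) : ℂ)) := by
    rw [mul_sub, mul_inv_cancel₀ h.ne_zero]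
    simp [Ker.den, kPsi]; ring
  rw [e, norm_mul, mul_assoc]
  gcongr

lemma isOpen_off : IsOpen {z | Off z} := by
  have h1 : IsOpen {z : ℂ | z.im ≠ 0} := isOpen_ne_fun Complex.continuous_im continuous_const
  have h2 : IsOpen {z : ℂ | z.re < 0} := isOpen_lt Complex.continuous_re continuous_const
  exact h1.union h2

lemma off_iff_neg_mem (z : ℂ) : Off z ↔ -z ∈ Complex.slitPlane := by
  simp [Off, Complex.mem_slitPlane_iff, or_comm]

lemma isPreconnected_off : IsPreconnected {z | Off z} := by
  have h := (StarConvex.isPathConnected Complex.starConvex_one_slitPlane Complex.one_mem_slitPlane).isConnected.isPreconnected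
  have h2 := h.image (fun z => -z) continuous_neg.continuousOn
  convert h2 using 1
  ext z
  simp [off_iff_neg_mem]

/-- product of two numbers in the lower half plane -/
lemma off_mul_lower {a b : ℂ} (ha : a.im < 0) (hb : b.im < 0) : Off (a * b) := by
  unfold Off
  by_contra hcon
  push Not at hcon
  obtain ⟨h1, h2⟩ := hcon
  simp only [Complex.mul_im, Complex.mul_re] at h1 h2
  have h3 := mul_pos_of_neg_of_neg ha hb
  have h4 : (a.re * b.re) * (a.im * b.im) = - (a.re * b.im) ^ 2 := by
    linear_combination (a.re * b.im) * h1
  nlinarith [sq_nonneg (a.re * b.im)]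

lemma off_mul_upper {a b : ℂ} (ha : 0 < a.im) (hb : 0 < b.im) : Off (a * b) := by
  have := off_mul_lower (a := -a) (b := -b) (by simpa) (by simpa)
  simpa using this

/-- A measure with quadratic growth on balls has no mass. -/
lemma no_mass {σ : Measure ℝ} {p : ℝ → ℝ} {K : ℝ} {α β r₀ : ℝ}
    (hr₀ : 0 < r₀)
    (h : ∀ q ∈ Ioo α β, ∀ r, 0 < r → r ≤ r₀ → σ {t | |p t - q| ≤ r} ≤ ENNReal.ofReal (K * r ^ 2)) :
    σ {t | p t ∈ Ioo α β} = 0 := by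
  rcases le_or_gt β α with hab | hab
  · simp [Ioo_eq_empty (not_lt.mpr hab)]
  set D := β - α with hD
  have hDpos : 0 < D := by linarith
  -- bound for each n
  have hn : ∀ n : ℕ, D / (n + 1) ≤ r₀ → σ {t | p t ∈ Ioo α β} ≤ ENNReal.ofReal (K * D ^ 2 / (n + 1)) := by
    intro n hn
    have hsub : {t | p t ∈ Ioo α β} ⊆ ⋃ i ∈ Finset.range (n + 1),
        {t | |p t - (α + D * (i + 1 / 2) / (n + 1))| ≤ D / (n + 1)} := by
      intro t ht
      obtain ⟨h1, h2⟩ := ht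
      have hnp : (0 : ℝ) < n + 1 := by positivity
      set y := (p t - α) * (n + 1) / D with hy
      have hy0 : 0 ≤ y := by
        have : 0 < p t - α := by linarith
        positivity
      have hy1 : y < n + 1 := by
        rw [hy, div_lt_iff₀ hDpos]; nlinarith
      have hfl := Nat.floor_le hy0
      have hfl2 := Nat.lt_floor_add_one y
      have hpt : p t = α + D * y / (n + 1) := by rw [hy]; field_simp; ring
      simp only [Finset.mem_range, mem_iUnion, mem_ofPred_eq, exists_prop]
      refine ⟨⌊y⌋₊, ?_, ?_⟩
      · rw [Nat.floor_lt hy0]; push_cast; exact hy1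
      · have : p t - (α + D * (⌊y⌋₊ + 1 / 2) / (n + 1)) = D / (n + 1) * (y - ⌊y⌋₊ - 1 / 2) := by
          rw [hpt]; field_simp; ring
        rw [this, abs_mul, abs_of_pos (by positivity)]
        have : |y - ⌊y⌋₊ - 1 / 2| ≤ 1 := by rw [abs_le]; constructor <;> linarith
        have hd : 0 < D / (n + 1) := by positivity
        nlinarith
    refine (measure_mono hsub).trans ((measure_biUnion_finset_le _ _).trans ?_)
    refine (Finset.sum_le_sum (g := fun _ => ENNReal.ofReal (K * (D / (n + 1)) ^ 2)) ?_).trans ?_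
    · intro i hi
      have hi' : (i : ℝ) + 1 ≤ n + 1 := by
        have := Finset.mem_range.mp hi
        exact_mod_cast this
      refine h _ ⟨?_, ?_⟩ _ (by positivity) hn
      · have : 0 < D * (i + 1 / 2) / (n + 1) := by positivity
        linarith
      · have : D * (i + 1 / 2) / (n + 1) < D := by
          rw [div_lt_iff₀ (by positivity)]; nlinarith
        linarith
    · rw [Finset.sum_const, Finset.card_range, nsmul_eq_mul]
      rw [← ENNReal.ofReal_natCast, ← ENNReal.ofReal_mul (by positivity)]
      apply ENNReal.ofReal_le_ofReal
      apply le_of_eq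
      push_cast
      field_simp
  have hlim : Tendsto (fun n : ℕ => ENNReal.ofReal (K * D ^ 2 / (n + 1))) atTop (𝓝 0) := by
    rw [← ENNReal.ofReal_zero]
    refine ENNReal.tendsto_ofReal ?_
    have := (tendsto_one_div_add_atTop_nhds_zero_nat (𝕜 := ℝ)).const_mul (K * D ^ 2)
    simpa [div_eq_mul_inv] using this
  have hlim2 : ∀ᶠ n : ℕ in atTop, D / ((n : ℝ) + 1) ≤ r₀ := by
    have := (tendsto_one_div_add_atTop_nhds_zero_nat (𝕜 := ℝ)).const_mul D
    simp only [mul_one_div, mul_zero] at this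
    exact (this.eventually_lt_const hr₀).mono fun n hn => hn.le
  have := ge_of_tendsto hlim (hlim2.mono hn)
  exact le_antisymm this bot_le


/-! ### Part 2: the state equations -/

/-- `B` -/
def Bf (l : ℝ) (u A : ℂ) : ℂ := l * A + (1 - l) / u
/-- `h = A B` -/
def hf (l : ℝ) (u A : ℂ) : ℂ := A * Bf l u A
/-- first subordination variable -/
def s1f (l : ℝ) (G : Measure ℝ) (u A : ℂ) : ℂ := u - kPsi.I G (hf l u A) * Bf l u A
/-- second subordination variable -/
def s2f (l : ℝ) (G : Measure ℝ) (u A : ℂ) : ℂ := u - l * (kPsi.I G (hf l u A) * A)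
/-- product -/
def qf (l : ℝ) (G : Measure ℝ) (u A : ℂ) : ℂ := s1f l G u A * s2f l G u A
/-- the equation -/
def Ff (l : ℝ) (G ν : Measure ℝ) (u A : ℂ) : ℂ := A - s2f l G u A * kN.I ν (qf l G u A)

lemma im_integral' {σ : Measure ℝ} {f : ℝ → ℂ} (hf : Integrable f σ) :
    (∫ t, f t ∂σ).im = ∫ t, (f t).im ∂σ :=
  (Complex.imCLM.integral_comp_comm hf).symm

/-- `R` -/
def Rr (G : Measure ℝ) (h : ℂ) : ℝ := ∫ t, (1 + t ^ 2) / ‖kPsi.den h t‖ ^ 2 ∂G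

lemma Rr_integrable {G : Measure ℝ} [IsFiniteMeasure G] {h : ℂ} (hg : kPsi.Good G h) :
    Integrable (fun t : ℝ => (1 + t ^ 2) / ‖kPsi.den h t‖ ^ 2) G := by
  obtain ⟨c, hc, hh⟩ := hg
  have hm : Measurable (fun t : ℝ => (1 + t ^ 2) / ‖kPsi.den h t‖ ^ 2) := by
    have h3 := kPsi.measurable_den h
    fun_prop
  refine Integrable.of_bound hm.aestronglyMeasurable (1 / c ^ 2) ?_
  filter_upwards [hh] with t ht
  have h2 : 0 < ‖kPsi.den h t‖ := lt_of_lt_of_le (by positivity) ht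
  rw [Real.norm_eq_abs, abs_of_nonneg (by positivity)]
  rw [div_le_div_iff₀ (by positivity) (by positivity), one_mul]
  calc (1 + t ^ 2) * c ^ 2 ≤ (1 + t ^ 2) * (1 + t ^ 2) * c ^ 2 := by
        have : (1 + t ^ 2) * 1 ≤ (1 + t ^ 2) * (1 + t ^ 2) := by gcongr; linarith [sq_nonneg t]
        nlinarith [sq_nonneg c]
    _ = (c * (1 + t ^ 2)) ^ 2 := by ring
    _ ≤ ‖kPsi.den h t‖ ^ 2 := by gcongr

lemma Rr_nonneg (G : Measure ℝ) (h : ℂ) : 0 ≤ Rr G h := integral_nonneg fun t => by positivity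

/-- lower bound for `R` -/
def Rlow (G : Measure ℝ) (K : ℝ) : ℝ := ∫ t, (1 + t ^ 2) / (1 + K * t ^ 2) ^ 2 ∂G

lemma Rlow_integrable {G : Measure ℝ} [IsFiniteMeasure G] {K : ℝ} (hK : 1 ≤ K) :
    Integrable (fun t : ℝ => (1 + t ^ 2) / (1 + K * t ^ 2) ^ 2) G := by
  have hm : Measurable (fun t : ℝ => (1 + t ^ 2) / (1 + K * t ^ 2) ^ 2) := by fun_prop
  refine Integrable.of_bound hm.aestronglyMeasurable 1 (ae_of_all _ fun t => ?_)
  rw [Real.norm_eq_abs, abs_of_nonneg (by positivity), div_le_one (by positivity)]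
  nlinarith [sq_nonneg t, mul_nonneg (sub_nonneg.mpr hK) (sq_nonneg t), sq_nonneg (K * t ^ 2)]

lemma Rlow_pos {G : Measure ℝ} [IsFiniteMeasure G] (hG : G ≠ 0) {K : ℝ} (hK : 1 ≤ K) :
    0 < Rlow G K := by
  unfold Rlow
  have hp : ∀ t : ℝ, 0 < (1 + t ^ 2) / (1 + K * t ^ 2) ^ 2 := fun t => by positivity
  rw [integral_pos_iff_support_of_nonneg (fun t => (hp t).le) (Rlow_integrable hK)]
  have : Function.support (fun t : ℝ => (1 + t ^ 2) / (1 + K * t ^ 2) ^ 2) = univ := by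
    ext t; simp only [Function.mem_support, mem_univ, iff_true]; exact (hp t).ne'
  rw [this]
  exact Measure.measure_univ_pos.mpr hG

lemma Rlow_le {G : Measure ℝ} [IsFiniteMeasure G] {h : ℂ} (hg : kPsi.Good G h) {K : ℝ} (hK : 1 ≤ K)
    (hh : ‖h‖ ≤ K) : Rlow G K ≤ Rr G h := by
  refine integral_mono_ae (Rlow_integrable hK) (Rr_integrable hg) ?_
  filter_upwards [hg.den_ne] with t ht
  have h2 := norm_pos_iff.mpr ht
  have h3 : ‖kPsi.den h t‖ ≤ 1 + K * t ^ 2 := by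
    unfold Ker.den kPsi
    simp only
    refine (norm_add_le _ _).trans ?_
    rw [norm_mul, Complex.norm_real, Complex.norm_real, norm_neg, Real.norm_eq_abs, Real.norm_eq_abs,
      abs_one, abs_of_nonneg (sq_nonneg t)]
    gcongr
  gcongr

lemma im_psi {G : Measure ℝ} [IsFiniteMeasure G] {a b : ℂ} (hg : kPsi.Good G (a * b)) :
    (kPsi.I G (a * b) * b).im =
      -(Rr G (a * b) * (-b.im) + (∫ t, kPsi.wr (a * b) t ∂G) * ‖b‖ ^ 2 * (-a.im)) := by
  unfold Ker.I Rr
  rw [← integral_mul_const, im_integral' (hg.integrable.mul_const _)]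
  rw [← integral_mul_const, mul_assoc, ← integral_mul_const, ← integral_add
    ((Rr_integrable hg).mul_const _) (hg.integrable_wr.mul_const _), ← integral_neg]
  refine integral_congr_ae (ae_of_all _ fun t => ?_)
  simp only
  have e : ((kPsi.k t : ℂ) / kPsi.den (a * b) t * b) =
      (((kPsi.k t) * (Complex.normSq (kPsi.den (a * b) t))⁻¹ : ℝ) : ℂ) *
        (b * (starRingEnd ℂ) (kPsi.den (a * b) t)) := by
    rw [div_eq_mul_inv, Complex.inv_def]; push_cast; ring
  rw [e, Complex.im_ofReal_mul]
  have e2 : (b * (starRingEnd ℂ) (kPsi.den (a * b) t)).im = b.im + t ^ 2 * ‖b‖ ^ 2 * a.im := by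
    rw [← Complex.normSq_eq_norm_sq, Complex.normSq_apply]
    simp [Ker.den, kPsi, Complex.mul_im, Complex.mul_re, ← Complex.ofReal_pow]
    ring
  rw [e2, Complex.normSq_eq_norm_sq, Ker.wr]
  have e3 : |kPsi.k t * kPsi.β t| = (1 + t ^ 2) * t ^ 2 := by
    simp only [kPsi]
    rw [abs_mul, abs_neg, abs_of_nonneg (by positivity), abs_of_nonneg (by positivity)]
  have e4 : kPsi.k t = 1 + t ^ 2 := rfl
  rw [e3, e4]
  ring

lemma im_N {σ : Measure ℝ} [IsFiniteMeasure σ] {a b : ℂ} (ha : 0 < a.im) (hb : 0 < b.im) :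
    (∫ t, kN.wr (a * b) t ∂σ) * ‖b‖ ^ 2 * a.im ≤ -(b * kN.I σ (a * b)).im := by
  have hg := (off_mul_upper ha hb).goodN σ
  unfold Ker.I
  rw [← integral_const_mul, im_integral' (hg.integrable.const_mul _), ← integral_neg,
    mul_assoc, ← integral_mul_const]
  refine integral_mono (hg.integrable_wr.mul_const _) (hg.integrable.const_mul b).im.neg fun t => ?_
  simp only
  have e : b * ((kN.k t : ℂ) / kN.den (a * b) t) =
      (((Complex.normSq (kN.den (a * b) t))⁻¹ : ℝ) : ℂ) *
        (b * (starRingEnd ℂ) (kN.den (a * b) t)) := by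
    rw [div_eq_mul_inv, Complex.inv_def]; simp [kN]; ring
  have e2 : (b * (starRingEnd ℂ) (kN.den (a * b) t)).im = -(‖b‖ ^ 2 * a.im + t ^ 2 * b.im) := by
    rw [← Complex.normSq_eq_norm_sq, Complex.normSq_apply]
    simp [Ker.den, kN, Complex.mul_im, Complex.mul_re, ← Complex.ofReal_pow]
    ring
  have e3 : kN.wr (a * b) t = (Complex.normSq (kN.den (a * b) t))⁻¹ := by
    rw [Complex.normSq_eq_norm_sq]; simp [Ker.wr, kN]
  rw [e, Complex.im_ofReal_mul, e2, e3]
  have h1 : 0 ≤ (Complex.normSq (kN.den (a * b) t))⁻¹ := inv_nonneg.mpr (Complex.normSq_nonneg _)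
  have h2 : 0 ≤ t ^ 2 * b.im := by positivity
  nlinarith [mul_nonneg h1 h2]

lemma norm_N_sq_le {ν : Measure ℝ} [IsProbabilityMeasure ν] {q : ℂ} (hg : kN.Good ν q) :
    ‖kN.I ν q‖ ^ 2 ≤ ∫ t, kN.wr q t ∂ν := by
  set m := ∫ t, ‖(kN.k t : ℂ) / kN.den q t‖ ∂ν with hm
  have h1 : ‖kN.I ν q‖ ≤ m := norm_integral_le_integral_norm _
  have i1 := hg.integrable.norm
  have i2 := hg.integrable_wr
  have h2 : 0 ≤ ∫ t, (kN.wr q t - 2 * m * ‖(kN.k t : ℂ) / kN.den q t‖ + m ^ 2) ∂ν := by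
    refine integral_nonneg fun t => ?_
    have : kN.wr q t = ‖(kN.k t : ℂ) / kN.den q t‖ ^ 2 := by
      simp [Ker.wr, kN]
    simp only [this, Pi.zero_apply]
    nlinarith [sq_nonneg (‖(kN.k t : ℂ) / kN.den q t‖ - m)]
  have i3 : Integrable (fun t => kN.wr q t - 2 * m * ‖(kN.k t : ℂ) / kN.den q t‖) ν :=
    i2.sub (i1.const_mul _)
  rw [integral_add i3 (integrable_const _), integral_sub i2 (i1.const_mul _),
    integral_const_mul, ← hm] at h2
  simp at h2
  nlinarith [norm_nonneg (kN.I ν q)]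

lemma Bf_im {l : ℝ} (hl : l ∈ Ioo (0 : ℝ) 1) {u A : ℂ} (hu : 0 ≤ u.im) (hA : A.im < 0) :
    (Bf l u A).im < 0 := by
  unfold Bf
  have h1 : ((1 - (l : ℂ)) / u).im ≤ 0 := by
    have e : (1 - (l : ℂ)) / u = ((1 - l : ℝ) : ℂ) * u⁻¹ := by push_cast; rw [div_eq_mul_inv]
    rw [e, Complex.im_ofReal_mul, Complex.inv_im]
    have h2 : 0 ≤ 1 - l := by linarith [hl.2]
    have h3 : -u.im / Complex.normSq u ≤ 0 :=
      div_nonpos_of_nonpos_of_nonneg (by linarith) (Complex.normSq_nonneg _)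
    exact mul_nonpos_of_nonneg_of_nonpos h2 h3
  rw [Complex.add_im, Complex.im_ofReal_mul]
  nlinarith [hl.1]

lemma hf_off {l : ℝ} (hl : l ∈ Ioo (0 : ℝ) 1) {u A : ℂ} (hu : 0 ≤ u.im) (hA : A.im < 0) :
    Off (hf l u A) := off_mul_lower hA (Bf_im hl hu hA)

lemma s1f_im {l : ℝ} (hl : l ∈ Ioo (0 : ℝ) 1) {G : Measure ℝ} [IsFiniteMeasure G] {u A : ℂ}
    (hu : 0 ≤ u.im) (hA : A.im < 0) :
    (s1f l G u A).im = u.im + Rr G (hf l u A) * (-(Bf l u A).im) +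
      (∫ t, kPsi.wr (hf l u A) t ∂G) * ‖Bf l u A‖ ^ 2 * (-A.im) := by
  have := im_psi (G := G) (a := A) (b := Bf l u A) ((hf_off hl hu hA).goodPsi G)
  unfold s1f
  rw [Complex.sub_im, hf, this]; ring

lemma s2f_im {l : ℝ} (hl : l ∈ Ioo (0 : ℝ) 1) {G : Measure ℝ} [IsFiniteMeasure G] {u A : ℂ}
    (hu : 0 ≤ u.im) (hA : A.im < 0) :
    (s2f l G u A).im = u.im + l * (Rr G (hf l u A) * (-A.im) +
      (∫ t, kPsi.wr (hf l u A) t ∂G) * ‖A‖ ^ 2 * (-(Bf l u A).im)) := by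
  have h0 : Bf l u A * A = hf l u A := mul_comm _ _
  have := im_psi (G := G) (a := Bf l u A) (b := A) (by rw [h0]; exact (hf_off hl hu hA).goodPsi G)
  rw [h0] at this
  unfold s2f
  rw [Complex.sub_im, Complex.im_ofReal_mul, this]; ring

lemma wr_int_nonneg (κ : Ker) (σ : Measure ℝ) (h : ℂ) : 0 ≤ ∫ t, κ.wr h t ∂σ :=
  integral_nonneg fun t => Ker.wr_nonneg h t

lemma s1f_im_pos {l : ℝ} (hl : l ∈ Ioo (0 : ℝ) 1) {G : Measure ℝ} [IsFiniteMeasure G] {u A : ℂ}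
    (hu : 0 ≤ u.im) (hA : A.im < 0) (h : 0 < u.im ∨ G ≠ 0) : 0 < (s1f l G u A).im := by
  rw [s1f_im hl hu hA]
  have hB := Bf_im hl hu hA
  have h3 : 0 ≤ (∫ t, kPsi.wr (hf l u A) t ∂G) * ‖Bf l u A‖ ^ 2 * (-A.im) := by
    have := wr_int_nonneg kPsi G (hf l u A)
    have : 0 ≤ -A.im := by linarith
    positivity
  have h2 : 0 ≤ Rr G (hf l u A) * (-(Bf l u A).im) :=
    mul_nonneg (Rr_nonneg _ _) (by linarith)
  rcases h with h | h
  · linarith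
  · have h4 : 0 < Rr G (hf l u A) := (Rlow_pos h (le_max_left 1 ‖hf l u A‖)).trans_le
      (Rlow_le ((hf_off hl hu hA).goodPsi G) (le_max_left _ _) (le_max_right _ _))
    have : 0 < Rr G (hf l u A) * (-(Bf l u A).im) := mul_pos h4 (by linarith)
    linarith

lemma s2f_im_pos {l : ℝ} (hl : l ∈ Ioo (0 : ℝ) 1) {G : Measure ℝ} [IsFiniteMeasure G] {u A : ℂ}
    (hu : 0 ≤ u.im) (hA : A.im < 0) (h : 0 < u.im ∨ G ≠ 0) : 0 < (s2f l G u A).im := by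
  rw [s2f_im hl hu hA]
  have hB := Bf_im hl hu hA
  have hl1 := hl.1
  have h3 : 0 ≤ (∫ t, kPsi.wr (hf l u A) t ∂G) * ‖A‖ ^ 2 * (-(Bf l u A).im) := by
    have := wr_int_nonneg kPsi G (hf l u A)
    have : 0 ≤ -(Bf l u A).im := by linarith
    positivity
  have h2 : 0 ≤ Rr G (hf l u A) * (-A.im) :=
    mul_nonneg (Rr_nonneg _ _) (by linarith)
  have h5 : 0 ≤ l * (Rr G (hf l u A) * (-A.im) +
      (∫ t, kPsi.wr (hf l u A) t ∂G) * ‖A‖ ^ 2 * (-(Bf l u A).im)) := by positivity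
  rcases h with h | h
  · linarith
  · have h4 : 0 < Rr G (hf l u A) := (Rlow_pos h (le_max_left 1 ‖hf l u A‖)).trans_le
      (Rlow_le ((hf_off hl hu hA).goodPsi G) (le_max_left _ _) (le_max_right _ _))
    have : 0 < Rr G (hf l u A) * (-A.im) := mul_pos h4 (by linarith)
    have : 0 < l * (Rr G (hf l u A) * (-A.im) +
      (∫ t, kPsi.wr (hf l u A) t ∂G) * ‖A‖ ^ 2 * (-(Bf l u A).im)) := by positivity
    linarith

/-- The algebraic identity `B s₂ = λ A s₁ + 1 - λ`. -/
lemma B_s2 {l : ℝ} (G : Measure ℝ) {u : ℂ} (hu : u ≠ 0) (A : ℂ) :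
    Bf l u A * s2f l G u A = l * (A * s1f l G u A) + (1 - l) := by
  unfold s2f s1f
  generalize kPsi.I G (hf l u A) = p
  unfold Bf
  field_simp
  ring

lemma alg_bounds {l P R W nA nB n1 n2 a b x1 x2 : ℝ} (hl : l ∈ Ioo (0 : ℝ) 1)
    (hP : 0 ≤ P) (hR : 0 ≤ R) (hW : 0 ≤ W) (hx1 : 0 < x1) (hx2 : 0 < x2)
    (ha : P * n2 ^ 2 * x1 ≤ a) (hb : l * (P * n1 ^ 2 * x2) + (1 - l) * (x2 / n2 ^ 2) ≤ b)
    (hn2 : 0 < n2) (hn1 : 0 < n1) (hnA : 0 ≤ nA)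
    (h1 : R * b + W * nB ^ 2 * a ≤ x1) (h2 : l * (R * a + W * nA ^ 2 * b) ≤ x2)
    (hA : nA ^ 2 ≤ n2 ^ 2 * P) :
    W * (nA * nB) ^ 2 ≤ 1 ∧ l * (1 - l) * R ^ 2 * P ≤ 1 ∧ l * R * P * (n1 * n2) ≤ 1 ∧
      l ^ 2 * W * P * nA ^ 2 * n1 ^ 2 ≤ 1 := by
  obtain ⟨l0, l1⟩ := hl
  have l1' : 0 < 1 - l := by linarith
  have a0 : 0 ≤ a := le_trans (by positivity) ha
  have hb1 : l * (P * n1 ^ 2 * x2) ≤ b := le_trans (by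
    have : 0 ≤ (1 - l) * (x2 / n2 ^ 2) := by positivity
    linarith) hb
  have hb2 : (1 - l) * (x2 / n2 ^ 2) ≤ b := le_trans (by
    have : 0 ≤ l * (P * n1 ^ 2 * x2) := by positivity
    linarith) hb
  have b0 : 0 ≤ b := le_trans (by positivity) hb1
  have c1 : W * nB ^ 2 * a ≤ x1 := by have : 0 ≤ R * b := by positivity
                                      linarith
  have c2 : R * b ≤ x1 := by have : 0 ≤ W * nB ^ 2 * a := by positivity
                             linarith
  have d1 : l * (R * a) ≤ x2 := by have : 0 ≤ l * (W * nA ^ 2 * b) := by positivity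
                                   linarith
  have d2 : l * (W * nA ^ 2 * b) ≤ x2 := by have : 0 ≤ l * (R * a) := by positivity
                                            linarith
  refine ⟨?_, ?_, ?_, ?_⟩
  · refine le_of_mul_le_mul_right ?_ hx1
    calc W * (nA * nB) ^ 2 * x1 = W * nB ^ 2 * (nA ^ 2 * x1) := by ring
      _ ≤ W * nB ^ 2 * (n2 ^ 2 * P * x1) := by gcongr
      _ = W * nB ^ 2 * (P * n2 ^ 2 * x1) := by ring
      _ ≤ W * nB ^ 2 * a := by gcongr
      _ ≤ 1 * x1 := by linarith
  · refine le_of_mul_le_mul_right ?_ hx1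
    calc l * (1 - l) * R ^ 2 * P * x1 = R * ((1 - l) * ((l * (R * (P * n2 ^ 2 * x1))) / n2 ^ 2)) := by
          field_simp
      _ ≤ R * ((1 - l) * ((l * (R * a)) / n2 ^ 2)) := by gcongr
      _ ≤ R * ((1 - l) * (x2 / n2 ^ 2)) := by gcongr
      _ ≤ R * b := by gcongr
      _ ≤ 1 * x1 := by linarith
  · have key : (l * R * P * (n1 * n2)) ^ 2 ≤ 1 := by
      refine le_of_mul_le_mul_right ?_ hx1
      calc (l * R * P * (n1 * n2)) ^ 2 * x1 = R * (l * (P * n1 ^ 2 * (l * (R * (P * n2 ^ 2 * x1))))) := by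
            ring
        _ ≤ R * (l * (P * n1 ^ 2 * (l * (R * a)))) := by gcongr
        _ ≤ R * (l * (P * n1 ^ 2 * x2)) := by gcongr
        _ ≤ R * b := by gcongr
        _ ≤ 1 * x1 := by linarith
    nlinarith [key]
  · refine le_of_mul_le_mul_right ?_ hx2
    calc l ^ 2 * W * P * nA ^ 2 * n1 ^ 2 * x2 = l * (W * nA ^ 2 * (l * (P * n1 ^ 2 * x2))) := by ring
      _ ≤ l * (W * nA ^ 2 * b) := by gcongr
      _ ≤ 1 * x2 := by linarith

/-- The main a priori bounds. -/
lemma main_bounds {l : ℝ} (hl : l ∈ Ioo (0 : ℝ) 1) {G ν : Measure ℝ} [IsFiniteMeasure G]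
    [IsProbabilityMeasure ν] {u A : ℂ} (hu : 0 < u.im) (hA : A.im < 0) (hF : Ff l G ν u A = 0) :
    Off (hf l u A) ∧ Off (qf l G u A) ∧
    (∫ t, kPsi.wr (hf l u A) t ∂G) * ‖hf l u A‖ ^ 2 ≤ 1 ∧
    l * (1 - l) * Rr G (hf l u A) ^ 2 * (∫ t, kN.wr (qf l G u A) t ∂ν) ≤ 1 ∧
    l * Rr G (hf l u A) * (∫ t, kN.wr (qf l G u A) t ∂ν) * ‖qf l G u A‖ ≤ 1 ∧
    l ^ 2 * (∫ t, kPsi.wr (hf l u A) t ∂G) * (∫ t, kN.wr (qf l G u A) t ∂ν) * ‖A‖ ^ 2 *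
      ‖s1f l G u A‖ ^ 2 ≤ 1 ∧
    ‖A‖ ^ 2 ≤ ‖s2f l G u A‖ ^ 2 * (∫ t, kN.wr (qf l G u A) t ∂ν) := by
  have oh := hf_off hl hu.le hA
  have x1 := s1f_im_pos hl (G := G) hu.le hA (Or.inl hu)
  have x2 := s2f_im_pos hl (G := G) hu.le hA (Or.inl hu)
  have e1 := s1f_im hl (G := G) hu.le hA
  have e2 := s2f_im hl (G := G) hu.le hA
  have oq : Off (qf l G u A) := off_mul_upper x1 x2
  have hu0 : u ≠ 0 := by rintro rfl; simp at hu
  have hBs := B_s2 (l := l) G hu0 A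
  have hA2 : A = s2f l G u A * kN.I ν (qf l G u A) := by unfold Ff at hF; linear_combination hF
  have s20 : s2f l G u A ≠ 0 := by intro h; rw [h] at x2; simp at x2
  have s10 : s1f l G u A ≠ 0 := by intro h; rw [h] at x1; simp at x1
  have hB2 : Bf l u A = l * (s1f l G u A * kN.I ν (qf l G u A)) + (1 - l) / s2f l G u A := by
    field_simp
    rw [hBs]
    nth_rewrite 1 [hA2]
    ring
  have nN := norm_N_sq_le (oq.goodN ν)
  have ia := im_N (σ := ν) x1 x2
  have ib := im_N (σ := ν) x2 x1
  rw [show s1f l G u A * s2f l G u A = qf l G u A from rfl, ← hA2] at ia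
  rw [show s2f l G u A * s1f l G u A = qf l G u A from mul_comm _ _] at ib
  have iB : (Bf l u A).im = l * (s1f l G u A * kN.I ν (qf l G u A)).im -
      (1 - l) * ((s2f l G u A).im / ‖s2f l G u A‖ ^ 2) := by
    have := congrArg Complex.im hB2
    rw [this, Complex.add_im, Complex.im_ofReal_mul, div_eq_mul_inv,
      show (1 - (l : ℂ)) = ((1 - l : ℝ) : ℂ) by push_cast; rfl, Complex.im_ofReal_mul, Complex.inv_im,
      Complex.normSq_eq_norm_sq]
    ring
  have hAn : ‖A‖ ^ 2 ≤ ‖s2f l G u A‖ ^ 2 * (∫ t, kN.wr (qf l G u A) t ∂ν) := by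
    have : ‖A‖ = ‖s2f l G u A‖ * ‖kN.I ν (qf l G u A)‖ := by
      rw [← norm_mul, ← hA2]
    rw [this, mul_pow]
    gcongr
  have := alg_bounds (a := -A.im) (b := -(Bf l u A).im) (nB := ‖Bf l u A‖) hl
    (wr_int_nonneg kN ν (qf l G u A)) (Rr_nonneg G (hf l u A))
    (wr_int_nonneg kPsi G (hf l u A)) x1 x2 ia
    (by rw [iB]; have := mul_le_mul_of_nonneg_left ib hl.1.le; linarith)
    (norm_pos_iff.mpr s20) (norm_pos_iff.mpr s10) (norm_nonneg A)
    (by rw [e1]; linarith) (by rw [e2]; linarith) hAn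
  obtain ⟨h1, h2, h3, h4⟩ := this
  refine ⟨oh, oq, ?_, h2, ?_, h4, hAn⟩
  · rw [hf, norm_mul]; exact h1
  · rw [show ‖qf l G u A‖ = ‖s1f l G u A‖ * ‖s2f l G u A‖ from norm_mul _ _]; exact h3

/-- Differentiability of the state functions. -/
lemma diff_state {l : ℝ} {G : Measure ℝ} [IsFiniteMeasure G]
    {U A : ℂ → ℂ} {z : ℂ} (hU : DifferentiableAt ℂ U z) (hA : DifferentiableAt ℂ A z)
    (hU0 : U z ≠ 0) (hg : kPsi.Good G (hf l (U z) (A z))) :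
    DifferentiableAt ℂ (fun z => s1f l G (U z) (A z)) z ∧
    DifferentiableAt ℂ (fun z => s2f l G (U z) (A z)) z ∧
    DifferentiableAt ℂ (fun z => qf l G (U z) (A z)) z := by
  have hB : DifferentiableAt ℂ (fun z => Bf l (U z) (A z)) z := by
    unfold Bf
    exact (hA.const_mul _).add ((differentiableAt_const _).div hU hU0)
  have hh : DifferentiableAt ℂ (fun z => hf l (U z) (A z)) z := hA.mul hB
  have hp : DifferentiableAt ℂ (fun z => kPsi.I G (hf l (U z) (A z))) z :=
    DifferentiableAt.comp (g := kPsi.I G) (f := fun z => hf l (U z) (A z)) z hg.differentiableAt hh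
  have h1 : DifferentiableAt ℂ (fun z => s1f l G (U z) (A z)) z := hU.sub (hp.mul hB)
  have h2 : DifferentiableAt ℂ (fun z => s2f l G (U z) (A z)) z := hU.sub ((hp.mul hA).const_mul _)
  exact ⟨h1, h2, h1.mul h2⟩

lemma diff_F {l : ℝ} {G ν : Measure ℝ} [IsFiniteMeasure G] [IsFiniteMeasure ν]
    {U A : ℂ → ℂ} {z : ℂ} (hU : DifferentiableAt ℂ U z) (hA : DifferentiableAt ℂ A z)
    (hU0 : U z ≠ 0) (hg : kPsi.Good G (hf l (U z) (A z)))
    (hq : kN.Good ν (qf l G (U z) (A z))) :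
    DifferentiableAt ℂ (fun z => Ff l G ν (U z) (A z)) z := by
  obtain ⟨h1, h2, h3⟩ := diff_state (l := l) hU hA hU0 hg
  exact hA.sub (h2.mul (DifferentiableAt.comp (g := kN.I ν) (f := fun z => qf l G (U z) (A z)) z
    hq.differentiableAt h3))


/-! ### Part 3: the Cauchy transform of `ρ` solves the equation -/

/-- the Cauchy transform of a symmetric measure -/
def Ar (ρ : Measure ℝ) (u : ℂ) : ℂ := u * kN.I ρ (u ^ 2)

lemma off_sq {u : ℂ} (hu : 0 < u.im) : Off (u ^ 2) := by
  rw [pow_two]; exact off_mul_upper hu hu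

lemma kN_wr_pos {σ : Measure ℝ} [IsFiniteMeasure σ] (h0 : σ ≠ 0) {q : ℂ} (hq : Off q) :
    0 < ∫ t, kN.wr q t ∂σ := by
  have hg := hq.goodN σ
  have : ∀ t, 0 < kN.wr q t := by
    intro t
    obtain ⟨c, hc, hh⟩ := hq.lower
    have h1 := hh (t ^ 2) (by positivity)
    have h2 : kN.den q t = q - ((t ^ 2 : ℝ) : ℂ) := by simp [Ker.den, kN]; ring
    have h3 : 0 < ‖kN.den q t‖ := by rw [h2]; exact lt_of_lt_of_le (by positivity) h1
    have : kN.wr q t = 1 / ‖kN.den q t‖ ^ 2 := by simp [Ker.wr, kN]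
    rw [this]; positivity
  rw [integral_pos_iff_support_of_nonneg (fun t => (this t).le) hg.integrable_wr]
  have e : Function.support (kN.wr q) = univ := by
    ext t; simp only [Function.mem_support, mem_univ, iff_true]; exact (this t).ne'
  rw [e]
  exact Measure.measure_univ_pos.mpr h0

lemma Ar_im_neg {ρ : Measure ℝ} [IsProbabilityMeasure ρ] {u : ℂ} (hu : 0 < u.im) :
    (Ar ρ u).im < 0 := by
  have h1 := im_N (σ := ρ) hu hu
  have h2 := kN_wr_pos (IsProbabilityMeasure.ne_zero ρ) (off_mul_upper hu hu)
  have h3 : 0 < ‖u‖ := norm_pos_iff.mpr (by rintro rfl; simp at hu)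
  unfold Ar
  rw [pow_two]
  have : 0 < (∫ t, kN.wr (u * u) t ∂ρ) * ‖u‖ ^ 2 * u.im := by positivity
  linarith

lemma Ar_diff {ρ : Measure ℝ} [IsProbabilityMeasure ρ] {u : ℂ} (hu : 0 < u.im) :
    DifferentiableAt ℂ (Ar ρ) u := by
  refine differentiableAt_id.mul ?_
  exact DifferentiableAt.comp (g := kN.I ρ) (f := fun u : ℂ => u ^ 2) u
    ((off_sq hu).goodN ρ).differentiableAt (by fun_prop)

lemma isOpen_UHP : IsOpen UHP := isOpen_lt continuous_const Complex.continuous_im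

lemma convex_UHP : Convex ℝ UHP := convex_halfSpace_im_gt 0

lemma one_add_Mt {σ : Measure ℝ} [IsProbabilityMeasure σ] {q : ℂ} (hq : Off q) :
    1 + Mt σ q⁻¹ = q * kN.I σ q := by
  have hg := hq.goodN σ
  have h0 := hq.ne_zero
  have e1 : (1 : ℂ) = ∫ t : ℝ, (1 : ℂ) ∂σ := by simp
  have e2 : q * kN.I σ q = ∫ t : ℝ, (1 + q⁻¹ * (t : ℂ) ^ 2 / (1 - q⁻¹ * (t : ℂ) ^ 2)) ∂σ := by
    unfold Ker.I
    rw [← integral_const_mul]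
    refine integral_congr_ae ?_
    filter_upwards [hg.den_ne] with t ht
    have h2 : kN.den q t = q - (t : ℂ) ^ 2 := by simp [Ker.den, kN]; ring
    rw [h2] at ht ⊢
    have h3 : 1 - q⁻¹ * (t : ℂ) ^ 2 = q⁻¹ * (q - (t : ℂ) ^ 2) := by field_simp
    have h4 : (kN.k t : ℂ) = 1 := by simp [kN]
    rw [h3, h4]
    field_simp
    ring
  have hi : Integrable (fun t : ℝ => q⁻¹ * (t : ℂ) ^ 2 / (1 - q⁻¹ * (t : ℂ) ^ 2)) σ := by
    have : Integrable (fun t : ℝ => q * ((kN.k t : ℂ) / kN.den q t) - 1) σ :=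
      (hg.integrable.const_mul q).sub (integrable_const _)
    refine this.congr ?_
    filter_upwards [hg.den_ne] with t ht
    have h2 : kN.den q t = q - (t : ℂ) ^ 2 := by simp [Ker.den, kN]; ring
    rw [h2] at ht ⊢
    have h3 : 1 - q⁻¹ * (t : ℂ) ^ 2 = q⁻¹ * (q - (t : ℂ) ^ 2) := by field_simp
    have h4 : (kN.k t : ℂ) = 1 := by simp [kN]
    rw [h3, h4]
    field_simp
    ring
  rw [e2, integral_add (integrable_const _) hi]
  simp [Mt]

lemma Ht_inv {l : ℝ} {σ : Measure ℝ} [IsProbabilityMeasure σ] {q : ℂ} (hq : Off q) :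
    Ht l σ q⁻¹ = kN.I σ q * (l * (q * kN.I σ q) + (1 - l)) := by
  have h := one_add_Mt (σ := σ) hq
  have h2 : Mt σ q⁻¹ = q * kN.I σ q - 1 := by linear_combination h
  unfold Ht
  rw [h, h2]
  have := hq.ne_zero
  field_simp
  ring

lemma rectC_eq (G : Measure ℝ) (h : ℂ) : rectC G h = h * kPsi.I G h := by
  unfold rectC Ker.I
  congr 2
  ext t
  simp [kPsi, Ker.den]
  ring_nf

lemma I_real (κ : Ker) (σ : Measure ℝ) (x : ℝ) :
    κ.I σ x = ((∫ t, κ.k t / (κ.α t + x * κ.β t) ∂σ : ℝ) : ℂ) := by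
  unfold Ker.I Ker.den
  rw [← integral_complex_ofReal]
  congr 1
  ext t
  push_cast
  rfl

lemma F_zero_imag {l : ℝ} (hl : l ∈ Ioo (0 : ℝ) 1) {G ν ρ : Measure ℝ} [IsFiniteMeasure G]
    [IsProbabilityMeasure ν] [IsProbabilityMeasure ρ] {y : ℝ} (hy : 0 < y)
    (hT : Tfun l (Mt ρ ((-1 / y ^ 2 : ℝ) : ℂ) - rectC G (Ht l ρ ((-1 / y ^ 2 : ℝ) : ℂ))) ≠ 0)
    (hH : Ht l ρ ((-1 / y ^ 2 : ℝ) : ℂ) = Ht l ν (Ht l ρ ((-1 / y ^ 2 : ℝ) : ℂ) /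
      Tfun l (Mt ρ ((-1 / y ^ 2 : ℝ) : ℂ) - rectC G (Ht l ρ ((-1 / y ^ 2 : ℝ) : ℂ))))) :
    Ff l G ν (Complex.I * y) (Ar ρ (Complex.I * y)) = 0 := by
  set u : ℂ := Complex.I * y with hu
  have hui : 0 < u.im := by simp [hu, hy]
  have hu0 : u ≠ 0 := by intro h; rw [h] at hui; simp at hui
  have hx : ((-1 / y ^ 2 : ℝ) : ℂ) = (u ^ 2)⁻¹ := by
    rw [hu, mul_pow, Complex.I_sq]
    push_cast
    have : (y : ℂ) ≠ 0 := by exact_mod_cast hy.ne'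
    field_simp
  rw [hx] at hT hH
  set A := Ar ρ u with hA
  have hAi : A.im < 0 := Ar_im_neg hui
  have x1 := s1f_im_pos hl (G := G) hui.le hAi (Or.inl hui)
  have x2 := s2f_im_pos hl (G := G) hui.le hAi (Or.inl hui)
  have oq : Off (qf l G u A) := off_mul_upper x1 x2
  have oh := hf_off hl hui.le hAi
  have hAu : u ^ 2 * kN.I ρ (u ^ 2) = u * A := by rw [hA]; unfold Ar; ring
  have hM : Mt ρ (u ^ 2)⁻¹ = u * A - 1 := by
    have := one_add_Mt (σ := ρ) (off_sq hui)
    rw [hAu] at this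
    linear_combination this
  have hHr : Ht l ρ (u ^ 2)⁻¹ = hf l u A := by
    rw [Ht_inv (off_sq hui), hAu]
    have : kN.I ρ (u ^ 2) = A / u := by rw [hA]; unfold Ar; field_simp
    rw [this]
    unfold hf Bf
    field_simp
  have hTe : Tfun l (Mt ρ (u ^ 2)⁻¹ - rectC G (Ht l ρ (u ^ 2)⁻¹)) = hf l u A * qf l G u A := by
    rw [hHr, hM, rectC_eq]
    have hBs := B_s2 (l := l) G hu0 A
    unfold Tfun
    have e1 : u * A - 1 - hf l u A * kPsi.I G (hf l u A) + 1 = A * s1f l G u A := by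
      unfold s1f
      have : hf l u A = A * Bf l u A := rfl
      linear_combination -kPsi.I G (hf l u A) * this
    have e2 : l * (u * A - 1 - hf l u A * kPsi.I G (hf l u A)) + 1 = Bf l u A * s2f l G u A := by
      rw [hBs, ← e1]; ring
    rw [e1, e2]
    unfold hf qf
    ring
  rw [hTe, hHr] at hH
  have hq' : hf l u A / (hf l u A * qf l G u A) = (qf l G u A)⁻¹ := by
    have := oh.ne_zero
    have := oq.ne_zero
    field_simp
  rw [hq', Ht_inv oq] at hH
  -- reality
  obtain ⟨n, hn⟩ : ∃ n : ℝ, kN.I ρ (u ^ 2) = n := by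
    rw [show u ^ 2 = ((-y ^ 2 : ℝ) : ℂ) by rw [hu, mul_pow, Complex.I_sq]; push_cast; ring, I_real]
    exact ⟨_, rfl⟩
  have hA2 : A = Complex.I * ((y * n : ℝ) : ℂ) := by
    rw [hA]; unfold Ar; rw [hn, hu]; push_cast; ring
  have hyn : y * n < 0 := by
    have := hAi; rw [hA2] at this; simpa using this
  set b : ℝ := l * (y * n) - (1 - l) / y with hb
  have hB2 : Bf l u A = Complex.I * (b : ℂ) := by
    unfold Bf
    rw [hA2, hu, hb]
    have : (y : ℂ) ≠ 0 := by exact_mod_cast hy.ne'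
    push_cast
    field_simp
    linear_combination (1 - (l : ℂ)) * Complex.I_sq
  obtain ⟨p, hp⟩ : ∃ p : ℝ, kPsi.I G (hf l u A) = p := by
    rw [show hf l u A = ((-(y * n * b) : ℝ) : ℂ) by
        unfold hf; rw [hB2, hA2]; push_cast
        linear_combination ((y : ℂ) * n * b) * Complex.I_sq, I_real]
    exact ⟨_, rfl⟩
  have hs1 : s1f l G u A = Complex.I * ((y - p * b : ℝ) : ℂ) := by
    unfold s1f; rw [hp, hB2, hu]; push_cast; ring
  have hs2 : s2f l G u A = Complex.I * ((y - l * (p * (y * n)) : ℝ) : ℂ) := by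
    unfold s2f; rw [hp, hA2, hu]; push_cast; ring
  have y1 : 0 < y - p * b := by rw [hs1] at x1; simpa using x1
  have y2 : 0 < y - l * (p * (y * n)) := by rw [hs2] at x2; simpa using x2
  set c1 : ℝ := y - p * b
  set c2 : ℝ := y - l * (p * (y * n))
  have hq2 : qf l G u A = ((-(c1 * c2) : ℝ) : ℂ) := by
    unfold qf; rw [hs1, hs2]; push_cast; linear_combination ((c1 : ℂ) * c2) * Complex.I_sq
  obtain ⟨m, hm, hm0⟩ : ∃ m : ℝ, kN.I ν (qf l G u A) = m ∧ m ≤ 0 := by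
    refine ⟨_, by rw [hq2, I_real], ?_⟩
    refine integral_nonpos fun t => ?_
    simp only [kN, Pi.zero_apply]
    apply div_nonpos_of_nonneg_of_nonpos zero_le_one
    nlinarith [mul_pos y1 y2, sq_nonneg t]
  have hX : A * s1f l G u A = ((-(y * n * c1) : ℝ) : ℂ) := by
    rw [hs1]; nth_rewrite 1 [hA2]; push_cast; linear_combination ((y : ℂ) * n * c1) * Complex.I_sq
  have hY : qf l G u A * kN.I ν (qf l G u A) = ((-(c1 * c2) * m : ℝ) : ℂ) := by
    rw [hq2, ← hq2, hm]; push_cast; rw [hq2]; push_cast; ring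
  have hX0 : 0 < -(y * n * c1) := by nlinarith
  have hY0 : 0 ≤ -(c1 * c2) * m := by nlinarith [mul_pos y1 y2]
  have hXY : A * s1f l G u A = qf l G u A * kN.I ν (qf l G u A) := by
    have hBs := B_s2 (l := l) G hu0 A
    have key : (A * s1f l G u A) * (l * (A * s1f l G u A) + (1 - l)) =
        (qf l G u A * kN.I ν (qf l G u A)) * (l * (qf l G u A * kN.I ν (qf l G u A)) + (1 - l)) := by
      rw [← hBs]
      have : A * s1f l G u A * (Bf l u A * s2f l G u A) = qf l G u A * hf l u A := by
        unfold qf hf; ring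
      rw [this, hH]; ring
    rw [hX, hY] at key ⊢
    set X := -(y * n * c1)
    set Y := -(c1 * c2) * m
    have key' : X * (l * X + (1 - l)) = Y * (l * Y + (1 - l)) := by exact_mod_cast key
    have h5 : (X - Y) * (l * (X + Y) + (1 - l)) = 0 := by linear_combination key'
    have h6 : 0 < l * (X + Y) + (1 - l) := by nlinarith [hl.1, hl.2]
    have : X = Y := by
      rcases mul_eq_zero.mp h5 with h | h
      · linarith
      · exact absurd h h6.ne'
    rw [this]
  have s10 : s1f l G u A ≠ 0 := by intro h; rw [h] at x1; simp at x1
  unfold Ff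
  have : s1f l G u A * (A - s2f l G u A * kN.I ν (qf l G u A)) = 0 := by
    have : qf l G u A * kN.I ν (qf l G u A) = s1f l G u A * s2f l G u A * kN.I ν (qf l G u A) := rfl
    linear_combination hXY + this
  exact (mul_eq_zero.mp this).resolve_left s10

lemma diff_F_UHP {l : ℝ} (hl : l ∈ Ioo (0 : ℝ) 1) {G ν ρ : Measure ℝ} [IsFiniteMeasure G]
    [IsProbabilityMeasure ν] [IsProbabilityMeasure ρ] :
    DifferentiableOn ℂ (fun u => Ff l G ν u (Ar ρ u)) UHP := by
  intro u hu
  have hu' : 0 < u.im := hu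
  have hA := Ar_im_neg (ρ := ρ) hu'
  refine DifferentiableAt.differentiableWithinAt ?_
  refine diff_F (U := fun u => u) differentiableAt_id (Ar_diff hu') ?_
    ((hf_off hl hu'.le hA).goodPsi G) ?_
  · rintro rfl; simp at hu'
  · exact Off.goodN (off_mul_upper (s1f_im_pos hl hu'.le hA (Or.inl hu'))
      (s2f_im_pos hl hu'.le hA (Or.inl hu'))) ν

theorem F_zero {l : ℝ} (hl : l ∈ Ioo (0 : ℝ) 1) {G ν ρ : Measure ℝ} [IsFiniteMeasure G]
    [IsProbabilityMeasure ν] [IsProbabilityMeasure ρ] (hconv : IsRectConv l G ν ρ) :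
    ∀ u ∈ UHP, Ff l G ν u (Ar ρ u) = 0 := by
  obtain ⟨ε, hε, hh⟩ := hconv
  have han := (diff_F_UHP hl (G := G) (ν := ν) (ρ := ρ)).analyticOnNhd isOpen_UHP
  set y0 : ℝ := 1 + 1 / ε with hy0
  have hy0p : 0 < y0 := by positivity
  have hmem : Complex.I * (y0 : ℂ) ∈ UHP := by simp [UHP, hy0p]
  have hz : ∀ y : ℝ, y0 ≤ y → Ff l G ν (Complex.I * y) (Ar ρ (Complex.I * y)) = 0 := by
    intro y hy
    have hyp : 0 < y := hy0p.trans_le hy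
    have hx : (-1 / y ^ 2 : ℝ) ∈ Ioo (-ε) 0 := by
      constructor
      · rw [lt_div_iff₀ (by positivity)]
        have h1 : 1 ≤ y := le_trans (by rw [hy0]; have : 0 < 1 / ε := by positivity
                                        linarith) hy
        have h2 : 1 < ε * y := by
          calc 1 < ε * y0 := by rw [hy0]; field_simp; linarith
            _ ≤ ε * y := by gcongr
        nlinarith
      · exact div_neg_of_neg_of_pos (by norm_num) (by positivity)
    obtain ⟨h1, h2⟩ := hh _ hx
    exact F_zero_imag hl hyp h1 h2
  have hfreq : ∃ᶠ z in 𝓝[≠] (Complex.I * (y0 : ℂ)), Ff l G ν z (Ar ρ z) = 0 := by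
    have ht : Tendsto (fun y : ℝ => Complex.I * (y : ℂ)) (𝓝[>] y0) (𝓝[≠] (Complex.I * (y0 : ℂ))) := by
      refine tendsto_nhdsWithin_iff.mpr ⟨?_, ?_⟩
      · have : Continuous (fun y : ℝ => Complex.I * (y : ℂ)) := by fun_prop
        exact this.continuousAt.tendsto.mono_left nhdsWithin_le_nhds
      · filter_upwards [self_mem_nhdsWithin] with y hy h
        simp at h
        exact (ne_of_gt hy) h
    refine ht.frequently (Eventually.frequently ?_)
    filter_upwards [self_mem_nhdsWithin] with y hy
    exact hz y (le_of_lt hy)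
  exact han.eqOn_zero_of_preconnected_of_frequently_eq_zero convex_UHP.isPreconnected hmem hfreq

theorem G_ne_zero {l : ℝ} (hl : l ∈ Ioo (0 : ℝ) 1) {μ G : Measure ℝ} [IsProbabilityMeasure μ]
    (hμ0 : μ ≠ Measure.dirac (0 : ℝ)) (hID : IsRectInfDiv l μ G) : G ≠ 0 := by
  rintro rfl
  obtain ⟨ε, hε, hh⟩ := hID
  apply hμ0
  set x : ℝ := -ε / 2 with hx
  have hx0 : x < 0 := by rw [hx]; linarith
  have h := hh x ⟨by rw [hx]; linarith, hx0⟩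
  have e0 : ∀ z, rectC (0 : Measure ℝ) z = 0 := by intro z; simp [rectC]
  rw [e0] at h
  have hxc : (x : ℂ) ≠ 0 := by exact_mod_cast hx0.ne
  have hM : Mt μ (x : ℂ) = ((∫ t, x * t ^ 2 / (1 - x * t ^ 2) ∂μ : ℝ) : ℂ) := by
    unfold Mt
    rw [← integral_complex_ofReal]
    congr 1; ext t; push_cast; rfl
  set f : ℝ → ℝ := fun t => -(x * t ^ 2 / (1 - x * t ^ 2)) with hf
  have hfb : ∀ t, 0 ≤ f t ∧ f t ≤ 1 := by
    intro t
    have h1 : 0 < 1 - x * t ^ 2 := by nlinarith [sq_nonneg t]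
    have e : f t = (-x * t ^ 2) / (1 - x * t ^ 2) := by rw [hf]; ring
    rw [e]
    refine ⟨div_nonneg (by nlinarith [sq_nonneg t]) h1.le, ?_⟩
    rw [div_le_one h1]; linarith
  have hfi : Integrable f μ := by
    refine Integrable.of_bound (C := 1) ?_ (ae_of_all _ fun t => ?_)
    · have : Measurable f := by rw [hf]; fun_prop
      exact this.aestronglyMeasurable
    · rw [Real.norm_eq_abs, abs_of_nonneg (hfb t).1]; exact (hfb t).2
  set m := ∫ t, f t ∂μ with hm
  have hM2 : Mt μ (x : ℂ) = ((-m : ℝ) : ℂ) := by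
    rw [hM, hm, ← integral_neg]
    simp [hf]
  have hm0 : 0 ≤ m := integral_nonneg fun t => (hfb t).1
  have hm1 : m ≤ 1 := by
    calc m ≤ ∫ t, (1 : ℝ) ∂μ := integral_mono hfi (integrable_const _) fun t => (hfb t).2
      _ = 1 := by simp
  unfold Ht Tfun at h
  rw [hM2] at h
  have h2 : (1 + (-m)) * (1 + l * (-m)) = (1 : ℝ) := by
    have : (x : ℂ) * ((1 + (((-m : ℝ)) : ℂ)) * (1 + l * ((-m : ℝ) : ℂ)) - 1) = 0 := by
      linear_combination h
    have := (mul_eq_zero.mp this).resolve_left hxc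
    have h3 : ((1 + (((-m : ℝ)) : ℂ)) * (1 + l * ((-m : ℝ) : ℂ))) = 1 := by linear_combination this
    exact_mod_cast h3
  have hmz : m = 0 := by
    by_contra hne
    have : 0 < m := lt_of_le_of_ne hm0 (Ne.symm hne)
    nlinarith [hl.1, hl.2, mul_pos this hl.1, mul_nonneg (mul_nonneg hm0 hl.1.le) (sub_nonneg.mpr hm1)]
  have hae : f =ᵐ[μ] 0 := (integral_eq_zero_iff_of_nonneg (fun t => (hfb t).1) hfi).mp hmz
  have hae2 : ∀ᵐ t ∂μ, t = 0 := by
    filter_upwards [hae] with t ht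
    have h1 : 0 < 1 - x * t ^ 2 := by nlinarith [sq_nonneg t]
    simp only [hf, Pi.zero_apply, neg_eq_zero, div_eq_zero_iff, mul_eq_zero] at ht
    rcases ht with (h | h) | h
    · exact absurd h hx0.ne
    · exact pow_eq_zero_iff (two_ne_zero) |>.mp h
    · exact absurd h h1.ne'
  ext s hs
  rw [Measure.dirac_apply' _ hs]
  by_cases h0 : (0 : ℝ) ∈ s
  · simp only [h0, indicator_of_mem, Pi.one_apply]
    have : μ s = μ univ := by
      apply measure_congr
      filter_upwards [hae2] with t ht
      apply propext
      rw [ht]; exact ⟨fun _ => trivial, fun _ => h0⟩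
    rw [this, measure_univ]
  · simp only [h0, not_false_eq_true, indicator_of_notMem]
    rw [← nonpos_iff_eq_zero, ← show μ ∅ = 0 from measure_empty]
    apply measure_mono_ae
    filter_upwards [hae2] with t ht hts
    rw [ht] at hts
    exact absurd hts h0

/-! ### Part 4: the equation is nontrivial at real points -/

lemma off_sqrt {q : ℂ} (hq : Off q) : ∃ s : ℂ, 0 < s.im ∧ s ^ 2 = q := by
  obtain ⟨s, hs⟩ := IsAlgClosed.exists_pow_nat_eq q (n := 2) two_pos
  have h0 : s.im ≠ 0 := by
    intro h
    rw [← hs] at hq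
    unfold Off at hq
    rw [pow_two, Complex.mul_im, Complex.mul_re, h] at hq
    simp at hq
    nlinarith [mul_self_nonneg s.re]
  rcases lt_or_gt_of_ne h0 with h | h
  · exact ⟨-s, by simpa using h, by rw [neg_sq, hs]⟩
  · exact ⟨s, h, hs⟩

/-- `h` as a function of `q` -/
def hq (l : ℝ) (ν : Measure ℝ) (q : ℂ) : ℂ := kN.I ν q * (l * (q * kN.I ν q) + (1 - l))

lemma hq_off {l : ℝ} (hl : l ∈ Ioo (0 : ℝ) 1) {ν : Measure ℝ} [IsProbabilityMeasure ν] {q : ℂ}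
    (h : Off q) : Off (hq l ν q) := by
  obtain ⟨s, hs, rfl⟩ := off_sqrt h
  have := hf_off hl hs.le (Ar_im_neg (ρ := ν) hs)
  have e : hf l s (Ar ν s) = hq l ν (s ^ 2) := by
    have s0 : s ≠ 0 := by rintro rfl; simp at hs
    unfold hf Bf Ar hq
    field_simp
  rwa [e] at this

/-- the function `X = u A` in terms of `q` -/
def Xq (l : ℝ) (G ν : Measure ℝ) (q : ℂ) : ℂ :=
  q * kN.I ν q + hq l ν q * kPsi.I G (hq l ν q)

/-- elimination -/
def Eq' (l : ℝ) (G ν : Measure ℝ) (x : ℝ) (q : ℂ) : ℂ :=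
  x ^ 2 * hq l ν q - (l * Xq l G ν q + (1 - l)) * Xq l G ν q

lemma Eq'_diff {l : ℝ} (hl : l ∈ Ioo (0 : ℝ) 1) {G ν : Measure ℝ} [IsFiniteMeasure G]
    [IsProbabilityMeasure ν] (x : ℝ) : DifferentiableOn ℂ (Eq' l G ν x) {q | Off q} := by
  intro q hqo
  refine DifferentiableAt.differentiableWithinAt ?_
  have h1 : DifferentiableAt ℂ (kN.I ν) q := (Off.goodN hqo ν).differentiableAt
  have h2 : DifferentiableAt ℂ (fun q => q * kN.I ν q) q := differentiableAt_id.mul h1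
  have h3 : DifferentiableAt ℂ (hq l ν) q := h1.mul ((h2.const_mul _).add (differentiableAt_const _))
  have h4 : DifferentiableAt ℂ (fun q => kPsi.I G (hq l ν q)) q :=
    DifferentiableAt.comp (g := kPsi.I G) (f := hq l ν) q
      ((hq_off hl hqo).goodPsi G).differentiableAt h3
  have h5 : DifferentiableAt ℂ (Xq l G ν) q := h2.add (h3.mul h4)
  exact (h3.const_mul _).sub (((h5.const_mul _).add (differentiableAt_const _)).mul h5)

lemma tend_qN {ν : Measure ℝ} [IsProbabilityMeasure ν] :
    Tendsto (fun y : ℝ => ((-y : ℝ) : ℂ) * kN.I ν ((-y : ℝ) : ℂ)) atTop (𝓝 1) := by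
  have e : ∀ y : ℝ, ((-y : ℝ) : ℂ) * kN.I ν ((-y : ℝ) : ℂ) =
      ((∫ t, y / (y + t ^ 2) ∂ν : ℝ) : ℂ) := by
    intro y
    rw [I_real, ← Complex.ofReal_mul, ← integral_const_mul]
    congr 2
    ext t
    simp only [kN]
    rw [show -t ^ 2 + -y * 1 = -(y + t ^ 2) by ring, div_neg]
    ring
  simp_rw [e]
  rw [show (1 : ℂ) = ((1 : ℝ) : ℂ) by simp]
  refine (Complex.continuous_ofReal.tendsto _).comp ?_
  rw [show (1 : ℝ) = ∫ t : ℝ, (1 : ℝ) ∂ν by simp]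
  refine tendsto_integral_filter_of_dominated_convergence (fun _ => 1) ?_ ?_ (integrable_const _) ?_
  · refine Eventually.of_forall fun y => ?_
    have : Measurable (fun t : ℝ => y / (y + t ^ 2)) := by fun_prop
    exact this.aestronglyMeasurable
  · filter_upwards [eventually_gt_atTop 0] with y hy
    refine ae_of_all _ fun t => ?_
    rw [Real.norm_eq_abs, abs_of_nonneg (by positivity), div_le_one (by positivity)]
    nlinarith [sq_nonneg t]
  · refine ae_of_all _ fun t => ?_
    have h1 : Tendsto (fun y : ℝ => 1 - t ^ 2 / (y + t ^ 2)) atTop (𝓝 (1 - 0)) := by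
      refine tendsto_const_nhds.sub ?_
      exact Tendsto.div_atTop tendsto_const_nhds (tendsto_atTop_add_const_right _ _ tendsto_id)
    rw [sub_zero] at h1
    refine h1.congr' ?_
    filter_upwards [eventually_gt_atTop 0] with y hy
    have : y + t ^ 2 ≠ 0 := by positivity
    field_simp
    ring

lemma tend_hpsi {G : Measure ℝ} [IsFiniteMeasure G] :
    Tendsto (fun h : ℝ => (h : ℂ) * kPsi.I G h) (𝓝[≤] 0) (𝓝 0) := by
  have e : ∀ h : ℝ, (h : ℂ) * kPsi.I G h =
      ((∫ t, h * ((1 + t ^ 2) / (1 + h * -t ^ 2)) ∂G : ℝ) : ℂ) := by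
    intro y
    rw [I_real, ← Complex.ofReal_mul, ← integral_const_mul]
    rfl
  simp_rw [e]
  rw [show (0 : ℂ) = ((0 : ℝ) : ℂ) by simp]
  refine (Complex.continuous_ofReal.tendsto _).comp ?_
  rw [show (0 : ℝ) = ∫ t : ℝ, (0 : ℝ) ∂G by simp]
  refine tendsto_integral_filter_of_dominated_convergence (fun _ => 1) ?_ ?_ (integrable_const _) ?_
  · refine Eventually.of_forall fun h => ?_
    have : Measurable (fun t : ℝ => h * ((1 + t ^ 2) / (1 + h * -t ^ 2))) := by fun_prop
    exact this.aestronglyMeasurable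
  · have h1 : ∀ᶠ h : ℝ in 𝓝[≤] (∫ t : ℝ, (0 : ℝ) ∂G), -1 < h := by
      simp only [integral_zero]
      exact nhdsWithin_le_nhds (lt_mem_nhds (by norm_num))
    have h2 : ∀ᶠ h : ℝ in 𝓝[≤] (∫ t : ℝ, (0 : ℝ) ∂G), h ≤ 0 := by
      simp only [integral_zero]
      exact self_mem_nhdsWithin
    filter_upwards [h1, h2] with h h1 h2
    refine ae_of_all _ fun t => ?_
    have h3 : 0 < 1 + h * -t ^ 2 := by nlinarith [sq_nonneg t]
    rw [norm_mul, norm_div, Real.norm_eq_abs, Real.norm_eq_abs, Real.norm_eq_abs, abs_of_nonpos h2,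
      abs_of_pos h3, abs_of_pos (by positivity), ← mul_div_assoc, div_le_one h3]
    nlinarith [sq_nonneg t]
  · refine ae_of_all _ fun t => ?_
    simp only [integral_zero]
    have : ContinuousAt (fun h : ℝ => h * ((1 + t ^ 2) / (1 + h * -t ^ 2))) 0 := by
      refine continuousAt_id.mul (continuousAt_const.div (by fun_prop) (by simp))
    have h2 := this.tendsto
    simp only [zero_mul] at h2
    exact h2.mono_left nhdsWithin_le_nhds

lemma Eq'_ne {l : ℝ} (hl : l ∈ Ioo (0 : ℝ) 1) {G ν : Measure ℝ} [IsFiniteMeasure G]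
    [IsProbabilityMeasure ν] (x : ℝ) : ¬ ∀ q, Off q → Eq' l G ν x q = 0 := by
  intro hall
  have t1 := tend_qN (ν := ν)
  have t0 : Tendsto (fun y : ℝ => (((-y)⁻¹ : ℝ) : ℂ)) atTop (𝓝 0) := by
    rw [show (0 : ℂ) = ((0 : ℝ) : ℂ) by simp]
    refine (Complex.continuous_ofReal.tendsto _).comp ?_
    exact tendsto_inv_atBot_zero.comp tendsto_neg_atTop_atBot
  have t2 : Tendsto (fun y : ℝ => kN.I ν ((-y : ℝ) : ℂ)) atTop (𝓝 0) := by
    have := t0.mul t1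
    rw [zero_mul] at this
    refine this.congr' ?_
    filter_upwards [eventually_gt_atTop 0] with y hy
    have : (y : ℂ) ≠ 0 := by exact_mod_cast hy.ne'
    push_cast
    field_simp
  have t3 : Tendsto (fun y : ℝ => hq l ν ((-y : ℝ) : ℂ)) atTop (𝓝 0) := by
    have := t2.mul ((t1.const_mul (l : ℂ)).add_const (1 - (l : ℂ)))
    rw [zero_mul] at this
    exact this
  -- real version
  have hr : ∀ y : ℝ, hq l ν ((-y : ℝ) : ℂ) = ((hq l ν ((-y : ℝ) : ℂ)).re : ℂ) := by
    intro y
    unfold hq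
    rw [I_real]
    norm_cast
  have t4 : Tendsto (fun y : ℝ => (hq l ν ((-y : ℝ) : ℂ)).re) atTop (𝓝[≤] 0) := by
    refine tendsto_nhdsWithin_iff.mpr ⟨?_, ?_⟩
    · have := (Complex.continuous_re.tendsto _).comp t3
      rw [Complex.zero_re] at this
      exact this
    · filter_upwards [eventually_gt_atTop 0] with y hy
      have : Off ((-y : ℝ) : ℂ) := Or.inr (by simpa using hy)
      have := hq_off hl (ν := ν) this
      rw [hr] at this
      rcases this with h | h
      · simp at h
      · rw [Complex.ofReal_re] at h
        exact le_of_lt h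
  have t5 := (tend_hpsi (G := G)).comp t4
  have t6 : Tendsto (fun y : ℝ => Xq l G ν ((-y : ℝ) : ℂ)) atTop (𝓝 (1 + 0)) := by
    refine t1.add (t5.congr fun y => ?_)
    simp only [Function.comp]
    rw [← hr y]
  rw [add_zero] at t6
  have t7 : Tendsto (fun y : ℝ => Eq' l G ν x ((-y : ℝ) : ℂ)) atTop
      (𝓝 ((x : ℂ) ^ 2 * 0 - (l * 1 + (1 - l)) * 1)) :=
    (t3.const_mul _).sub (((t6.const_mul _).add_const _).mul t6)
  have t8 : Tendsto (fun y : ℝ => Eq' l G ν x ((-y : ℝ) : ℂ)) atTop (𝓝 0) := by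
    refine tendsto_const_nhds.congr' ?_
    filter_upwards [eventually_gt_atTop 0] with y hy
    exact (hall _ (Or.inr (by simpa using hy))).symm
  have := tendsto_nhds_unique t7 t8
  ring_nf at this
  norm_num at this

lemma off_qf {l : ℝ} (hl : l ∈ Ioo (0 : ℝ) 1) {G : Measure ℝ} [IsFiniteMeasure G] (hG : G ≠ 0)
    {x : ℝ} {A : ℂ} (hA : A.im < 0) : Off (qf l G x A) :=
  off_mul_upper (s1f_im_pos hl (by simp) hA (Or.inr hG)) (s2f_im_pos hl (by simp) hA (Or.inr hG))

lemma isOpen_low : IsOpen {A : ℂ | A.im < 0} := isOpen_lt Complex.continuous_im continuous_const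

lemma hf_not_const {l : ℝ} (hl : l ∈ Ioo (0 : ℝ) 1) {u z0 : ℂ} :
    ¬ ∀ᶠ z in 𝓝 z0, hf l u z = hf l u z0 := by
  intro h
  obtain ⟨r, hr, hh⟩ := Metric.eventually_nhds_iff.mp h
  have key : ∀ d : ℝ, 0 < d → d < r → (l : ℂ) * (2 * z0 + d) + (1 - l) / u = 0 := by
    intro d hd hdr
    have h1 := hh (y := z0 + d) (by simpa [dist_eq_norm, abs_of_pos hd] using hdr)
    unfold hf Bf at h1
    have hd' : (d : ℂ) ≠ 0 := by exact_mod_cast hd.ne'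
    apply mul_left_cancel₀ hd'
    linear_combination h1
  have h1 := key (r / 2) (by positivity) (by linarith)
  have h2 := key (r / 4) (by positivity) (by linarith)
  have h3 : (l : ℂ) * ((r / 4 : ℝ) : ℂ) = 0 := by
    push_cast at *
    linear_combination h1 - h2
  have h4 : l * (r / 4) = 0 := by exact_mod_cast h3
  have := hl.1
  have : 0 < l * (r / 4) := by positivity
  linarith

theorem F_nontriv {l : ℝ} (hl : l ∈ Ioo (0 : ℝ) 1) {G ν : Measure ℝ} [IsFiniteMeasure G]
    [IsProbabilityMeasure ν] (hG : G ≠ 0) {x : ℝ} (hx : x ≠ 0) :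
    ¬ ∀ A : ℂ, A.im < 0 → Ff l G ν x A = 0 := by
  intro hall
  have hxc : (x : ℂ) ≠ 0 := by exact_mod_cast hx
  -- consequences
  have hh : ∀ A : ℂ, A.im < 0 → hf l x A = hq l ν (qf l G x A) ∧ Eq' l G ν x (qf l G x A) = 0 := by
    intro A hA
    have hF := hall A hA
    have hBs := B_s2 (l := l) G hxc A
    unfold Ff at hF
    have hA1 : A = s2f l G x A * kN.I ν (qf l G x A) := by linear_combination hF
    have hX : A * s1f l G x A = qf l G x A * kN.I ν (qf l G x A) := by
      nth_rewrite 1 [hA1]; unfold qf; ring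
    have e1 : hf l x A = hq l ν (qf l G x A) := by
      unfold hq
      rw [← hX, ← hBs]
      calc hf l x A = A * Bf l x A := rfl
        _ = (s2f l G x A * kN.I ν (qf l G x A)) * Bf l x A := by rw [← hA1]
        _ = _ := by ring
    refine ⟨e1, ?_⟩
    have e2 : Xq l G ν (qf l G x A) = x * A := by
      unfold Xq
      rw [← e1, ← hX]
      unfold s1f
      have : hf l x A = A * Bf l x A := rfl
      linear_combination kPsi.I G (hf l x A) * this
    unfold Eq'
    rw [e2, ← e1]
    unfold hf Bf
    field_simp
    ring
  have hmem : (-Complex.I).im < 0 := by simp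
  have hd : DifferentiableOn ℂ (fun A => qf l G x A) {A : ℂ | A.im < 0} := by
    intro A hA
    exact (diff_state (U := fun _ => (x : ℂ)) (A := fun A => A) (differentiableAt_const _)
      differentiableAt_id hxc ((hf_off hl (by simp) hA).goodPsi G)).2.2.differentiableWithinAt
  have han := hd.analyticOnNhd isOpen_low _ hmem
  have hev : ∀ᶠ A : ℂ in 𝓝 (-Complex.I), A.im < 0 := isOpen_low.mem_nhds hmem
  rcases han.eventually_constant_or_nhds_le_map_nhds with h | h
  · apply hf_not_const hl (u := x) (z0 := -Complex.I)
    filter_upwards [h, hev] with A h1 h2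
    rw [(hh A h2).1, h1, (hh _ hmem).1]
  · have hz : ∀ᶠ q in 𝓝 (qf l G x (-Complex.I)), Eq' l G ν x q = 0 := by
      refine h ?_
      rw [Filter.mem_map]
      filter_upwards [hev] with A hA
      exact (hh A hA).2
    have := ((Eq'_diff hl (G := G) (ν := ν) x).analyticOnNhd
      isOpen_off).eqOn_zero_of_preconnected_of_eventuallyEq_zero isPreconnected_off
      (off_qf hl hG hmem) hz
    exact Eq'_ne hl x this

/-! ### Part 5: tools for the cluster analysis -/

lemma W_markov {κ : Ker} {σ : Measure ℝ} {h : ℂ} {K r : ℝ} (hr : 0 < r)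
    (hW : κ.W σ h ≤ ENNReal.ofReal K) {s : Set ℝ}
    (hs : ∀ t ∈ s, 0 < |κ.k t * κ.β t| ∧ ‖κ.den h t‖ ^ 2 ≤ r ^ 2 * |κ.k t * κ.β t|) :
    σ s ≤ ENNReal.ofReal (K * r ^ 2) := by
  have hm : Measurable (fun t => ENNReal.ofReal |κ.k t * κ.β t| * (‖κ.den h t‖ₑ ^ 2)⁻¹) := by
    have h1 := κ.mk'
    have h2 := κ.mβ
    have h3 := κ.measurable_den h
    fun_prop
  have hr2 : 0 < r ^ 2 := by positivity
  have hsub : s ⊆ {t | ENNReal.ofReal (r ^ 2)⁻¹ ≤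
      ENNReal.ofReal |κ.k t * κ.β t| * (‖κ.den h t‖ₑ ^ 2)⁻¹} := by
    intro t ht
    obtain ⟨h1, h2⟩ := hs t ht
    simp only [mem_ofPred_eq]
    by_cases hd : κ.den h t = 0
    · rw [hd]
      simp only [enorm_zero, ne_eq, OfNat.ofNat_ne_zero, not_false_eq_true, zero_pow, ENNReal.inv_zero]
      rw [ENNReal.mul_top (ENNReal.ofReal_pos.mpr h1).ne']
      exact le_top
    · rw [Ker.W_integrand_eq hd]
      apply ENNReal.ofReal_le_ofReal
      have h0 : 0 < ‖κ.den h t‖ := norm_pos_iff.mpr hd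
      unfold Ker.wr
      rw [le_div_iff₀ (by positivity), inv_mul_le_iff₀ hr2]
      exact h2
  have h1 := mul_meas_ge_le_lintegral (μ := σ) hm (ENNReal.ofReal (r ^ 2)⁻¹)
  have h2 : ENNReal.ofReal (r ^ 2)⁻¹ * σ s ≤ ENNReal.ofReal K :=
    (mul_le_mul_right (measure_mono hsub) _).trans (h1.trans hW)
  have h3 : σ s = ENNReal.ofReal (r ^ 2) * (ENNReal.ofReal (r ^ 2)⁻¹ * σ s) := by
    rw [← mul_assoc, ← ENNReal.ofReal_mul hr2.le, mul_inv_cancel₀ hr2.ne', ENNReal.ofReal_one, one_mul]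
  rw [h3, mul_comm K, ENNReal.ofReal_mul hr2.le]
  exact mul_le_mul_right h2 _

lemma goodPsi_of_W {G : Measure ℝ} {K α β δ : ℝ} (hδ : 0 < δ)
    (h : ∀ η ∈ Ioo α β, δ ≤ |η| ∧ kPsi.W G (η : ℂ) ≤ ENNReal.ofReal K) {η : ℝ} (hη : η ∈ Ioo α β) :
    kPsi.Good G (η : ℂ) := by
  have hz : G {t | 1 / t ^ 2 ∈ Ioo α β} = 0 := by
    refine no_mass (p := fun t => 1 / t ^ 2) (r₀ := δ / 2) (by positivity) (K := K) ?_
    intro q hq r hr hrr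
    obtain ⟨h1, h2⟩ := h q hq
    refine W_markov hr h2 ?_
    intro t ht
    simp only [mem_ofPred_eq] at ht
    have t0 : t ≠ 0 := by
      rintro rfl
      simp at ht
      linarith
    have ek : |kPsi.k t * kPsi.β t| = (1 + t ^ 2) * t ^ 2 := by
      simp only [kPsi]
      rw [abs_mul, abs_neg, abs_of_nonneg (by positivity), abs_of_nonneg (by positivity)]
    have t2 : 0 < t ^ 2 := by positivity
    rw [ek]
    refine ⟨by positivity, ?_⟩
    have e : kPsi.den (q : ℂ) t = ((t ^ 2 * (1 / t ^ 2 - q) : ℝ) : ℂ) := by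
      have : t ^ 2 * (1 / t ^ 2 - q) = 1 + q * -t ^ 2 := by field_simp; ring
      rw [this]; simp [Ker.den, kPsi]
    rw [e, Complex.norm_real, Real.norm_eq_abs, abs_mul, abs_of_pos t2, mul_pow]
    have : |1 / t ^ 2 - q| ^ 2 ≤ r ^ 2 := by gcongr
    nlinarith [mul_le_mul_of_nonneg_left this (sq_nonneg (t ^ 2)), mul_pos t2 (pow_pos hr 2)]
  set d := min (η - α) (β - η) with hd
  have hd0 : 0 < d := lt_min (by linarith [hη.1]) (by linarith [hη.2])
  have hdp : 0 < 1 + (|η| + 1) / d := by positivity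
  refine ⟨(1 + (|η| + 1) / d)⁻¹, by positivity, ?_⟩
  have hae : ∀ᵐ t ∂G, ¬ (1 / t ^ 2 ∈ Ioo α β) := by
    rw [ae_iff]; simpa using hz
  filter_upwards [hae] with t ht
  rw [inv_mul_le_iff₀ hdp]
  have e : kPsi.den (η : ℂ) t = ((1 - η * t ^ 2 : ℝ) : ℂ) := by
    simp [Ker.den, kPsi]; ring
  rw [e, Complex.norm_real, Real.norm_eq_abs]
  set e := |1 - η * t ^ 2| with he
  have e0 : 0 ≤ e := abs_nonneg _
  have h1 : d * t ^ 2 ≤ e := by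
    rcases eq_or_ne t 0 with rfl | t0
    · simpa using e0
    have t2 : 0 < t ^ 2 := by positivity
    have h2 : d ≤ |1 / t ^ 2 - η| := by
      by_contra hcon
      push Not at hcon
      apply ht
      rw [abs_lt] at hcon
      have := min_le_left (η - α) (β - η)
      have := min_le_right (η - α) (β - η)
      constructor <;> linarith
    have : e = |1 / t ^ 2 - η| * t ^ 2 := by
      rw [he, ← abs_of_pos t2, ← abs_mul, abs_of_pos t2]
      congr 1; field_simp
    rw [this]; gcongr
  have h2 : 1 ≤ e + |η| * t ^ 2 := by
    have h3 := le_abs_self (1 - η * t ^ 2)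
    have h4 : η * t ^ 2 ≤ |η| * t ^ 2 := by gcongr; exact le_abs_self _
    linarith
  have h3 : t ^ 2 ≤ e / d := by rw [le_div_iff₀ hd0]; linarith
  calc 1 + t ^ 2 ≤ e + (|η| + 1) * t ^ 2 := by linarith
    _ ≤ e + (|η| + 1) * (e / d) := by gcongr
    _ = (1 + (|η| + 1) / d) * e := by ring

lemma goodN_of_W {ν : Measure ℝ} {K α β : ℝ}
    (h : ∀ η ∈ Ioo α β, kN.W ν (η : ℂ) ≤ ENNReal.ofReal K) {η : ℝ} (hη : η ∈ Ioo α β) :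
    kN.Good ν (η : ℂ) := by
  have eden : ∀ (q t : ℝ), kN.den (q : ℂ) t = ((-(t ^ 2 - q) : ℝ) : ℂ) := by
    intro q t; simp [Ker.den, kN]; ring
  have hz : ν {t | t ^ 2 ∈ Ioo α β} = 0 := by
    refine no_mass (p := fun t => t ^ 2) (r₀ := 1) (by positivity) (K := K) ?_
    intro q hq r hr hrr
    refine W_markov hr (h q hq) ?_
    intro t ht
    simp only [mem_ofPred_eq] at ht
    have ek : |kN.k t * kN.β t| = 1 := by simp [kN]
    rw [ek]
    refine ⟨one_pos, ?_⟩
    rw [eden, Complex.norm_real, Real.norm_eq_abs, abs_neg, mul_one]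
    gcongr
  set d := min (η - α) (β - η) with hd
  have hd0 : 0 < d := lt_min (by linarith [hη.1]) (by linarith [hη.2])
  have hdp : 0 < 1 + (1 + |η|) / d := by positivity
  refine ⟨(1 + (1 + |η|) / d)⁻¹, by positivity, ?_⟩
  have hae : ∀ᵐ t ∂ν, ¬ (t ^ 2 ∈ Ioo α β) := by
    rw [ae_iff]; simpa using hz
  filter_upwards [hae] with t ht
  rw [inv_mul_le_iff₀ hdp, eden, Complex.norm_real, Real.norm_eq_abs, abs_neg]
  set e := |t ^ 2 - η| with he
  have h2 : d ≤ e := by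
    by_contra hcon
    push Not at hcon
    apply ht
    rw [abs_lt] at hcon
    have := min_le_left (η - α) (β - η)
    have := min_le_right (η - α) (β - η)
    constructor <;> linarith
  have h3 : t ^ 2 ≤ e + |η| := by
    have := le_abs_self (t ^ 2 - η)
    have := le_abs_self η
    linarith
  have h4 : 1 ≤ e / d := by rw [le_div_iff₀ hd0]; linarith
  calc 1 + t ^ 2 ≤ e + (1 + |η|) * 1 := by linarith
    _ ≤ e + (1 + |η|) * (e / d) := by gcongr
    _ = (1 + (1 + |η|) / d) * e := by ring

/-- non-constant continuous functions map subintervals well -/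
lemma interval_image {f : ℝ → ℝ} {c d : ℝ} (hf : ContinuousOn f (Ioo c d))
    {p q : ℝ} (hp : p ∈ Ioo c d) (hq : q ∈ Ioo c d) (hpq : f p ≠ f q) :
    ∃ α β c' d', c' < d' ∧ Ioo c' d' ⊆ Ioo c d ∧ (∀ a ∈ Ioo c' d', f a ∈ Ioo α β) ∧
      Ioo α β ⊆ f '' Ioo c d := by
  wlog hlt : f p < f q generalizing p q
  · exact this hq hp hpq.symm (lt_of_le_of_ne (not_lt.mp hlt) hpq.symm)
  have hIVT : Icc (f p) (f q) ⊆ f '' Ioo c d := isPreconnected_Ioo.intermediate_value hp hq hf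
  have hsub : Ioo (f p) (f q) ⊆ f '' Ioo c d := Ioo_subset_Icc_self.trans hIVT
  obtain ⟨m, hm, hm2⟩ := hsub (show (f p + f q) / 2 ∈ Ioo (f p) (f q) from ⟨by linarith, by linarith⟩)
  have hopen : IsOpen (Ioo c d ∩ f ⁻¹' Ioo (f p) (f q)) := hf.isOpen_inter_preimage isOpen_Ioo isOpen_Ioo
  have hmem : m ∈ Ioo c d ∩ f ⁻¹' Ioo (f p) (f q) :=
    ⟨hm, by show f m ∈ Ioo (f p) (f q); rw [hm2]; exact ⟨by linarith, by linarith⟩⟩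
  obtain ⟨c', d', h1, h2⟩ := mem_nhds_iff_exists_Ioo_subset.mp (hopen.mem_nhds hmem)
  exact ⟨f p, f q, c', d', h1.1.trans h1.2, fun a ha => (h2 ha).1, fun a ha => (h2 ha).2, hsub⟩

lemma exists_low {a : ℂ} (ha : a.im ≤ 0) {P : ℂ → Prop} (h : ∀ᶠ z in 𝓝 a, P z) :
    ∃ z : ℂ, z.im < 0 ∧ P z := by
  have ht : Tendsto (fun e : ℝ => a - Complex.I * (e : ℂ)) (𝓝[>] 0) (𝓝 a) := by
    have : Continuous (fun e : ℝ => a - Complex.I * (e : ℂ)) := by fun_prop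
    have := this.tendsto 0
    simp only [Complex.ofReal_zero, mul_zero, sub_zero] at this
    exact this.mono_left nhdsWithin_le_nhds
  obtain ⟨e, he, he2⟩ := ((ht.eventually h).and self_mem_nhdsWithin).exists
  refine ⟨_, ?_, he⟩
  have : (0 : ℝ) < e := he2
  simp
  linarith

/-- real points give frequent points in punctured neighborhoods -/
lemma real_freq {a c d : ℝ} (ha : a ∈ Ioo c d) {P : ℂ → Prop} (h : ∀ b ∈ Ioo c d, P (b : ℂ)) :
    ∃ᶠ z in 𝓝[≠] (a : ℂ), P z := by
  have ht : Tendsto (fun y : ℝ => (y : ℂ)) (𝓝[>] a) (𝓝[≠] (a : ℂ)) := by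
    refine tendsto_nhdsWithin_iff.mpr ⟨?_, ?_⟩
    · exact Complex.continuous_ofReal.continuousAt.tendsto.mono_left nhdsWithin_le_nhds
    · filter_upwards [self_mem_nhdsWithin] with y hy h
      simp at h
      exact (ne_of_gt hy) h
  refine ht.frequently (Eventually.frequently ?_)
  filter_upwards [nhdsWithin_le_nhds (isOpen_Ioo.mem_nhds ha)] with y hy
  exact h y hy

lemma F_diff_low {l : ℝ} (hl : l ∈ Ioo (0 : ℝ) 1) {G ν : Measure ℝ} [IsFiniteMeasure G]
    [IsProbabilityMeasure ν] (hG : G ≠ 0) {x : ℝ} (hx : x ≠ 0) :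
    DifferentiableOn ℂ (fun A => Ff l G ν x A) {A : ℂ | A.im < 0} := by
  intro A hA
  exact (diff_F (U := fun _ => (x : ℂ)) (A := fun A => A) (differentiableAt_const _)
      differentiableAt_id (by exact_mod_cast hx) ((hf_off hl (by simp) hA).goodPsi G)
      ((off_qf hl hG hA).goodN ν)).differentiableWithinAt

/-- no accumulation of zeros in the lower half-plane -/
lemma no_acc_low {l : ℝ} (hl : l ∈ Ioo (0 : ℝ) 1) {G ν : Measure ℝ} [IsFiniteMeasure G]
    [IsProbabilityMeasure ν] (hG : G ≠ 0) {x : ℝ} (hx : x ≠ 0) {a : ℂ} (ha : a.im < 0)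
    (hfr : ∃ᶠ z in 𝓝[≠] a, Ff l G ν x z = 0) : False := by
  have := ((F_diff_low hl hG hx (ν := ν)).analyticOnNhd
    isOpen_low).eqOn_zero_of_preconnected_of_frequently_eq_zero
      (convex_halfSpace_im_lt 0).isPreconnected ha hfr
  exact F_nontriv hl hG hx (ν := ν) this

lemma analyticAt_of_ev {f : ℂ → ℂ} {a : ℂ} (h : ∀ᶠ z in 𝓝 a, DifferentiableAt ℂ f z) :
    AnalyticAt ℂ f a := Complex.analyticAt_iff_eventually_differentiableAt.mpr h

/-- local analyticity of `q` near good points -/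
lemma q_analytic {l : ℝ} {G : Measure ℝ} [IsFiniteMeasure G] {x : ℝ} (hx : x ≠ 0) {a : ℂ}
    (hg : kPsi.Good G (hf l x a)) : AnalyticAt ℂ (fun A => qf l G x A) a := by
  apply analyticAt_of_ev
  have hc : ContinuousAt (fun A => hf l x A) a := by unfold hf Bf; fun_prop
  filter_upwards [hc.eventually ((kPsi.isOpen_good G).mem_nhds hg)] with z hz
  exact (diff_state (U := fun _ => (x : ℂ)) (A := fun A => A) (differentiableAt_const _)
      differentiableAt_id (by exact_mod_cast hx) hz).2.2

lemma F_analytic {l : ℝ} {G ν : Measure ℝ} [IsFiniteMeasure G] [IsFiniteMeasure ν]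
    {x : ℝ} (hx : x ≠ 0) {a : ℂ}
    (hg : kPsi.Good G (hf l x a)) (hq : kN.Good ν (qf l G x a)) :
    AnalyticAt ℂ (fun A => Ff l G ν x A) a := by
  apply analyticAt_of_ev
  have hc : ContinuousAt (fun A => hf l x A) a := by unfold hf Bf; fun_prop
  have hc2 := (q_analytic hx hg).continuousAt
  filter_upwards [hc.eventually ((kPsi.isOpen_good G).mem_nhds hg),
    hc2.eventually ((kN.isOpen_good ν).mem_nhds hq)] with z hz hz2
  exact diff_F (U := fun _ => (x : ℂ)) (A := fun A => A) (differentiableAt_const _)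
      differentiableAt_id (by exact_mod_cast hx) hz hz2

/-- no accumulation of zeros on intervals of the real line -/
lemma no_acc_real {l : ℝ} (hl : l ∈ Ioo (0 : ℝ) 1) {G ν : Measure ℝ} [IsFiniteMeasure G]
    [IsProbabilityMeasure ν] (hG : G ≠ 0) {x : ℝ} (hx : x ≠ 0) {a c d : ℝ} (ha : a ∈ Ioo c d)
    (hg : kPsi.Good G (hf l x a)) (hq : kN.Good ν (qf l G x a))
    (hF : ∀ b ∈ Ioo c d, Ff l G ν x (b : ℂ) = 0) : False := by
  have h1 := (F_analytic hx hg hq).frequently_zero_iff_eventually_zero.mp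
    (real_freq ha (P := fun z => Ff l G ν x z = 0) hF)
  obtain ⟨z, hz, hz2⟩ := exists_low (by simp) h1.eventually_nhds
  exact no_acc_low hl hG hx hz (hz2.filter_mono nhdsWithin_le_nhds).frequently

/-! ### Part 6: cluster analysis -/

/-- standing hypotheses on a solution -/
structure Sol (l : ℝ) (G ν : Measure ℝ) (A : ℂ → ℂ) : Prop where
  cont : ContinuousOn A UHP
  im_neg : ∀ u ∈ UHP, (A u).im < 0
  zero : ∀ u ∈ UHP, Ff l G ν u (A u) = 0

lemma cluster_F {l : ℝ} (hl : l ∈ Ioo (0 : ℝ) 1) {G ν : Measure ℝ} [IsFiniteMeasure G]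
    [IsProbabilityMeasure ν] (hG : G ≠ 0) {A : ℂ → ℂ} (hS : Sol l G ν A)
    {x : ℝ} (hx : x ≠ 0) {a : ℂ} (ha : MapClusterPt a (𝓝[UHP] (x : ℂ)) A)
    {δ Λ : ℝ} (hδ : 0 < δ) (hδ' : δ < ‖hf l x a‖) (hΛ : 1 ≤ Λ) (hΛ' : ‖hf l x a‖ < Λ) :
    kPsi.W G (hf l x a) ≤ ENNReal.ofReal (1 / δ ^ 2) ∧
    kN.W ν (qf l G x a) ≤ ENNReal.ofReal (1 / (l * (1 - l) * Rlow G Λ ^ 2)) ∧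
    Ff l G ν x a = 0 := by
  have hxc : (x : ℂ) ≠ 0 := by exact_mod_cast hx
  set L := 𝓝[UHP] (x : ℂ) ⊓ comap A (𝓝 a) with hL
  have hne : L.NeBot := by
    rw [hL, neBot_inf_comap_iff_map, inf_comm]; exact ha
  have tu : Tendsto (fun u : ℂ => u) L (𝓝 (x : ℂ)) :=
    tendsto_id.mono_left (inf_le_left.trans nhdsWithin_le_nhds)
  have tA : Tendsto A L (𝓝 a) := tendsto_comap.mono_left inf_le_right
  have eU : ∀ᶠ u in L, u ∈ UHP := by
    have : ∀ᶠ u in 𝓝[UHP] (x : ℂ), u ∈ UHP := self_mem_nhdsWithin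
    exact this.filter_mono inf_le_left
  have tB : Tendsto (fun u => Bf l u (A u)) L (𝓝 (Bf l x a)) :=
    (tA.const_mul _).add (tendsto_const_nhds.div tu hxc)
  have th : Tendsto (fun u => hf l u (A u)) L (𝓝 (hf l x a)) := tA.mul tB
  have mb : ∀ᶠ u in L, _ := eU.mono fun u hu =>
    main_bounds hl (G := G) (ν := ν) hu (hS.im_neg u hu) (hS.zero u hu)
  have e1 : ∀ᶠ u in L, δ < ‖hf l u (A u)‖ := th.norm.eventually (lt_mem_nhds hδ')
  have e2 : ∀ᶠ u in L, ‖hf l u (A u)‖ < Λ := th.norm.eventually (gt_mem_nhds hΛ')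
  obtain ⟨w1, tpsi⟩ := Ker.I_tendsto (κ := kPsi) (σ := G) th (K := 1 / δ ^ 2)
    (mb.mono fun u hu => hu.1.goodPsi G) (by
      filter_upwards [mb, e1] with u hu h1
      rw [le_div_iff₀ (by positivity)]
      refine le_trans ?_ hu.2.2.1
      have := wr_int_nonneg kPsi G (hf l u (A u))
      gcongr)
  have ts1 : Tendsto (fun u => s1f l G u (A u)) L (𝓝 (s1f l G x a)) := tu.sub (tpsi.mul tB)
  have ts2 : Tendsto (fun u => s2f l G u (A u)) L (𝓝 (s2f l G x a)) :=
    tu.sub ((tpsi.mul tA).const_mul _)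
  have tq : Tendsto (fun u => qf l G u (A u)) L (𝓝 (qf l G x a)) := ts1.mul ts2
  have hR := Rlow_pos hG hΛ
  have l0 := hl.1
  have l1 : 0 < 1 - l := by linarith [hl.2]
  obtain ⟨w2, tN⟩ := Ker.I_tendsto (κ := kN) (σ := ν) tq (K := 1 / (l * (1 - l) * Rlow G Λ ^ 2))
    (mb.mono fun u hu => hu.2.1.goodN ν) (by
      filter_upwards [mb, e2] with u hu h2
      rw [le_div_iff₀ (by positivity), mul_comm]
      refine le_trans ?_ hu.2.2.2.1
      have := wr_int_nonneg kN ν (qf l G u (A u))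
      have := Rlow_le (hu.1.goodPsi G) hΛ h2.le
      gcongr)
  refine ⟨w1, w2, ?_⟩
  have tF : Tendsto (fun u => Ff l G ν u (A u)) L (𝓝 (Ff l G ν x a)) := tA.sub (ts2.mul tN)
  have tF0 : Tendsto (fun u => Ff l G ν u (A u)) L (𝓝 0) := by
    refine tendsto_const_nhds.congr' ?_
    filter_upwards [eU] with u hu
    exact (hS.zero u hu).symm
  exact tendsto_nhds_unique tF tF0

lemma cluster_F' {l : ℝ} (hl : l ∈ Ioo (0 : ℝ) 1) {G ν : Measure ℝ} [IsFiniteMeasure G]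
    [IsProbabilityMeasure ν] (hG : G ≠ 0) {A : ℂ → ℂ} (hS : Sol l G ν A)
    {x : ℝ} (hx : x ≠ 0) {a : ℂ} (ha : MapClusterPt a (𝓝[UHP] (x : ℂ)) A)
    (h0 : hf l x a ≠ 0) : Ff l G ν x a = 0 :=
  (cluster_F hl hG hS hx ha (δ := ‖hf l x a‖ / 2) (Λ := ‖hf l x a‖ + 1)
    (by have := norm_pos_iff.mpr h0; positivity) (by have := norm_pos_iff.mpr h0; linarith)
    (by have := norm_nonneg (hf l x a); linarith) (by linarith)).2.2

lemma cluster_im {l : ℝ} {G ν : Measure ℝ} {A : ℂ → ℂ} (hS : Sol l G ν A)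
    {x : ℝ} {a : ℂ} (ha : MapClusterPt a (𝓝[UHP] (x : ℂ)) A) : a.im ≤ 0 := by
  by_contra hcon
  push Not at hcon
  have h1 : ∀ᶠ z : ℂ in 𝓝 a, 0 < z.im := isOpen_UHP.mem_nhds hcon
  have h2 := ha.frequently h1
  obtain ⟨u, hu, hu2⟩ := (h2.and_eventually (self_mem_nhdsWithin (a := (x : ℂ)) (s := UHP))).exists
  have := hS.im_neg u hu2
  linarith

lemma crossing {A : ℂ → ℂ} (hc : ContinuousOn A UHP) {x : ℝ} {a : ℂ}
    (ha : MapClusterPt a (𝓝[UHP] (x : ℂ)) A) {r₀ : ℝ}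
    (hr₀ : ∃ᶠ u in 𝓝[UHP] (x : ℂ), r₀ ≤ ‖A u - a‖) {r : ℝ} (hr : 0 < r) (hr' : r < r₀) :
    ∃ b, MapClusterPt b (𝓝[UHP] (x : ℂ)) A ∧ ‖b - a‖ = r := by
  have hfr : ∃ᶠ u in 𝓝[UHP] (x : ℂ), A u ∈ Metric.sphere a r := by
    rw [(Metric.nhdsWithin_basis_ball).frequently_iff]
    intro ε hε
    have hmem : Metric.ball (x : ℂ) ε ∩ UHP ∈ 𝓝[UHP] (x : ℂ) :=
      inter_mem (nhdsWithin_le_nhds (Metric.ball_mem_nhds _ hε)) self_mem_nhdsWithin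
    obtain ⟨u1, h1, hu1⟩ := (hr₀.and_eventually hmem).exists
    obtain ⟨u2, h2, hu2⟩ := ((ha.frequently (Metric.ball_mem_nhds a hr)).and_eventually hmem).exists
    have hconv : IsPreconnected (Metric.ball (x : ℂ) ε ∩ UHP) :=
      ((convex_ball _ _).inter convex_UHP).isPreconnected
    have hcont : ContinuousOn (fun u => ‖A u - a‖) (Metric.ball (x : ℂ) ε ∩ UHP) :=
      ((hc.mono inter_subset_right).sub continuousOn_const).norm
    have := hconv.intermediate_value hu2 hu1 hcont
    have h2' : ‖A u2 - a‖ < r := by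
      have : A u2 ∈ Metric.ball a r := h2
      rwa [Metric.mem_ball, dist_eq_norm] at this
    obtain ⟨u, hu, hur⟩ := this (show r ∈ Icc _ _ from ⟨h2'.le, hr'.le.trans h1⟩)
    refine ⟨u, hu, ?_⟩
    rw [mem_sphere_iff_norm]; exact hur
  obtain ⟨b, hb, hb2⟩ := (isCompact_sphere a r).exists_mapClusterPt_of_frequently hfr
  exact ⟨b, hb2, mem_sphere_iff_norm.mp hb⟩

/-- no interval of real cluster points -/
lemma no_interval {l : ℝ} (hl : l ∈ Ioo (0 : ℝ) 1) {G ν : Measure ℝ} [IsFiniteMeasure G]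
    [IsProbabilityMeasure ν] (hG : G ≠ 0) {A : ℂ → ℂ} (hS : Sol l G ν A)
    {x : ℝ} (hx : x ≠ 0) {c d : ℝ} (hcd : c < d)
    (hJ : ∀ a ∈ Ioo c d, MapClusterPt (a : ℂ) (𝓝[UHP] (x : ℂ)) A) : False := by
  have hxc : (x : ℂ) ≠ 0 := by exact_mod_cast hx
  set hr : ℝ → ℝ := fun a => a * (l * a + (1 - l) / x) with hhr
  have hrc : Continuous hr := by rw [hhr]; fun_prop
  have hre : ∀ a : ℝ, hf l x a = (hr a : ℂ) := by
    intro a; simp only [hf, Bf, hhr]; push_cast; rfl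
  have hnorm : ∀ a : ℝ, ‖hf l x a‖ = |hr a| := by
    intro a; rw [hre, Complex.norm_real, Real.norm_eq_abs]
  -- choose a base point
  obtain ⟨a0, ha0, ha0'⟩ : ∃ a0 ∈ Ioo c d, hr a0 ≠ 0 := by
    have hfin : ({0, -((1 - l) / x) / l} : Set ℝ).Finite := by simp
    obtain ⟨a0, h1, h2⟩ := ((Ioo_infinite hcd).sdiff hfin).nonempty
    refine ⟨a0, h1, ?_⟩
    simp only [mem_insert_iff, mem_singleton_iff, not_or] at h2
    refine mul_ne_zero h2.1 ?_
    intro h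
    apply h2.2
    have := hl.1.ne'
    field_simp
    field_simp at h
    linarith
  have hpos : 0 < |hr a0| := abs_pos.mpr ha0'
  set δ := |hr a0| / 2 with hδ
  set Λ := |hr a0| + 1 with hΛ
  have hδ0 : 0 < δ := by positivity
  have hΛ1 : 1 ≤ Λ := by rw [hΛ]; linarith
  have hev : ∀ᶠ a in 𝓝 a0, a ∈ Ioo c d ∧ δ < |hr a| ∧ |hr a| < Λ := by
    have h1 := hrc.abs.continuousAt (x := a0)
    have h2 := h1.eventually (lt_mem_nhds (show δ < |hr a0| by rw [hδ]; linarith))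
    have h3 := h1.eventually (gt_mem_nhds (show |hr a0| < Λ by rw [hΛ]; linarith))
    filter_upwards [isOpen_Ioo.mem_nhds ha0, h2, h3] with a h1 h2 h3
    exact ⟨h1, h2, h3⟩
  obtain ⟨c0, d0, h0, hsub⟩ := mem_nhds_iff_exists_Ioo_subset.mp hev
  have key : ∀ a ∈ Ioo c0 d0, kPsi.W G (hf l x a) ≤ ENNReal.ofReal (1 / δ ^ 2) ∧
      kN.W ν (qf l G x a) ≤ ENNReal.ofReal (1 / (l * (1 - l) * Rlow G Λ ^ 2)) ∧
      Ff l G ν x a = 0 := by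
    intro a ha
    obtain ⟨h1, h2, h3⟩ := hsub ha
    exact cluster_F hl hG hS hx (hJ a h1) hδ0 (by rwa [hnorm]) hΛ1 (by rwa [hnorm])
  -- nonconstant h
  have hnc : ∃ q ∈ Ioo c0 d0, hr a0 ≠ hr q := by
    by_contra hcon
    push Not at hcon
    have h1 : ∃ᶠ z in 𝓝[≠] (a0 : ℂ), hf l x z = hf l x a0 := by
      refine real_freq h0 (P := fun z => hf l x z = hf l x a0) ?_
      intro b hb
      rw [hre, hre, hcon b hb]
    have han : AnalyticAt ℂ (fun z => hf l x z) (a0 : ℂ) := by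
      apply analyticAt_of_ev
      refine Eventually.of_forall fun z => ?_
      unfold hf Bf; fun_prop
    have := (han.frequently_eq_iff_eventually_eq (g := fun _ => hf l x a0) analyticAt_const).mp h1
    exact hf_not_const hl this
  obtain ⟨q, hq, hne⟩ := hnc
  obtain ⟨α, β, c1, d1, hcd1, hsub1, him1, himg1⟩ := interval_image hrc.continuousOn h0 hq hne
  have hgood1 : ∀ a ∈ Ioo c1 d1, kPsi.Good G (hf l x a) := by
    intro a ha
    rw [hre]
    refine goodPsi_of_W hδ0 (K := 1 / δ ^ 2) (α := α) (β := β) ?_ (him1 a ha)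
    intro η hη
    obtain ⟨b, hb, rfl⟩ := himg1 hη
    refine ⟨(hsub hb).2.1.le, ?_⟩
    rw [← hre]; exact (key b hb).1
  -- q
  set qr : ℝ → ℝ := fun a => (qf l G x a).re with hqr
  have hqe : ∀ a : ℝ, qf l G x a = (qr a : ℂ) := by
    intro a
    simp only [hqr, qf, s1f, s2f, Bf]
    rw [hre, I_real]
    norm_cast
  have hqc : ContinuousOn qr (Ioo c1 d1) := by
    intro a ha
    refine ContinuousAt.continuousWithinAt ?_
    have h1 := (q_analytic hx (hgood1 a ha)).continuousAt
    have h2 : ContinuousAt (fun a : ℝ => qf l G x (a : ℂ)) a :=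
      ContinuousAt.comp (f := fun a : ℝ => (a : ℂ)) (g := fun A => qf l G x A) h1
        Complex.continuous_ofReal.continuousAt
    exact Complex.continuous_re.continuousAt.comp h2
  obtain ⟨a2, ha2, hN⟩ : ∃ a2 ∈ Ioo c1 d1, kN.Good ν (qf l G x (a2 : ℂ)) := by
    set a1 := (c1 + d1) / 2 with ha1
    have ha1m : a1 ∈ Ioo c1 d1 := ⟨by rw [ha1]; linarith, by rw [ha1]; linarith⟩
    by_cases hcst : ∃ q ∈ Ioo c1 d1, qr a1 ≠ qr q
    · obtain ⟨q, hq, hne⟩ := hcst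
      obtain ⟨α', β', c2, d2, hcd2, hsub2, him2, himg2⟩ := interval_image hqc ha1m hq hne
      have hm : (c2 + d2) / 2 ∈ Ioo c2 d2 := ⟨by linarith, by linarith⟩
      refine ⟨(c2 + d2) / 2, hsub2 hm, ?_⟩
      rw [hqe]
      refine goodN_of_W (K := 1 / (l * (1 - l) * Rlow G Λ ^ 2)) (α := α') (β := β') ?_ (him2 _ hm)
      intro η hη
      obtain ⟨b, hb, rfl⟩ := himg2 hη
      rw [← hqe]
      exact (key b (hsub1 hb)).2.1
    · push Not at hcst
      refine ⟨a1, ha1m, ?_⟩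
      have h1 : ∃ᶠ z in 𝓝[≠] (a1 : ℂ), qf l G x z = qf l G x a1 := by
        refine real_freq ha1m (P := fun z => qf l G x z = qf l G x a1) ?_
        intro b hb
        rw [hqe, hqe, hcst b hb]
      have h2 := ((q_analytic hx (hgood1 a1 ha1m)).frequently_eq_iff_eventually_eq
        (g := fun _ => qf l G x a1) analyticAt_const).mp h1
      obtain ⟨z, hz, hz2⟩ := exists_low (by simp) h2
      rw [← hz2]
      exact (off_qf hl hG hz).goodN ν
  exact no_acc_real hl hG hx ha2 (hgood1 a2 ha2) hN (fun b hb => (key b (hsub1 hb)).2.2)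

theorem dichotomy {l : ℝ} (hl : l ∈ Ioo (0 : ℝ) 1) {G ν : Measure ℝ} [IsFiniteMeasure G]
    [IsProbabilityMeasure ν] (hG : G ≠ 0) {A : ℂ → ℂ} (hS : Sol l G ν A)
    {x : ℝ} (hx : x ≠ 0) :
    (∃ a, Tendsto A (𝓝[UHP] (x : ℂ)) (𝓝 a)) ∨
      Tendsto (fun u => ‖A u‖) (𝓝[UHP] (x : ℂ)) atTop := by
  by_contra hcon
  push Not at hcon
  obtain ⟨hno, hninf⟩ := hcon
  -- a cluster point
  obtain ⟨a0, ha0⟩ : ∃ a, MapClusterPt a (𝓝[UHP] (x : ℂ)) A := by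
    rw [tendsto_atTop] at hninf
    push Not at hninf
    obtain ⟨C, hC⟩ := hninf
    have : ∃ᶠ u in 𝓝[UHP] (x : ℂ), A u ∈ Metric.closedBall (0 : ℂ) C := by
      refine hC.mono fun u hu => ?_
      rw [mem_closedBall_zero_iff]
      exact hu.le
    obtain ⟨a, -, h⟩ := (isCompact_closedBall (0 : ℂ) C).exists_mapClusterPt_of_frequently this
    exact ⟨a, h⟩
  have hr0 : ∀ a, ∃ r₀ > 0, ∃ᶠ u in 𝓝[UHP] (x : ℂ), r₀ ≤ ‖A u - a‖ := by
    intro a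
    have := hno a
    rw [Metric.tendsto_nhds] at this
    push Not at this
    obtain ⟨ε, hε, h⟩ := this
    refine ⟨ε, hε, h.mono fun u hu => ?_⟩
    rw [← dist_eq_norm]; exact hu
  by_cases hlow : ∃ a1, MapClusterPt a1 (𝓝[UHP] (x : ℂ)) A ∧ a1.im < 0
  · obtain ⟨a1, ha1, him⟩ := hlow
    obtain ⟨r₀, hr₀, hfr⟩ := hr0 a1
    refine no_acc_low hl hG hx him (ν := ν) ?_
    rw [(Metric.nhdsWithin_basis_ball).frequently_iff]
    intro ε hε
    set r := min (min r₀ ε) (-a1.im) / 2 with hr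
    have hmin : 0 < min (min r₀ ε) (-a1.im) := lt_min (lt_min hr₀ hε) (by linarith)
    have hrp : 0 < r := by positivity
    have h1 : r < r₀ := by
      have := (min_le_left (min r₀ ε) (-a1.im)).trans (min_le_left _ _)
      rw [hr]; linarith
    have h2 : r < ε := by
      have := (min_le_left (min r₀ ε) (-a1.im)).trans (min_le_right _ _)
      rw [hr]; linarith
    have h3 : r < -a1.im := by
      have := min_le_right (min r₀ ε) (-a1.im)
      rw [hr]; linarith
    obtain ⟨b, hb, hbr⟩ := crossing hS.cont ha1 hfr hrp h1
    refine ⟨b, ⟨by rw [Metric.mem_ball, dist_eq_norm, hbr]; exact h2, ?_⟩, ?_⟩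
    · intro hba
      rw [mem_singleton_iff] at hba
      rw [hba, sub_self, norm_zero] at hbr
      linarith
    · have hbi : b.im < 0 := by
        have := (Complex.abs_im_le_norm (b - a1)).trans_eq hbr
        rw [Complex.sub_im] at this
        have := (abs_le.mp this).2
        linarith
      exact cluster_F' hl hG hS hx hb (hf_off hl (by simp) hbi).ne_zero
  · push Not at hlow
    have hreal : ∀ a, MapClusterPt a (𝓝[UHP] (x : ℂ)) A → a = (a.re : ℂ) := by
      intro a ha
      have h1 := cluster_im hS ha
      have h2 := hlow a ha
      apply Complex.ext
      · simp
      · simp; linarith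
    obtain ⟨r₀, hr₀, hfr⟩ := hr0 a0
    have hpm : ∀ r, 0 < r → r < r₀ → MapClusterPt ((a0.re + r : ℝ) : ℂ) (𝓝[UHP] (x : ℂ)) A ∨
        MapClusterPt ((a0.re - r : ℝ) : ℂ) (𝓝[UHP] (x : ℂ)) A := by
      intro r h1 h2
      obtain ⟨b, hb, hbr⟩ := crossing hS.cont ha0 hfr h1 h2
      have e : |b.re - a0.re| = r := by
        have e1 := hreal b hb
        have e2 := hreal a0 ha0
        rw [e1, e2, ← Complex.ofReal_sub, Complex.norm_real] at hbr
        exact hbr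
      rw [hreal b hb] at hb
      rcases abs_eq h1.le |>.mp e with h | h
      · left; rwa [show a0.re + r = b.re by linarith]
      · right; rwa [show a0.re - r = b.re by linarith]
    have hclosed : IsClosed {a : ℝ | MapClusterPt (a : ℂ) (𝓝[UHP] (x : ℂ)) A} :=
      (isClosed_setOfPred_clusterPt (f := map A (𝓝[UHP] (x : ℂ)))).preimage Complex.continuous_ofReal
    by_cases hall : ∀ r, 0 < r → r < r₀ → MapClusterPt ((a0.re + r : ℝ) : ℂ) (𝓝[UHP] (x : ℂ)) A
    · refine no_interval hl hG hS hx (c := a0.re) (d := a0.re + r₀) (by linarith) ?_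
      intro a ha
      have := hall (a - a0.re) (by linarith [ha.1]) (by linarith [ha.2])
      rwa [show a0.re + (a - a0.re) = a by ring] at this
    · push Not at hall
      obtain ⟨r, h1, h2, h3⟩ := hall
      have hev : ∀ᶠ s in 𝓝 r, (0 < s ∧ s < r₀) ∧
          ¬ MapClusterPt ((a0.re + s : ℝ) : ℂ) (𝓝[UHP] (x : ℂ)) A := by
        have hc : ContinuousAt (fun s => a0.re + s) r := by fun_prop
        filter_upwards [isOpen_Ioo.mem_nhds (show r ∈ Ioo 0 r₀ from ⟨h1, h2⟩),
          hc.eventually (hclosed.isOpen_compl.mem_nhds h3)] with s hs hs2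
        exact ⟨hs, hs2⟩
      obtain ⟨c, d, hr, hsub⟩ := mem_nhds_iff_exists_Ioo_subset.mp hev
      refine no_interval hl hG hS hx (c := a0.re - d) (d := a0.re - c)
        (by linarith [hr.1, hr.2]) ?_
      intro a ha
      obtain ⟨⟨k1, k2⟩, k3⟩ := hsub (show a0.re - a ∈ Ioo c d from ⟨by linarith [ha.2], by linarith [ha.1]⟩)
      have := (hpm _ k1 k2).resolve_left k3
      rwa [show a0.re - (a0.re - a) = a by ring] at this

/-! ### Part 7: infinite limits only at atoms of `ν` -/

lemma neBot_UHP (x : ℝ) : (𝓝[UHP] (x : ℂ)).NeBot := by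
  rw [← mem_closure_iff_nhdsWithin_neBot, UHP, Complex.closure_setOfPred_lt_im]
  simp

lemma levy_bound {ι : Type*} {L : Filter ι} [L.NeBot] [L.IsCountablyGenerated]
    {G : Measure ℝ} [IsFiniteMeasure G] {h : ι → ℂ}
    (hinf : Tendsto (fun n => ‖h n‖) L atTop) (hoff : ∀ᶠ n in L, Off (h n))
    (hW : ∀ᶠ n in L, (∫ t, kPsi.wr (h n) t ∂G) * ‖h n‖ ^ 2 ≤ 1) :
    Integrable (fun t : ℝ => (1 + t ^ 2) / t ^ 2) G ∧ ∫ t : ℝ, (1 + t ^ 2) / t ^ 2 ∂G ≤ 1 := by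
  have hm : ∀ n, Measurable (fun t => ENNReal.ofReal (kPsi.wr (h n) t * ‖h n‖ ^ 2)) := by
    intro n
    have := Ker.measurable_wr (κ := kPsi) (h n)
    fun_prop
  have hn0 : ∀ᶠ n in L, h n ≠ 0 := by
    filter_upwards [hinf.eventually_gt_atTop 0] with n hn
    exact norm_pos_iff.mp hn
  have hlim : ∀ t : ℝ, t ≠ 0 →
      Tendsto (fun n => kPsi.wr (h n) t * ‖h n‖ ^ 2) L (𝓝 ((1 + t ^ 2) / t ^ 2)) := by
    intro t ht
    have hti : Tendsto (fun n => (h n)⁻¹) L (𝓝 0) :=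
      tendsto_inv₀_cobounded.comp (tendsto_norm_atTop_iff_cobounded.mp hinf)
    have h1 : Tendsto (fun n => (1 + t ^ 2) * t ^ 2 / ‖(h n)⁻¹ - (t : ℂ) ^ 2‖ ^ 2) L
        (𝓝 ((1 + t ^ 2) * t ^ 2 / ‖(0 : ℂ) - (t : ℂ) ^ 2‖ ^ 2)) := by
      refine tendsto_const_nhds.div ((hti.sub tendsto_const_nhds).norm.pow 2) ?_
      simp [ht]
    have e : (1 + t ^ 2) * t ^ 2 / ‖(0 : ℂ) - (t : ℂ) ^ 2‖ ^ 2 = (1 + t ^ 2) / t ^ 2 := by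
      rw [zero_sub, norm_neg, norm_pow, Complex.norm_real, Real.norm_eq_abs, sq_abs]
      field_simp
    rw [e] at h1
    refine h1.congr' ?_
    filter_upwards [hn0] with n hn
    have e2 : (h n)⁻¹ - (t : ℂ) ^ 2 = (h n)⁻¹ * kPsi.den (h n) t := by
      simp only [Ker.den, kPsi]; push_cast; field_simp; ring
    rw [e2, norm_mul, norm_inv, Ker.wr]
    have e3 : |kPsi.k t * kPsi.β t| = (1 + t ^ 2) * t ^ 2 := by
      simp only [kPsi]; rw [mul_neg, abs_neg, abs_of_nonneg (by positivity)]
    rw [e3, mul_pow, inv_pow]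
    have := norm_pos_iff.mpr hn
    by_cases hd : ‖kPsi.den (h n) t‖ = 0
    · rw [hd]; simp
    · field_simp
  have hfat : ∫⁻ t : ℝ, ENNReal.ofReal ((1 + t ^ 2) / t ^ 2) ∂G ≤ 1 := by
    calc ∫⁻ t : ℝ, ENNReal.ofReal ((1 + t ^ 2) / t ^ 2) ∂G
        ≤ ∫⁻ t, liminf (fun n => ENNReal.ofReal (kPsi.wr (h n) t * ‖h n‖ ^ 2)) L ∂G := by
          refine lintegral_mono fun t => ?_
          by_cases ht : t = 0
          · subst ht; simp
          · have := (ENNReal.continuous_ofReal.tendsto _).comp (hlim t ht)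
            exact this.liminf_eq.ge
      _ ≤ liminf (fun n => ∫⁻ t, ENNReal.ofReal (kPsi.wr (h n) t * ‖h n‖ ^ 2) ∂G) L :=
          lintegral_liminf_le hm
      _ ≤ 1 := by
          refine liminf_le_of_frequently_le' (Eventually.frequently ?_)
          filter_upwards [hoff, hW] with n h1 h2
          rw [← ofReal_integral_eq_lintegral_ofReal ((h1.goodPsi G).integrable_wr.mul_const _)
            (ae_of_all _ fun t => mul_nonneg (Ker.wr_nonneg _ _) (by positivity)),
            integral_mul_const]
          exact ENNReal.ofReal_le_one.mpr h2
  have hmj : Measurable (fun t : ℝ => (1 + t ^ 2) / t ^ 2) := by fun_prop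
  have hj0 : ∀ t : ℝ, 0 ≤ (1 + t ^ 2) / t ^ 2 := fun t => by positivity
  have hi : Integrable (fun t : ℝ => (1 + t ^ 2) / t ^ 2) G := by
    refine ⟨hmj.aestronglyMeasurable, ?_⟩
    rw [hasFiniteIntegral_iff_ofReal (ae_of_all _ hj0)]
    exact hfat.trans_lt ENNReal.one_lt_top
  refine ⟨hi, ?_⟩
  rw [← ofReal_integral_eq_lintegral_ofReal hi (ae_of_all _ hj0)] at hfat
  exact ENNReal.ofReal_le_one.mp hfat

lemma psi_infty {G : Measure ℝ} [IsFiniteMeasure G] {h : ℂ}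
    (hi : Integrable (fun t : ℝ => (1 + t ^ 2) / t ^ 2) G)
    (hj : ∫ t : ℝ, (1 + t ^ 2) / t ^ 2 ∂G ≤ 1)
    (hoff : Off h) (hW : (∫ t, kPsi.wr h t ∂G) * ‖h‖ ^ 2 ≤ 1) :
    ‖kPsi.I G h - (G.real {0} : ℂ)‖ ≤ 1 / ‖h‖ := by
  have hg := hoff.goodPsi G
  have hh : 0 < ‖h‖ := norm_pos_iff.mpr hoff.ne_zero
  have e0 : (G.real {0} : ℂ) = ∫ t, ({0} : Set ℝ).indicator (fun _ => (1 : ℂ)) t ∂G := by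
    rw [integral_indicator (measurableSet_singleton 0)]
    simp [Measure.real]
  have i0 : Integrable (({0} : Set ℝ).indicator (fun _ => (1 : ℂ))) G :=
    (integrable_const _).indicator (measurableSet_singleton 0)
  rw [e0, Ker.I, ← integral_sub hg.integrable i0]
  have i1 : Integrable (fun t : ℝ => 1 / 2 * (‖h‖ * kPsi.wr h t) +
      1 / 2 * (1 / ‖h‖ * ((1 + t ^ 2) / t ^ 2))) G :=
    ((hg.integrable_wr.const_mul _).const_mul _).add ((hi.const_mul _).const_mul _)
  have b1 : ‖∫ t, ((kPsi.k t : ℂ) / kPsi.den h t - ({0} : Set ℝ).indicator (fun _ => (1 : ℂ)) t) ∂G‖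
      ≤ ∫ t : ℝ, (1 / 2 * (‖h‖ * kPsi.wr h t) + 1 / 2 * (1 / ‖h‖ * ((1 + t ^ 2) / t ^ 2))) ∂G := by
    refine norm_integral_le_of_norm_le i1 ?_
    filter_upwards [hg.den_ne] with t hd
    by_cases ht : t = 0
    · subst ht
      simp [kPsi, Ker.den, Ker.wr]
    · have hm : t ∉ ({0} : Set ℝ) := by simpa using ht
      rw [indicator_of_notMem hm, sub_zero, Ker.wr]
      have e3 : |kPsi.k t * kPsi.β t| = (1 + t ^ 2) * t ^ 2 := by
        simp only [kPsi]; rw [mul_neg, abs_neg, abs_of_nonneg (by positivity)]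
      have e4 : ‖((kPsi.k t : ℝ) : ℂ)‖ = 1 + t ^ 2 := by
        rw [Complex.norm_real, Real.norm_eq_abs]; simp only [kPsi]
        rw [abs_of_nonneg (by positivity)]
      rw [norm_div, e3, e4]
      have hdp := norm_pos_iff.mpr hd
      set d := ‖kPsi.den h t‖
      have ht2 : 0 < t ^ 2 := by positivity
      have key : 1 / d ≤ 1 / 2 * (‖h‖ * (t ^ 2 / d ^ 2)) + 1 / 2 * (1 / ‖h‖ * (1 / t ^ 2)) := by
        have : 1 / 2 * (‖h‖ * (t ^ 2 / d ^ 2)) + 1 / 2 * (1 / ‖h‖ * (1 / t ^ 2)) - 1 / d =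
            (‖h‖ * t ^ 2 - d) ^ 2 / (2 * ‖h‖ * t ^ 2 * d ^ 2) := by
          field_simp; ring
        have h2 : 0 ≤ (‖h‖ * t ^ 2 - d) ^ 2 / (2 * ‖h‖ * t ^ 2 * d ^ 2) := by positivity
        linarith
      calc (1 + t ^ 2) / d = (1 + t ^ 2) * (1 / d) := by ring
        _ ≤ (1 + t ^ 2) * _ := mul_le_mul_of_nonneg_left key (by positivity)
        _ = _ := by ring
  refine b1.trans ?_
  rw [integral_add ((hg.integrable_wr.const_mul _).const_mul _) ((hi.const_mul _).const_mul _)]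
  simp only [integral_const_mul]
  have h1 : ‖h‖ * (∫ t, kPsi.wr h t ∂G) ≤ 1 / ‖h‖ := by
    rw [le_div_iff₀ hh]; linarith
  have h2 : 1 / ‖h‖ * (∫ t : ℝ, (1 + t ^ 2) / t ^ 2 ∂G) ≤ 1 / ‖h‖ :=
    mul_le_of_le_one_right (by positivity) hj
  linarith

lemma Rr_ge {G : Measure ℝ} [IsFiniteMeasure G] {h : ℂ} (hoff : Off h) :
    G.real {0} ≤ Rr G h := by
  have e0 : G.real {0} = ∫ t, ({0} : Set ℝ).indicator (fun _ => (1 : ℝ)) t ∂G := by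
    rw [integral_indicator (measurableSet_singleton 0)]
    simp [Measure.real]
  rw [e0, Rr]
  refine integral_mono ((integrable_const _).indicator (measurableSet_singleton 0))
    (Rr_integrable (hoff.goodPsi G)) fun t => ?_
  by_cases ht : t = 0
  · subst ht; simp [kPsi, Ker.den]
  · have hm : t ∉ ({0} : Set ℝ) := by simpa using ht
    simp only
    rw [indicator_of_notMem hm]; positivity

lemma W_ge {G : Measure ℝ} [IsFiniteMeasure G] {h : ℂ} (hoff : Off h) (h1 : 1 ≤ ‖h‖) :
    ∫ t : ℝ, t ^ 2 / (1 + t ^ 2) ∂G ≤ (∫ t, kPsi.wr h t ∂G) * ‖h‖ ^ 2 := by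
  have hg := hoff.goodPsi G
  rw [← integral_mul_const]
  refine integral_mono_of_nonneg (ae_of_all _ fun t => by positivity)
    (hg.integrable_wr.mul_const _) ?_
  filter_upwards [hg.den_ne] with t hd
  have hdp := norm_pos_iff.mpr hd
  have e3 : |kPsi.k t * kPsi.β t| = (1 + t ^ 2) * t ^ 2 := by
    simp only [kPsi]; rw [mul_neg, abs_neg, abs_of_nonneg (by positivity)]
  rw [Ker.wr, e3, div_mul_eq_mul_div, div_le_div_iff₀ (by positivity) (by positivity)]
  have h3 : ‖kPsi.den h t‖ ≤ ‖h‖ * (1 + t ^ 2) := by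
    have e : kPsi.den h t = 1 - h * (t : ℂ) ^ 2 := by
      simp only [Ker.den, kPsi]; push_cast; ring
    rw [e]
    refine (norm_sub_le _ _).trans ?_
    rw [norm_one, norm_mul, norm_pow, Complex.norm_real, Real.norm_eq_abs, sq_abs]
    nlinarith
  calc t ^ 2 * ‖kPsi.den h t‖ ^ 2 ≤ t ^ 2 * (‖h‖ * (1 + t ^ 2)) ^ 2 := by gcongr
    _ = _ := by ring

lemma c_pos {G : Measure ℝ} [IsFiniteMeasure G] (hG : G ≠ 0) (h0 : G {0} = 0) :
    0 < ∫ t : ℝ, t ^ 2 / (1 + t ^ 2) ∂G := by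
  have hi : Integrable (fun t : ℝ => t ^ 2 / (1 + t ^ 2)) G := by
    have hm : Measurable (fun t : ℝ => t ^ 2 / (1 + t ^ 2)) := by fun_prop
    refine Integrable.of_bound hm.aestronglyMeasurable 1 (ae_of_all _ fun t => ?_)
    rw [Real.norm_eq_abs, abs_of_nonneg (by positivity), div_le_one (by positivity)]
    linarith
  rw [integral_pos_iff_support_of_nonneg (fun t => by positivity) hi]
  have e : Function.support (fun t : ℝ => t ^ 2 / (1 + t ^ 2)) = {0}ᶜ := by
    ext t
    have : (1 + t ^ 2) ≠ 0 := by positivity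
    simp [this]
  rw [e, pos_iff_ne_zero]
  intro hc
  apply hG
  rw [← Measure.measure_univ_eq_zero, ← union_compl_self ({0} : Set ℝ)]
  exact measure_union_null h0 hc

lemma atom_of_infty {ι : Type*} {L : Filter ι} [L.NeBot] {ν : Measure ℝ} [IsProbabilityMeasure ν]
    {q : ι → ℂ} {y K : ℝ} (hK : 0 < K) (hq : Tendsto q L (𝓝 (y : ℂ)))
    (hoff : ∀ᶠ n in L, Off (q n))
    (hP : ∀ᶠ n in L, ∫ t, kN.wr (q n) t ∂ν ≤ K * ‖kN.I ν (q n)‖ ^ 2)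
    (hN : Tendsto (fun n => ‖kN.I ν (q n)‖) L atTop) : ν {t | t ^ 2 = y} ≠ 0 := by
  intro h0
  set E : ℝ → Set ℝ := fun δ => {t | |t ^ 2 - y| ≤ δ} with hE
  have hEm : ∀ δ, MeasurableSet (E δ) := fun δ =>
    measurableSet_le (by fun_prop) measurable_const
  obtain ⟨δ, hδ, hEδ⟩ : ∃ δ > 0, ν.real (E δ) < 1 / (4 * K) := by
    have h1 : Tendsto (fun δ => ν (E δ)) (𝓝[>] 0) (𝓝 (ν (⋂ r > 0, E r))) := by
      refine tendsto_measure_biInter_gt (fun r _ => (hEm r).nullMeasurableSet) ?_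
        ⟨1, one_pos, measure_ne_top _ _⟩
      intro i j _ hij t ht
      exact le_trans ht hij
    have h2 : (⋂ r > 0, E r) = {t | t ^ 2 = y} := by
      ext t
      simp only [mem_iInter, hE, mem_ofPred_eq]
      constructor
      · intro h
        have : |t ^ 2 - y| ≤ 0 := le_of_forall_gt_imp_ge_of_dense fun r hr => h r hr
        have := abs_nonpos_iff.mp this
        linarith
      · intro h r hr
        rw [h, sub_self, abs_zero]; exact le_of_lt hr
    rw [h2, h0] at h1
    have h3 := (ENNReal.tendsto_toReal ENNReal.zero_ne_top).comp h1
    have h5 : (0 : ENNReal).toReal < 1 / (4 * K) := by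
      rw [ENNReal.toReal_zero]; positivity
    have h4 := h3.eventually (gt_mem_nhds h5)
    obtain ⟨δ, hd1, hd2⟩ := (h4.and self_mem_nhdsWithin).exists
    exact ⟨δ, hd2, hd1⟩
  have e1 : ∀ᶠ n in L, ‖q n - y‖ < δ / 2 := by
    have := hq.eventually (Metric.ball_mem_nhds (y : ℂ) (half_pos hδ))
    filter_upwards [this] with n hn
    rw [← dist_eq_norm]; exact hn
  obtain ⟨n, hoff, hP, e1, hbig⟩ :=
    (hoff.and (hP.and (e1.and (hN.eventually_gt_atTop (8 * (2 / δ)))))).exists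
  have hg := hoff.goodN ν
  set N := ‖kN.I ν (q n)‖ with hNdef
  have hNp : 0 < N := lt_trans (by positivity) hbig
  set a := 1 / (K * N) with ha
  have hap : 0 < a := by positivity
  have iE : Integrable ((E δ).indicator (fun _ => (1 : ℝ))) ν :=
    (integrable_const _).indicator (hEm δ)
  have i1 : Integrable (fun t : ℝ => 1 / 2 * (a * kN.wr (q n) t) +
      1 / 2 * (1 / a * (E δ).indicator (fun _ => (1 : ℝ)) t)) ν :=
    ((hg.integrable_wr.const_mul _).const_mul _).add ((iE.const_mul _).const_mul _)
  have b1 : N ≤ ∫ t : ℝ, (1 / 2 * (a * kN.wr (q n) t) +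
      1 / 2 * (1 / a * (E δ).indicator (fun _ => (1 : ℝ)) t) + 2 / δ) ∂ν := by
    rw [hNdef, Ker.I]
    refine norm_integral_le_of_norm_le (i1.add (integrable_const _)) ?_
    filter_upwards [hg.den_ne] with t hd
    have hdp := norm_pos_iff.mpr hd
    have hk : ‖((kN.k t : ℝ) : ℂ)‖ = 1 := by simp [kN]
    have hw : kN.wr (q n) t = 1 / ‖kN.den (q n) t‖ ^ 2 := by simp [kN, Ker.wr]
    rw [norm_div, hk, hw]
    by_cases ht : t ∈ E δ
    · rw [indicator_of_mem ht]
      set d := ‖kN.den (q n) t‖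
      have : 1 / 2 * (a * (1 / d ^ 2)) + 1 / 2 * (1 / a * 1) - 1 / d =
          (a - d) ^ 2 / (2 * a * d ^ 2) := by
        field_simp; ring
      have h2 : 0 ≤ (a - d) ^ 2 / (2 * a * d ^ 2) := by positivity
      have : 0 < 2 / δ := by positivity
      linarith
    · rw [indicator_of_notMem ht]
      have hd2 : δ / 2 ≤ ‖kN.den (q n) t‖ := by
        have e : ((t ^ 2 - y : ℝ) : ℂ) = (q n - y) - kN.den (q n) t := by
          simp only [Ker.den, kN]; push_cast; ring
        have h3 : δ < ‖((t ^ 2 - y : ℝ) : ℂ)‖ := by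
          rw [Complex.norm_real, Real.norm_eq_abs]; exact not_le.mp ht
        rw [e] at h3
        have := norm_sub_le (q n - y) (kN.den (q n) t)
        linarith
      have h4 : 1 / ‖kN.den (q n) t‖ ≤ 2 / δ := by
        rw [div_le_div_iff₀ hdp hδ]; linarith
      have h5 : 0 ≤ 1 / 2 * (a * (1 / ‖kN.den (q n) t‖ ^ 2)) := by positivity
      linarith
  rw [integral_add i1 (integrable_const _), integral_add
    ((hg.integrable_wr.const_mul _).const_mul _) ((iE.const_mul _).const_mul _)] at b1
  simp only [integral_const_mul] at b1
  rw [integral_indicator (hEm δ)] at b1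
  simp only [integral_const, smul_eq_mul, mul_one, measureReal_restrict_apply_univ,
    probReal_univ, one_mul] at b1
  have h1 : a * (∫ t, kN.wr (q n) t ∂ν) ≤ N := by
    calc a * _ ≤ a * (K * N ^ 2) := by gcongr
      _ = N := by rw [ha]; field_simp
  have h2 : 1 / a * ν.real (E δ) ≤ N / 4 := by
    calc 1 / a * _ ≤ 1 / a * (1 / (4 * K)) := by gcongr
      _ = N / 4 := by rw [ha]; field_simp
  linarith

theorem infty_atom {l : ℝ} (hl : l ∈ Ioo (0 : ℝ) 1) {G ν : Measure ℝ} [IsFiniteMeasure G]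
    [IsProbabilityMeasure ν] (hG : G ≠ 0) {A : ℂ → ℂ} (hS : Sol l G ν A)
    {x : ℝ} (hx : x ≠ 0) (hinf : Tendsto (fun u => ‖A u‖) (𝓝[UHP] (x : ℂ)) atTop) :
    ν {t | t ^ 2 = x ^ 2} ≠ 0 := by
  have hxc : (x : ℂ) ≠ 0 := by exact_mod_cast hx
  have l0 := hl.1
  have l1 : 0 < 1 - l := by linarith [hl.2]
  set L := 𝓝[UHP] (x : ℂ) with hL
  have : L.NeBot := neBot_UHP x
  have tu : Tendsto (fun u : ℂ => u) L (𝓝 (x : ℂ)) := tendsto_id.mono_left nhdsWithin_le_nhds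
  have eU : ∀ᶠ u in L, u ∈ UHP := self_mem_nhdsWithin
  have mb : ∀ᶠ u in L, _ := eU.mono fun u hu =>
    main_bounds hl (G := G) (ν := ν) hu (hS.im_neg u hu) (hS.zero u hu)
  have tlu : Tendsto (fun u : ℂ => ‖(1 - (l : ℂ)) / u‖) L (𝓝 ‖(1 - (l : ℂ)) / x‖) :=
    (tendsto_const_nhds.div tu hxc).norm
  have elu : ∀ᶠ u in L, ‖(1 - (l : ℂ)) / u‖ < ‖(1 - (l : ℂ)) / x‖ + 1 :=
    tlu.eventually (gt_mem_nhds (by linarith))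
  set D := ‖(1 - (l : ℂ)) / x‖ + 1 with hD
  have hlA : ∀ u, ‖(l : ℂ) * A u‖ = l * ‖A u‖ := by
    intro u
    rw [norm_mul, Complex.norm_real, Real.norm_eq_abs, abs_of_pos l0]
  have eB1 : ∀ᶠ u in L, l * ‖A u‖ - D ≤ ‖Bf l u (A u)‖ := by
    filter_upwards [elu] with u hu
    have := norm_sub_le_norm_add ((l : ℂ) * A u) ((1 - (l : ℂ)) / u)
    rw [hlA] at this
    unfold Bf
    linarith
  have eB2 : ∀ᶠ u in L, ‖Bf l u (A u)‖ ≤ l * ‖A u‖ + D := by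
    filter_upwards [elu] with u hu
    have := norm_add_le ((l : ℂ) * A u) ((1 - (l : ℂ)) / u)
    rw [hlA] at this
    unfold Bf
    linarith
  have tB : Tendsto (fun u => ‖Bf l u (A u)‖) L atTop := by
    refine tendsto_atTop_mono' L eB1 ?_
    exact tendsto_atTop_add_const_right _ _ (hinf.const_mul_atTop l0)
  have th : Tendsto (fun u => ‖hf l u (A u)‖) L atTop := by
    have := hinf.atTop_mul_atTop₀ tB
    refine this.congr fun u => ?_
    rw [hf, norm_mul]
  obtain ⟨hi, hj⟩ := levy_bound th (mb.mono fun u hu => hu.1) (mb.mono fun u hu => hu.2.2.1)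
  have epsi : ∀ᶠ u in L, ‖kPsi.I G (hf l u (A u)) - (G.real {0} : ℂ)‖ ≤ 1 / ‖hf l u (A u)‖ :=
    mb.mono fun u hu => psi_infty hi hj hu.1 hu.2.2.1
  by_cases hg0 : G {0} = 0
  · -- no gaussian part
    have hr0 : G.real {0} = 0 := by simp [Measure.real, hg0]
    simp only [hr0, Complex.ofReal_zero, sub_zero] at epsi
    have tpB : Tendsto (fun u => kPsi.I G (hf l u (A u)) * Bf l u (A u)) L (𝓝 0) := by
      rw [tendsto_zero_iff_norm_tendsto_zero]
      refine squeeze_zero' (Eventually.of_forall fun u => norm_nonneg _) ?_ hinf.inv_tendsto_atTop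
      filter_upwards [epsi, hinf.eventually_gt_atTop 0, tB.eventually_gt_atTop 0] with u h1 h2 h3
      rw [norm_mul]
      calc _ ≤ 1 / ‖hf l u (A u)‖ * ‖Bf l u (A u)‖ := by gcongr
        _ = _ := by rw [hf, norm_mul]; simp only [Pi.inv_apply]; field_simp
    have tpA : Tendsto (fun u => kPsi.I G (hf l u (A u)) * A u) L (𝓝 0) := by
      rw [tendsto_zero_iff_norm_tendsto_zero]
      refine squeeze_zero' (Eventually.of_forall fun u => norm_nonneg _) ?_ tB.inv_tendsto_atTop
      filter_upwards [epsi, hinf.eventually_gt_atTop 0, tB.eventually_gt_atTop 0] with u h1 h2 h3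
      rw [norm_mul]
      calc _ ≤ 1 / ‖hf l u (A u)‖ * ‖A u‖ := by gcongr
        _ = _ := by rw [hf, norm_mul]; simp only [Pi.inv_apply]; field_simp
    have ts1 : Tendsto (fun u => s1f l G u (A u)) L (𝓝 (x : ℂ)) := by
      simpa [s1f] using tu.sub tpB
    have ts2 : Tendsto (fun u => s2f l G u (A u)) L (𝓝 (x : ℂ)) := by
      simpa [s2f] using tu.sub (tpA.const_mul (l : ℂ))
    have tq : Tendsto (fun u => qf l G u (A u)) L (𝓝 ((x ^ 2 : ℝ) : ℂ)) := by
      have := ts1.mul ts2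
      rw [← pow_two] at this
      push_cast
      exact this
    have hnx : 0 < ‖(x : ℂ)‖ := norm_pos_iff.mpr hxc
    have es1 : ∀ᶠ u in L, ‖(x : ℂ)‖ / 2 < ‖s1f l G u (A u)‖ :=
      ts1.norm.eventually (lt_mem_nhds (by linarith))
    have es2 : ∀ᶠ u in L, ‖s2f l G u (A u)‖ < 2 * ‖(x : ℂ)‖ :=
      ts2.norm.eventually (gt_mem_nhds (by linarith))
    have hA : ∀ᶠ u in L, ‖A u‖ = ‖s2f l G u (A u)‖ * ‖kN.I ν (qf l G u (A u))‖ := by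
      filter_upwards [eU] with u hu
      have := hS.zero u hu
      unfold Ff at this
      rw [← norm_mul, ← sub_eq_zero.mp this]
    have hc := c_pos hG hg0
    set c := ∫ t : ℝ, t ^ 2 / (1 + t ^ 2) ∂G with hcdef
    refine atom_of_infty (K := 16 / (l ^ 2 * c)) (by positivity) tq
      (mb.mono fun u hu => hu.2.1) ?_ ?_
    · filter_upwards [mb, es1, es2, hA, eB2, th.eventually_ge_atTop 1,
        hinf.eventually_gt_atTop (D / (1 - l)), hinf.eventually_gt_atTop 0]
        with u hu h1 h2 h3 h4 h5 h6 h7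
      have hW := W_ge (G := G) hu.1 h5
      rw [← hcdef] at hW
      have hm := hu.2.2.2.2.2.1
      have hP0 := wr_int_nonneg kN ν (qf l G u (A u))
      have hBA : ‖Bf l u (A u)‖ ≤ ‖A u‖ := by
        rw [div_lt_iff₀ l1] at h6
        linarith
      set P := ∫ t, kN.wr (qf l G u (A u)) t ∂ν
      set W := ∫ t, kPsi.wr (hf l u (A u)) t ∂G
      set n1 := ‖s1f l G u (A u)‖
      set n2 := ‖s2f l G u (A u)‖
      set N := ‖kN.I ν (qf l G u (A u))‖
      have hhn : ‖hf l u (A u)‖ = ‖A u‖ * ‖Bf l u (A u)‖ := by rw [hf, norm_mul]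
      have k1 : l ^ 2 * c * P * n1 ^ 2 ≤ ‖Bf l u (A u)‖ ^ 2 := by
        have q1 : l ^ 2 * c * P * n1 ^ 2 * ‖A u‖ ^ 2 ≤ ‖Bf l u (A u)‖ ^ 2 * ‖A u‖ ^ 2 := by
          calc l ^ 2 * c * P * n1 ^ 2 * ‖A u‖ ^ 2
              ≤ l ^ 2 * (W * ‖hf l u (A u)‖ ^ 2) * P * n1 ^ 2 * ‖A u‖ ^ 2 := by gcongr
            _ = (l ^ 2 * W * P * ‖A u‖ ^ 2 * n1 ^ 2) * ‖hf l u (A u)‖ ^ 2 := by ring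
            _ ≤ 1 * ‖hf l u (A u)‖ ^ 2 := by gcongr
            _ = _ := by rw [hhn]; ring
        exact le_of_mul_le_mul_right q1 (by positivity)
      have k2 : ‖Bf l u (A u)‖ ^ 2 ≤ (2 * ‖(x : ℂ)‖ * N) ^ 2 := by
        have hN0 : 0 ≤ N := norm_nonneg _
        gcongr
        refine hBA.trans ?_
        rw [h3]
        gcongr
      have k3 : l ^ 2 * c * P * (‖(x : ℂ)‖ / 2) ^ 2 ≤ (2 * ‖(x : ℂ)‖ * N) ^ 2 :=
        le_trans (by gcongr) (k1.trans k2)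
      have k4 : (l ^ 2 * c * P) * ‖(x : ℂ)‖ ^ 2 ≤ (16 * N ^ 2) * ‖(x : ℂ)‖ ^ 2 := by
        nlinarith
      have k5 := le_of_mul_le_mul_right k4 (by positivity)
      rw [div_mul_eq_mul_div, le_div_iff₀ (by positivity)]
      linarith
    · have : Tendsto (fun u => (2 * ‖(x : ℂ)‖)⁻¹ * ‖A u‖) L atTop :=
        hinf.const_mul_atTop (by positivity)
      refine tendsto_atTop_mono' L ?_ this
      filter_upwards [hA, es2] with u h1 h2
      rw [inv_mul_le_iff₀ (by positivity), h1]
      gcongr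
  · exfalso
    have hg : 0 < G.real {0} := by
      rw [Measure.real]; exact ENNReal.toReal_pos hg0 (measure_ne_top _ _)
    set g := G.real {0} with hgdef
    have enu : ∀ᶠ u in L, ‖u‖ < ‖(x : ℂ)‖ + 1 := tu.norm.eventually (gt_mem_nhds (by linarith))
    set X := ‖(x : ℂ)‖ + 1 with hX
    have hXp : 0 < X := by positivity
    have hbig : ∀ᶠ u in L, X + (g + 1) * ‖A u‖ < ‖A u‖ ^ 2 * (l * g) := by
      have t2 : Tendsto (fun u => ‖A u‖ * (l * g * ‖A u‖ - (g + 1))) L atTop := by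
        refine hinf.atTop_mul_atTop₀ ?_
        exact tendsto_atTop_add_const_right _ _ (hinf.const_mul_atTop (by positivity))
      filter_upwards [t2.eventually_gt_atTop X] with u hu
      nlinarith
    obtain ⟨u, hu, hp, hnu, hbig, hB, hh⟩ := (mb.and (epsi.and (enu.and (hbig.and
      ((tB.eventually_gt_atTop (2 * (X + 1) / g)).and
        (th.eventually_gt_atTop (max 1 (2 / g)))))))).exists
    have hh1 : 1 < ‖hf l u (A u)‖ := (le_max_left _ _).trans_lt hh
    have hh2 : 2 / g < ‖hf l u (A u)‖ := (le_max_right _ _).trans_lt hh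
    have hm := hu.2.2.2.2.1
    have hlast := hu.2.2.2.2.2.2
    have hR := Rr_ge (G := G) hu.1
    rw [← hgdef] at hR
    have hP0 := wr_int_nonneg kN ν (qf l G u (A u))
    have d1 : 1 / ‖hf l u (A u)‖ ≤ 1 := by
      rw [div_le_one (by linarith)]; exact hh1.le
    have d2 : 1 / ‖hf l u (A u)‖ ≤ g / 2 := by
      rw [div_lt_iff₀ hg] at hh2
      rw [div_le_div_iff₀ (by linarith) two_pos]; linarith
    have hgn : ‖(g : ℂ)‖ = g := by rw [Complex.norm_real, Real.norm_eq_abs, abs_of_pos hg]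
    set ψ := kPsi.I G (hf l u (A u)) with hψ
    have p1 : ‖ψ‖ ≤ g + 1 := by
      have := norm_sub_norm_le ψ (g : ℂ)
      rw [hgn] at this; linarith
    have p2 : g / 2 ≤ ‖ψ‖ := by
      have := norm_sub_norm_le (g : ℂ) ψ
      rw [hgn, norm_sub_rev] at this; linarith
    have n1 : 1 ≤ ‖s1f l G u (A u)‖ := by
      have h1 := norm_sub_norm_le (ψ * Bf l u (A u)) u
      rw [norm_sub_rev, norm_mul] at h1
      have e : s1f l G u (A u) = u - ψ * Bf l u (A u) := rfl
      rw [e]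
      have h2 : X + 1 ≤ ‖ψ‖ * ‖Bf l u (A u)‖ := by
        calc X + 1 = g / 2 * (2 * (X + 1) / g) := by field_simp
          _ ≤ _ := by gcongr
      linarith
    have n2 : ‖s2f l G u (A u)‖ ≤ X + (g + 1) * ‖A u‖ := by
      have h1 := norm_sub_le u ((l : ℂ) * (ψ * A u))
      have e : s2f l G u (A u) = u - l * (ψ * A u) := rfl
      rw [e]
      rw [norm_mul, norm_mul, Complex.norm_real, Real.norm_eq_abs, abs_of_pos l0] at h1
      have h2 : l * (‖ψ‖ * ‖A u‖) ≤ 1 * ((g + 1) * ‖A u‖) := by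
        gcongr
        exact hl.2.le
      linarith
    have hqn : ‖qf l G u (A u)‖ = ‖s1f l G u (A u)‖ * ‖s2f l G u (A u)‖ := by rw [qf, norm_mul]
    set P := ∫ t, kN.wr (qf l G u (A u)) t ∂ν
    set m1 := ‖s1f l G u (A u)‖
    set m2 := ‖s2f l G u (A u)‖
    have hm20 : 0 ≤ m2 := norm_nonneg _
    have k1 : l * g * P * m2 ≤ 1 := by
      calc l * g * P * m2 ≤ l * Rr G (hf l u (A u)) * P * (m1 * m2) := by
            have hR0 := Rr_nonneg G (hf l u (A u))
            gcongr
            nlinarith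
        _ ≤ 1 := by rw [← hqn]; exact hm
    have k2 : ‖A u‖ ^ 2 * (l * g) ≤ m2 := by
      calc ‖A u‖ ^ 2 * (l * g) ≤ m2 ^ 2 * P * (l * g) := by gcongr
        _ = m2 * (l * g * P * m2) := by ring
        _ ≤ m2 * 1 := by gcongr
        _ = m2 := mul_one _
    linarith

/-! ### Part 8: Stieltjes inversion -/

lemma countable_atoms (ν : Measure ℝ) [IsProbabilityMeasure ν] :
    {x : ℝ | ν {t | t ^ 2 = x ^ 2} ≠ 0}.Countable := by
  have h1 : {x : ℝ | 0 < ν {x}}.Countable :=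
    Measure.countable_meas_pos_of_disjoint_iUnion (μ := ν) (As := fun x : ℝ => {x})
      (fun x => measurableSet_singleton x) (fun x y hxy => by simpa [Function.onFun] using hxy)
  have h2 : ((fun x : ℝ => -x) ⁻¹' {x : ℝ | 0 < ν {x}}).Countable := h1.preimage neg_injective
  refine (h1.union h2).mono fun x hx => ?_
  by_contra hcon
  simp only [mem_union, mem_preimage, mem_ofPred_eq, not_or, not_lt, nonpos_iff_eq_zero] at hcon
  apply hx
  have : {t : ℝ | t ^ 2 = x ^ 2} ⊆ {x} ∪ {-x} := by
    intro t ht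
    exact sq_eq_sq_iff_eq_or_eq_neg.mp ht
  exact measure_mono_null this (measure_union_null hcon.1 hcon.2)

/-- regular points -/
def regU (A : ℂ → ℂ) : Set ℝ := {x | x ≠ 0 ∧ ∃ a, Tendsto A (𝓝[UHP] (x : ℂ)) (𝓝 a)}

lemma regU_open {l : ℝ} (hl : l ∈ Ioo (0 : ℝ) 1) {G ν : Measure ℝ} [IsFiniteMeasure G]
    [IsProbabilityMeasure ν] (hG : G ≠ 0) {A : ℂ → ℂ} (hS : Sol l G ν A) :
    IsOpen (regU A) := by
  rw [Metric.isOpen_iff]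
  rintro x ⟨hx, a, ha⟩
  have h1 : ∀ᶠ u in 𝓝[UHP] (x : ℂ), ‖A u‖ < ‖a‖ + 1 :=
    ha.norm.eventually (gt_mem_nhds (by linarith))
  rw [eventually_nhdsWithin_iff] at h1
  have h2 : ∀ᶠ u in 𝓝 (x : ℂ), ∀ᶠ v in 𝓝 u, v ∈ UHP → ‖A v‖ < ‖a‖ + 1 :=
    eventually_eventually_nhds.mpr h1
  have h3 : ∀ᶠ y : ℝ in 𝓝 x, ∀ᶠ v in 𝓝 (y : ℂ), v ∈ UHP → ‖A v‖ < ‖a‖ + 1 :=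
    Complex.continuous_ofReal.continuousAt.eventually h2
  have h4 : ∀ᶠ y : ℝ in 𝓝 x, y ≠ 0 := eventually_ne_nhds hx
  have h5 : ∀ᶠ y : ℝ in 𝓝 x, y ∈ regU A := by
    filter_upwards [h3, h4] with y h3 h4
    refine ⟨h4, ?_⟩
    rcases dichotomy hl hG hS h4 with h | h
    · exact h
    · exfalso
      have := neBot_UHP y
      rw [← eventually_nhdsWithin_iff] at h3
      obtain ⟨v, hv1, hv2⟩ := (h3.and (h.eventually_gt_atTop (‖a‖ + 1))).exists
      linarith
  exact Metric.mem_nhds_iff.mp h5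

lemma regU_null {l : ℝ} (hl : l ∈ Ioo (0 : ℝ) 1) {G ν : Measure ℝ} [IsFiniteMeasure G]
    [IsProbabilityMeasure ν] (hG : G ≠ 0) {A : ℂ → ℂ} (hS : Sol l G ν A) :
    volume (regU A)ᶜ = 0 := by
  refine Set.Countable.measure_zero ?_ _
  refine ((countable_singleton (0 : ℝ)).union (countable_atoms ν)).mono fun x hx => ?_
  by_cases h0 : x = 0
  · exact Or.inl h0
  · right
    rcases dichotomy hl hG hS h0 with h | h
    · exact absurd ⟨h0, h⟩ hx
    · exact infty_atom hl hG hS h0 h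

/-- the density -/
def dens (A : ℂ → ℂ) (x : ℝ) : ℝ := -(1 / Real.pi) * (extendFrom UHP A (x : ℂ)).im

lemma ext_cont {A : ℂ → ℂ} (hc : ContinuousOn A UHP) :
    ContinuousOn (extendFrom UHP A) (UHP ∪ (fun x : ℝ => (x : ℂ)) '' regU A) := by
  refine continuousOn_extendFrom ?_ ?_
  · rintro z (hz | ⟨x, hx, rfl⟩)
    · exact subset_closure hz
    · exact mem_closure_iff_nhdsWithin_neBot.mpr (neBot_UHP x)
  · rintro z (hz | ⟨x, hx, rfl⟩)
    · exact ⟨A z, hc z hz⟩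
    · exact hx.2

lemma ext_eq {A : ℂ → ℂ} (hc : ContinuousOn A UHP) {z : ℂ} (hz : z ∈ UHP) :
    extendFrom UHP A z = A z := extendFrom_eq (subset_closure hz) (hc z hz)

lemma dens_cont {A : ℂ → ℂ} (hc : ContinuousOn A UHP) : ContinuousOn (dens A) (regU A) := by
  have h1 : ContinuousOn (fun x : ℝ => extendFrom UHP A (x : ℂ)) (regU A) :=
    (ext_cont hc).comp Complex.continuous_ofReal.continuousOn
      (fun x hx => Or.inr (mem_image_of_mem _ hx))
  exact continuousOn_const.mul (Complex.continuous_im.comp_continuousOn h1)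

lemma dens_nonneg {A : ℂ → ℂ} (hn : ∀ u ∈ UHP, (A u).im < 0) {x : ℝ} (hx : x ∈ regU A) :
    0 ≤ dens A x := by
  obtain ⟨a, ha⟩ := hx.2
  have := neBot_UHP x
  have h1 : extendFrom UHP A (x : ℂ) = a :=
    extendFrom_eq (mem_closure_iff_nhdsWithin_neBot.mpr this) ha
  have h2 : a.im ≤ 0 := by
    refine le_of_tendsto ((Complex.continuous_im.tendsto a).comp ha) ?_
    filter_upwards [self_mem_nhdsWithin] with u hu
    exact (hn u hu).le
  unfold dens
  rw [h1]
  have := Real.pi_pos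
  have : 0 ≤ 1 / Real.pi := by positivity
  nlinarith

/-- Poisson kernel -/
def pois (y s : ℝ) : ℝ := 1 / Real.pi * (y / (s ^ 2 + y ^ 2))

lemma pois_cont {y : ℝ} (hy : 0 < y) : Continuous (pois y) := by
  unfold pois
  refine continuous_const.mul (continuous_const.div (by fun_prop) fun s => by positivity)

lemma pois_nonneg {y : ℝ} (hy : 0 < y) (s : ℝ) : 0 ≤ pois y s := by
  have := Real.pi_pos
  unfold pois; positivity

lemma pois_le {y : ℝ} (hy : 0 < y) (s : ℝ) : pois y s ≤ 1 / Real.pi * (1 / y) := by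
  have := Real.pi_pos
  unfold pois
  gcongr ?_ * ?_
  rw [div_le_div_iff₀ (by positivity) hy]
  nlinarith [sq_nonneg s]

lemma im_inv_sub {x y t : ℝ} :
    (1 / (((x : ℂ) + y * Complex.I) - t)).im = -(y / ((x - t) ^ 2 + y ^ 2)) := by
  rw [one_div, Complex.inv_im]
  simp [Complex.normSq_apply]
  ring

lemma Ar_pois {ρ : Measure ℝ} [IsProbabilityMeasure ρ]
    (hsym : Measure.map (fun t : ℝ => -t) ρ = ρ) (x : ℝ) {y : ℝ} (hy : 0 < y) :
    -(1 / Real.pi) * (Ar ρ ((x : ℂ) + y * Complex.I)).im = ∫ t, pois y (x - t) ∂ρ := by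
  set u : ℂ := (x : ℂ) + y * Complex.I with hu
  have him : u.im = y := by simp [hu]
  have hup : 0 < u.im := by rw [him]; exact hy
  have hg := (off_sq hup).goodN ρ
  have hi : ∀ s : ℝ → ℝ, Measurable s → Integrable (fun t => pois y (s t)) ρ := by
    intro s hs
    refine Integrable.of_bound ((pois_cont hy).measurable.comp hs).aestronglyMeasurable
      (1 / Real.pi * (1 / y)) (ae_of_all _ fun t => ?_)
    rw [Real.norm_eq_abs, abs_of_nonneg (pois_nonneg hy _)]
    exact pois_le hy _
  have e1 : (Ar ρ u).im = ∫ t, (u * ((kN.k t : ℂ) / kN.den (u ^ 2) t)).im ∂ρ := by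
    unfold Ar Ker.I
    rw [← integral_const_mul, im_integral' (hg.integrable.const_mul _)]
  have e2 : ∫ t, pois y (x + t) ∂ρ = ∫ t, pois y (x - t) ∂ρ := by
    conv_lhs => rw [← hsym]
    have hcx : Continuous fun t => pois y (x + t) := (pois_cont hy).comp (by fun_prop)
    rw [integral_map (by fun_prop) hcx.aestronglyMeasurable]
    simp [sub_eq_add_neg]
  have e3 : ∫ t, pois y (x - t) ∂ρ = ∫ t, (1 / 2 * pois y (x - t) + 1 / 2 * pois y (x + t)) ∂ρ := by
    rw [integral_add ((hi _ (by fun_prop)).const_mul _) ((hi _ (by fun_prop)).const_mul _),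
      integral_const_mul, integral_const_mul, e2]
    ring
  rw [e3, e1, ← integral_const_mul]
  refine integral_congr_ae (ae_of_all _ fun t => ?_)
  have hne : ∀ r : ℝ, u - r ≠ 0 := by
    intro r h
    have := congrArg Complex.im h
    simp [him] at this
    linarith
  have h1 := hne t
  have h2 := hne (-t)
  have e4 : u * ((kN.k t : ℂ) / kN.den (u ^ 2) t) =
      ((1 / 2 : ℝ) : ℂ) * (1 / (u - t) + 1 / (u - ((-t : ℝ) : ℂ))) := by
    have e5 : kN.den (u ^ 2) t = (u - t) * (u - ((-t : ℝ) : ℂ)) := by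
      simp only [Ker.den, kN]; push_cast; ring
    rw [e5]
    have : (kN.k t : ℂ) = 1 := by simp [kN]
    rw [this]
    field_simp
    push_cast
    ring
  simp only
  rw [e4, Complex.im_ofReal_mul, Complex.add_im, hu, im_inv_sub, im_inv_sub]
  unfold pois
  rw [sub_neg_eq_add]
  ring

lemma pois_scale {y : ℝ} (hy : 0 < y) (φ : ℝ → ℝ) (t : ℝ) :
    ∫ x, φ x * pois y (x - t) = ∫ s, φ (t + y * s) * (1 / Real.pi * (1 + s ^ 2)⁻¹) := by
  have h1 : ∫ x, φ x * pois y (x - t) = ∫ x, φ (x + t) * pois y x := by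
    rw [← integral_add_right_eq_self (fun x => φ x * pois y (x - t)) t]
    simp
  have h2 := Measure.integral_comp_mul_left (fun x => φ (x + t) * pois y x) y
  rw [h1]
  have h3 : ∫ x, φ (x + t) * pois y x = y * ∫ x, φ (y * x + t) * pois y (y * x) := by
    rw [h2, abs_of_pos (by positivity), smul_eq_mul]
    field_simp
  rw [h3, ← integral_const_mul]
  congr 1
  ext s
  unfold pois
  rw [add_comm (y * s) t]
  have : (y * s) ^ 2 + y ^ 2 ≠ 0 := by positivity
  have : 1 + s ^ 2 ≠ 0 := by positivity
  field_simp
  ring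

lemma pois_lim {ρ : Measure ℝ} [IsProbabilityMeasure ρ] {φ : ℝ → ℝ} (hφ : Continuous φ)
    (hc : HasCompactSupport φ) :
    Tendsto (fun y : ℝ => ∫ x, φ x * ∫ t, pois y (x - t) ∂ρ) (𝓝[>] 0) (𝓝 (∫ t, φ t ∂ρ)) := by
  obtain ⟨M, hM⟩ := hφ.bounded_above_of_compact_support hc
  have hM0 : 0 ≤ M := (norm_nonneg _).trans (hM 0)
  have hp : Integrable (fun s : ℝ => 1 / Real.pi * (1 + s ^ 2)⁻¹) :=
    integrable_inv_one_add_sq.const_mul _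
  have hp1 : ∫ s : ℝ, 1 / Real.pi * (1 + s ^ 2)⁻¹ = 1 := by
    rw [integral_const_mul, integral_univ_inv_one_add_sq]
    have := Real.pi_ne_zero
    field_simp
  have hp0 : ∀ s : ℝ, 0 ≤ 1 / Real.pi * (1 + s ^ 2)⁻¹ := fun s => by
    have := Real.pi_pos
    positivity
  have hswap : ∀ y : ℝ, 0 < y → ∫ x, φ x * ∫ t, pois y (x - t) ∂ρ =
      ∫ t, (∫ s, φ (t + y * s) * (1 / Real.pi * (1 + s ^ 2)⁻¹)) ∂ρ := by
    intro y hy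
    have hInt : Integrable (Function.uncurry fun x t => φ x * pois y (x - t))
        ((volume : Measure ℝ).prod ρ) := by
      have h1 : Integrable (fun z : ℝ × ℝ => φ z.1) ((volume : Measure ℝ).prod ρ) :=
        (hφ.integrable_of_hasCompactSupport hc).comp_fst ρ
      have hcont : Continuous fun z : ℝ × ℝ => pois y (z.1 - z.2) :=
        (pois_cont hy).comp (by fun_prop)
      refine h1.mul_bdd (c := 1 / Real.pi * (1 / y)) hcont.aestronglyMeasurable
        (ae_of_all _ fun z => ?_)
      rw [Real.norm_eq_abs, abs_of_nonneg (pois_nonneg hy _)]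
      exact pois_le hy _
    calc ∫ x, φ x * ∫ t, pois y (x - t) ∂ρ = ∫ x, ∫ t, φ x * pois y (x - t) ∂ρ := by
          simp only [integral_const_mul]
      _ = ∫ t, ∫ x, φ x * pois y (x - t) ∂volume ∂ρ := integral_integral_swap hInt
      _ = _ := by simp only [pois_scale hy]
  have hbd : ∀ y t s : ℝ, ‖φ (t + y * s) * (1 / Real.pi * (1 + s ^ 2)⁻¹)‖ ≤
      M * (1 / Real.pi * (1 + s ^ 2)⁻¹) := by
    intro y t s
    rw [norm_mul, Real.norm_of_nonneg (hp0 s)]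
    exact mul_le_mul_of_nonneg_right (hM _) (hp0 s)
  have hpc : Continuous (fun s : ℝ => 1 / Real.pi * (1 + s ^ 2)⁻¹) :=
    continuous_const.mul (Continuous.inv₀ (by fun_prop) fun s => by positivity)
  have h2 : Tendsto (fun y : ℝ => ∫ t, (∫ s, φ (t + y * s) * (1 / Real.pi * (1 + s ^ 2)⁻¹)) ∂ρ)
      (𝓝[>] 0) (𝓝 (∫ t, φ t ∂ρ)) := by
    refine tendsto_integral_filter_of_dominated_convergence (fun _ => M) ?_ ?_
      (integrable_const _) ?_
    · refine Eventually.of_forall fun y => ?_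
      refine Continuous.aestronglyMeasurable ?_
      refine continuous_of_dominated (bound := fun s => M * (1 / Real.pi * (1 + s ^ 2)⁻¹))
        (fun t => ?_) (fun t => ae_of_all _ fun s => hbd y t s) (hp.const_mul _)
        (ae_of_all _ fun s => ?_)
      · exact ((hφ.comp (by fun_prop)).mul hpc).aestronglyMeasurable
      · exact (hφ.comp (by fun_prop)).mul continuous_const
    · refine Eventually.of_forall fun y => ae_of_all _ fun t => ?_
      refine (norm_integral_le_of_norm_le (hp.const_mul M) (ae_of_all _ fun s => hbd y t s)).trans ?_
      rw [integral_const_mul, hp1, mul_one]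
    · refine ae_of_all _ fun t => ?_
      have e : φ t = ∫ s, φ t * (1 / Real.pi * (1 + s ^ 2)⁻¹) := by
        rw [integral_const_mul, hp1, mul_one]
      rw [e]
      refine tendsto_integral_filter_of_dominated_convergence
        (fun s => M * (1 / Real.pi * (1 + s ^ 2)⁻¹)) ?_ ?_ (hp.const_mul _) ?_
      · refine Eventually.of_forall fun y => ?_
        exact ((hφ.comp (by fun_prop)).mul hpc).aestronglyMeasurable
      · exact Eventually.of_forall fun y => ae_of_all _ fun s => hbd y t s
      · refine ae_of_all _ fun s => ?_
        have hcont : Continuous fun y : ℝ => φ (t + y * s) * (1 / Real.pi * (1 + s ^ 2)⁻¹) :=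
          (hφ.comp (by fun_prop)).mul continuous_const
        have := hcont.tendsto 0
        simp only [zero_mul, add_zero] at this
        exact this.mono_left nhdsWithin_le_nhds
  refine h2.congr' ?_
  filter_upwards [self_mem_nhdsWithin] with y hy
  exact (hswap y hy).symm

lemma dens_lim {A : ℂ → ℂ} (hA : ContinuousOn A UHP) {φ : ℝ → ℝ} (hφ : Continuous φ)
    (hc : HasCompactSupport φ) (hs : tsupport φ ⊆ regU A) :
    Tendsto (fun y : ℝ => ∫ x, φ x * (-(1 / Real.pi) * (A ((x : ℂ) + y * Complex.I)).im))
      (𝓝[>] 0) (𝓝 (∫ x, φ x * dens A x)) := by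
  set E := extendFrom UHP A with hE
  set B := UHP ∪ (fun x : ℝ => (x : ℂ)) '' regU A with hB
  have hEc : ContinuousOn E B := ext_cont hA
  set j : ℝ × ℝ → ℂ := fun z => (z.1 : ℂ) + z.2 * Complex.I with hj
  have hjc : Continuous j := by fun_prop
  have hjB : ∀ x ∈ tsupport φ, ∀ y : ℝ, 0 ≤ y → j (x, y) ∈ B := by
    intro x hx y hy
    rcases hy.eq_or_lt with h | h
    · right; exact ⟨x, hs hx, by simp [hj, ← h]⟩
    · left
      show 0 < (j (x, y)).im
      simp [hj, h]
  have hK : IsCompact (tsupport φ ×ˢ Icc (0 : ℝ) 1) := IsCompact.prod hc isCompact_Icc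
  have hcK : ContinuousOn (fun z => E (j z)) (tsupport φ ×ˢ Icc (0 : ℝ) 1) :=
    hEc.comp hjc.continuousOn fun z hz => hjB z.1 hz.1 z.2 hz.2.1
  obtain ⟨C, hC⟩ := hK.exists_bound_of_continuousOn hcK
  have hpi : 0 ≤ 1 / Real.pi := by have := Real.pi_pos; positivity
  have ev : ∀ᶠ y : ℝ in 𝓝[>] 0, y ∈ Ioo (0 : ℝ) 1 := Ioo_mem_nhdsGT one_pos
  have huhp : ∀ x y : ℝ, 0 < y → (x : ℂ) + y * Complex.I ∈ UHP := by
    intro x y hy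
    show 0 < ((x : ℂ) + y * Complex.I).im
    simp [hy]
  refine tendsto_integral_filter_of_dominated_convergence
    (fun x => ‖φ x‖ * (1 / Real.pi * C)) ?_ ?_
    ((hφ.integrable_of_hasCompactSupport hc).norm.mul_const _) ?_
  · filter_upwards [ev] with y hy
    refine Continuous.aestronglyMeasurable ?_
    refine hφ.mul (continuous_const.mul (Complex.continuous_im.comp ?_))
    exact hA.comp_continuous (by fun_prop) fun x => huhp x y hy.1
  · filter_upwards [ev] with y hy
    refine ae_of_all _ fun x => ?_
    by_cases hx : x ∈ tsupport φ
    · have h1 := hC (x, y) ⟨hx, hy.1.le, hy.2.le⟩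
      have h2 : E (j (x, y)) = A ((x : ℂ) + y * Complex.I) := ext_eq hA (huhp x y hy.1)
      simp only [h2] at h1
      rw [norm_mul, norm_mul, norm_neg, Real.norm_of_nonneg hpi]
      gcongr
      exact (Complex.abs_im_le_norm _).trans h1
    · rw [image_eq_zero_of_notMem_tsupport hx]; simp
  · refine ae_of_all _ fun x => ?_
    by_cases hx : x ∈ tsupport φ
    · refine tendsto_const_nhds.mul (tendsto_const_nhds.mul ?_)
      refine (Complex.continuous_im.tendsto _).comp ?_
      obtain ⟨a, ha⟩ := (hs hx).2
      have h1 : extendFrom UHP A (x : ℂ) = a :=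
        extendFrom_eq (mem_closure_iff_nhdsWithin_neBot.mpr (neBot_UHP x)) ha
      rw [h1]
      refine ha.comp (tendsto_nhdsWithin_iff.mpr ⟨?_, ?_⟩)
      · have hcy : Continuous fun y : ℝ => (x : ℂ) + y * Complex.I := by fun_prop
        have := hcy.tendsto 0
        simp only [Complex.ofReal_zero, zero_mul, add_zero] at this
        exact this.mono_left nhdsWithin_le_nhds
      · filter_upwards [ev] with y hy
        exact huhp x y hy.1
    · simp only [image_eq_zero_of_notMem_tsupport hx, zero_mul]
      exact tendsto_const_nhds

theorem stieltjes {ρ : Measure ℝ} [IsProbabilityMeasure ρ]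
    (hsym : Measure.map (fun t : ℝ => -t) ρ = ρ) (hA : ContinuousOn (Ar ρ) UHP)
    {φ : ℝ → ℝ} (hφ : Continuous φ)
    (hc : HasCompactSupport φ) (hs : tsupport φ ⊆ regU (Ar ρ)) :
    ∫ t, φ t ∂ρ = ∫ x, φ x * dens (Ar ρ) x := by
  refine tendsto_nhds_unique ((pois_lim (ρ := ρ) hφ hc).congr' ?_) (dens_lim hA hφ hc hs)
  filter_upwards [self_mem_nhdsWithin] with y hy
  simp only [Ar_pois hsym _ hy]

theorem restrict_eq {ρ : Measure ℝ} [IsProbabilityMeasure ρ]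
    (hsym : Measure.map (fun t : ℝ => -t) ρ = ρ) (hA : ContinuousOn (Ar ρ) UHP)
    (hU : IsOpen (regU (Ar ρ))) :
    ρ.restrict (regU (Ar ρ)) =
      (volume.restrict (regU (Ar ρ))).withDensity (fun x => ENNReal.ofReal (dens (Ar ρ) x)) := by
  set U := regU (Ar ρ) with hUdef
  set f := dens (Ar ρ) with hf
  have hfc : ContinuousOn f U := dens_cont hA
  have hf0 : ∀ x ∈ U, 0 ≤ f x := fun x hx => dens_nonneg (fun u hu => Ar_im_neg hu) hx
  have hfU : Continuous (fun x : U => f x) := hfc.domRestrict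
  have hUm : MeasurableSet U := hU.measurableSet
  have hlc : LocallyCompactSpace U := hU.isOpenEmbedding_subtypeVal.locallyCompactSpace
  have : IsFiniteMeasureOnCompacts ((volume : Measure ℝ).comap (Subtype.val : U → ℝ)) :=
    IsFiniteMeasureOnCompacts.comap' _ continuous_subtype_val (MeasurableEmbedding.subtype_coe hUm)
  have : IsFiniteMeasureOnCompacts (ρ.comap (Subtype.val : U → ℝ)) :=
    IsFiniteMeasureOnCompacts.comap' _ continuous_subtype_val (MeasurableEmbedding.subtype_coe hUm)
  have : IsLocallyFiniteMeasure ((volume : Measure ℝ).comap (Subtype.val : U → ℝ)) :=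
    inferInstance
  have : IsLocallyFiniteMeasure (ρ.comap (Subtype.val : U → ℝ)) := inferInstance
  have := IsLocallyFiniteMeasure.withDensity_ofReal
    (μ := (volume : Measure ℝ).comap (Subtype.val : U → ℝ)) hfU
  have key : ρ.comap (Subtype.val : U → ℝ) =
      ((volume : Measure ℝ).comap (Subtype.val : U → ℝ)).withDensity
        (fun x => ENNReal.ofReal (f x)) := by
    refine Measure.ext_of_integral_eq_on_compactlySupported fun g => ?_
    set φ : ℝ → ℝ := Function.extend Subtype.val g 0 with hφdef
    have hφg : ∀ x : U, φ x = g x := fun x => Subtype.val_injective.extend_apply _ _ _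
    have hφ : Continuous φ := HasCompactSupport.continuous_extend_zero hU g.continuous
      g.hasCompactSupport
    have hsub : tsupport φ ⊆ Subtype.val '' tsupport g :=
      HasCompactSupport.tsupport_extend_zero_subset g.hasCompactSupport continuous_subtype_val
    have hsU : tsupport φ ⊆ U := hsub.trans (by rintro _ ⟨x, -, rfl⟩; exact x.2)
    have hcφ : HasCompactSupport φ :=
      (g.hasCompactSupport.isCompact.image continuous_subtype_val).of_isClosed_subset
        (isClosed_tsupport _) hsub
    have h1 := stieltjes hsym hA hφ hcφ hsU
    have h2 : ∫ x : U, g x ∂(ρ.comap Subtype.val) = ∫ t, φ t ∂ρ := by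
      simp only [← hφg]
      rw [integral_subtype_comap hUm]
      exact setIntegral_eq_integral_of_forall_compl_eq_zero fun x hx =>
        image_eq_zero_of_notMem_tsupport fun h => hx (hsU h)
    have h3 : ∫ x : U, g x ∂(((volume : Measure ℝ).comap (Subtype.val : U → ℝ)).withDensity
        (fun x => ENNReal.ofReal (f x))) = ∫ x, φ x * f x := by
      rw [integral_withDensity_eq_integral_toReal_smul
        (f := fun x : U => ENNReal.ofReal (f x))
        (ENNReal.measurable_ofReal.comp hfU.measurable)
        (ae_of_all _ fun x => ENNReal.ofReal_lt_top)]
      have : ∀ x : U, (ENNReal.ofReal (f x)).toReal • g x = φ x * f x := by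
        intro x
        rw [ENNReal.toReal_ofReal (hf0 x x.2), hφg, smul_eq_mul, mul_comm]
      simp only [this]
      rw [integral_subtype_comap hUm (fun x => φ x * f x)]
      refine setIntegral_eq_integral_of_forall_compl_eq_zero fun x hx => ?_
      rw [image_eq_zero_of_notMem_tsupport fun h => hx (hsU h), zero_mul]
    rw [h2, h3, h1]
  have h4 := congrArg (Measure.map (Subtype.val : U → ℝ)) key
  rw [map_comap_subtype_coe hUm] at h4
  rw [h4]
  ext s hs
  rw [Measure.map_apply measurable_subtype_coe hs, withDensity_apply _ (measurable_subtype_coe hs),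
    withDensity_apply _ hs, ← lintegral_indicator hs, ← lintegral_indicator
    (measurable_subtype_coe hs), ← lintegral_subtype_comap hUm]
  rfl

/-- For `μ ≠ δ₀` infinitely divisible and `ρ = μ ⊞_λ ν`, the singular
part of `ρ` (w.r.t. Lebesgue measure) is carried by a closed Lebesgue-null set, and the
absolutely continuous part of `ρ` has a density which is continuous off a closed
Lebesgue-null set. -/
theorem stmt15 (l : ℝ) (hl : l ∈ Set.Ioo (0 : ℝ) 1)
    (μ : Measure ℝ) [IsProbabilityMeasure μ] (hμ0 : μ ≠ Measure.dirac (0 : ℝ))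
    (hμsym : Measure.map (fun t : ℝ => -t) μ = μ)
    (G : Measure ℝ) [IsFiniteMeasure G]
    (hGsym : Measure.map (fun t : ℝ => -t) G = G)
    (hID : IsRectInfDiv l μ G)
    (ν ρ : Measure ℝ) [IsProbabilityMeasure ν] [IsProbabilityMeasure ρ]
    (hνsym : Measure.map (fun t : ℝ => -t) ν = ν)
    (hρsym : Measure.map (fun t : ℝ => -t) ρ = ρ)
    (hconv : IsRectConv l G ν ρ) :
    (∃ S : Set ℝ, IsClosed S ∧ volume S = 0 ∧ ρ.singularPart volume Sᶜ = 0) ∧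
    (∃ S : Set ℝ, IsClosed S ∧ volume S = 0 ∧ ∃ f : ℝ → ℝ, ContinuousOn f Sᶜ ∧
      (volume.withDensity (ρ.rnDeriv volume)).restrict Sᶜ =
        (volume.restrict Sᶜ).withDensity (fun x => ENNReal.ofReal (f x))) := by
  have hG := G_ne_zero hl hμ0 hID
  have hA : ContinuousOn (Ar ρ) UHP := fun u hu => (Ar_diff hu).continuousAt.continuousWithinAt
  have hS : Sol l G ν (Ar ρ) := ⟨hA, fun u hu => Ar_im_neg hu, F_zero hl hconv⟩
  have hU := regU_open hl hG hS
  have hnull := regU_null hl hG hS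
  have hres := restrict_eq hρsym hA hU
  have hUm := hU.measurableSet
  set U := regU (Ar ρ) with hUdef
  have hsing : (ρ.singularPart volume).restrict U = 0 := by
    rw [← Measure.singularPart_restrict _ _ hUm, hres]
    exact Measure.singularPart_eq_zero_of_ac
      ((withDensity_absolutelyContinuous _ _).trans Measure.restrict_le_self.absolutelyContinuous)
  refine ⟨⟨Uᶜ, hU.isClosed_compl, hnull, ?_⟩, ⟨Uᶜ, hU.isClosed_compl, hnull, dens (Ar ρ), ?_, ?_⟩⟩
  · rw [compl_compl]
    exact Measure.restrict_eq_zero.mp hsing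
  · rw [compl_compl]
    exact dens_cont hA
  · rw [compl_compl, ← hres]
    conv_rhs => rw [ρ.haveLebesgueDecomposition_add volume]
    rw [Measure.restrict_add, hsing, zero_add]

end
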